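/- Let D ⊂ ℝ² be a bounded open set with C^{1,α} boundary (for some α > 0) which is either simply connected, or doubly connected with boundary consisting of an outer and an inner Jordan curve; in the doubly connected case let U denote the open region enclosed by the inner boundary curve. Suppose p ∈ C²(D) ∩ C¹(closure of D) satisfies Δp = −2 in D, together with: p = 0 on ∂D in the simply connected case; or p = 0 on the outer boundary, p ≡ c (a constant) on the inner boundary, and ∫_{inner boundary} ∇p·ν dσ = −2·|U| (ν the outward unit normal of U) in the doubly connected case. Then sup_D p ≤ |D|/(2π) and ∫_D p(x) dx ≤ |D|²/(4π), where |D| is the area of D. Moreover, equality holds in either inequality if and only if D is a disk (simply connected case) or an annulus, i.e. the region between two concentric circles (doubly connected case). -/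

import Mathlib

open MeasureTheory Real Set Filter Metric Function Topology

noncomputable section

abbrev E2 := EuclideanSpace ℝ (Fin 2)

def perp2 (x : E2) : E2 := (WithLp.equiv 2 (Fin 2 → ℝ)).symm ![-(x 1), x 0]

def K2 (x : E2) : E2 := (2 * π * ‖x‖ ^ 2)⁻¹ • perp2 x

def dS (cc : Bool) (α β : ℝ) : ℝ := if cc then min |α - β| (1 - |α - β|) else |α - β|

def nv (z : ℝ → E2) (L α : ℝ) : E2 := L⁻¹ • perp2 (deriv z α)

def Rm (z : ℝ → E2) (γ : ℝ → ℝ) (L ε α η : ℝ) : E2 :=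
  z α + (ε * γ α * η) • nv z L α

def Dset (cc : Bool) (z : ℝ → E2) (γ : ℝ → ℝ) (L ε : ℝ) : Set E2 :=
  {x | ∃ α ∈ (if cc then Icc (0:ℝ) 1 else Ioo (0:ℝ) 1), ∃ η ∈ Ioo (-1:ℝ) 0,
    x = Rm z γ L ε α η}

def e2 (i : Fin 2) : E2 := EuclideanSpace.single i (1:ℝ)

def lap (v : E2 → ℝ) (x : E2) : ℝ :=
  fderiv ℝ (fun y => fderiv ℝ v y (e2 0)) x (e2 0) +
  fderiv ℝ (fun y => fderiv ℝ v y (e2 1)) x (e2 1)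

/- STATEMENT 13 -/
def IsDiskOrAnnulus (D : Set E2) : Prop :=
  (∃ x₀ : E2, ∃ r : ℝ, 0 < r ∧ D = Metric.ball x₀ r) ∨
  (∃ x₀ : E2, ∃ r₁ r₂ : ℝ, 0 < r₁ ∧ r₁ < r₂ ∧
    D = {x : E2 | r₁ < dist x x₀ ∧ dist x x₀ < r₂})

section
def rho (z : E2) : ℝ := 1 + z 0 ^ 2 + z 1 ^ 2
lemma rho_pos (z : E2) : 0 < rho z := by unfold rho; positivity
def RK (i j : Fin 2) (z : E2) : ℝ := 2 * (z i * z j) / rho z - (if i = j then 1 else 0)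
def DK (j : Fin 2) (z : E2) : ℝ := z j * (2 / rho z + 4 / rho z ^ 2)
def kK (z : E2) : ℝ := (16 - 4 * rho z) / rho z ^ 3

lemma contDiff_coord (i : Fin 2) {n : WithTop ℕ∞} : ContDiff ℝ n (fun z : E2 => z i) :=
  (EuclideanSpace.proj (𝕜 := ℝ) i : E2 →L[ℝ] ℝ).contDiff

lemma contDiff_rho {n : WithTop ℕ∞} : ContDiff ℝ n rho := by
  unfold rho
  exact (contDiff_const.add ((contDiff_coord 0).pow 2)).add ((contDiff_coord 1).pow 2)

lemma contDiff_RK (i j : Fin 2) : ContDiff ℝ 1 (RK i j) := by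
  unfold RK
  exact ((contDiff_const.mul ((contDiff_coord i).mul (contDiff_coord j))).div contDiff_rho
    (fun z => (rho_pos z).ne')).sub contDiff_const

lemma contDiff_DK (j : Fin 2) : ContDiff ℝ 1 (DK j) := by
  unfold DK
  exact (contDiff_coord j).mul ((contDiff_const.div contDiff_rho
    (fun z => (rho_pos z).ne')).add (contDiff_const.div (contDiff_rho.pow 2)
    (fun z => (pow_pos (rho_pos z) 2).ne')))

lemma contDiff_kK : ContDiff ℝ 1 kK := by
  unfold kK
  exact (contDiff_const.sub (contDiff_const.mul contDiff_rho)).div (contDiff_rho.pow 3)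
    (fun z => (pow_pos (rho_pos z) 3).ne')

/-- directional derivative from a one-variable derivative -/
lemma fderiv_of_line {f : E2 → ℝ} (hf : ContDiff ℝ 1 f) (z v : E2) {d : ℝ}
    (h : HasDerivAt (fun t : ℝ => f (z + t • v)) d 0) : fderiv ℝ f z v = d := by
  have h1 := (hf.differentiable one_ne_zero z).lineDeriv_eq_fderiv (v := v)
  rw [← h1]; exact h.deriv

lemma coord_line (z : E2) (i j : Fin 2) :
    HasDerivAt (fun t : ℝ => (z + t • e2 i) j) (if j = i then 1 else 0) 0 := by
  have : (fun t : ℝ => (z + t • e2 i) j) = fun t => z j + t * (if j = i then 1 else 0) := by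
    funext t; simp [e2]
  rw [this]
  simpa using ((hasDerivAt_id (0:ℝ)).mul_const (if j = i then (1:ℝ) else 0)).const_add (z j)

lemma rho_line (z : E2) (i : Fin 2) :
    HasDerivAt (fun t : ℝ => rho (z + t • e2 i)) (2 * z i) 0 := by
  unfold rho
  have h0 := (coord_line z i 0).pow 2
  have h1 := (coord_line z i 1).pow 2
  have := (h0.const_add 1).add h1
  refine this.congr_deriv ?_
  fin_cases i <;> simp

lemma RK_line (z : E2) (i j : Fin 2) (k : Fin 2) :
    fderiv ℝ (RK i j) z (e2 k) = (2 * ((if i = k then 1 else 0) * z j + z i * (if j = k then 1 else 0)) * rho z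
      - 2 * (z i * z j) * (2 * z k)) / rho z ^ 2 := by
  apply fderiv_of_line (contDiff_RK i j)
  unfold RK
  have h := ((((coord_line z k i).mul (coord_line z k j)).const_mul 2).div (rho_line z k)
    (by simpa using (rho_pos z).ne')).sub_const (if i = j then 1 else 0)
  refine h.congr_deriv ?_
  simp

lemma div_RK (z : E2) (j : Fin 2) :
    fderiv ℝ (RK 0 j) z (e2 0) + fderiv ℝ (RK 1 j) z (e2 1) = DK j z := by
  rw [RK_line, RK_line]
  have := rho_pos z
  unfold DK
  have h : rho z = 1 + z 0 ^ 2 + z 1 ^ 2 := rfl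
  rw [← add_div, div_eq_iff (by positivity)]
  field_simp
  rw [h]
  fin_cases j <;> simp <;> ring

lemma DK_line (z : E2) (j : Fin 2) :
    fderiv ℝ (DK j) z (e2 j) = (2 / rho z + 4 / rho z ^ 2) +
      z j * (-(2 * (2 * z j)) / rho z ^ 2 - 4 * (2 * rho z * (2 * z j)) / rho z ^ 4) := by
  apply fderiv_of_line (contDiff_DK j)
  unfold DK
  have hr := rho_line z j
  have hne : rho (z + (0:ℝ) • e2 j) ≠ 0 := by simpa using (rho_pos z).ne'
  have h := (coord_line z j j).mul (((hasDerivAt_const (0:ℝ) (2:ℝ)).div hr hne).add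
    ((hasDerivAt_const (0:ℝ) (4:ℝ)).div (hr.pow 2) (pow_ne_zero 2 hne)))
  refine h.congr_deriv ?_
  simp
  left
  ring

lemma div_DK (z : E2) :
    fderiv ℝ (DK 0) z (e2 0) + fderiv ℝ (DK 1) z (e2 1) = kK z := by
  rw [DK_line, DK_line]
  have := rho_pos z
  unfold kK
  have h : rho z = 1 + z 0 ^ 2 + z 1 ^ 2 := rfl
  have h2 : z 1 ^ 2 = rho z - 1 - z 0 ^ 2 := by rw [h]; ring
  field_simp
  ring_nf
  rw [h2]
  ring

lemma clm_norm_sq (L : E2 →L[ℝ] ℝ) : ‖L‖ ^ 2 = L (e2 0) ^ 2 + L (e2 1) ^ 2 := by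
  obtain ⟨v, rfl⟩ := (InnerProductSpace.toDual ℝ E2).surjective L
  rw [LinearIsometryEquiv.norm_map, EuclideanSpace.norm_sq_eq]
  simp [e2, Fin.sum_univ_two, EuclideanSpace.inner_single_right]

lemma quad_bound (a0 a1 b0 b1 z0 z1 : ℝ) :
    -(a0 * (2 * (z0 * z0) / (1 + z0^2 + z1^2) - 1) * b0 + a1 * (2 * (z1 * z0) / (1 + z0^2 + z1^2)) * b0
     + (a0 * (2 * (z0 * z1) / (1 + z0^2 + z1^2)) * b1 + a1 * (2 * (z1 * z1) / (1 + z0^2 + z1^2) - 1) * b1))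
    ≤ √(a0 ^ 2 + a1 ^ 2) * √(b0 ^ 2 + b1 ^ 2) := by
  have hr : 0 < 1 + z0 ^ 2 + z1 ^ 2 := by positivity
  rw [← Real.sqrt_mul (by positivity)]
  apply Real.le_sqrt_of_sq_le
  set c0 := b0 - 2 * z0 * (z0 * b0 + z1 * b1) / (1 + z0^2 + z1^2) with hc0
  set c1 := b1 - 2 * z1 * (z0 * b0 + z1 * b1) / (1 + z0^2 + z1^2) with hc1
  have e1 : -(a0 * (2 * (z0 * z0) / (1 + z0^2 + z1^2) - 1) * b0 + a1 * (2 * (z1 * z0) / (1 + z0^2 + z1^2)) * b0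
     + (a0 * (2 * (z0 * z1) / (1 + z0^2 + z1^2)) * b1 + a1 * (2 * (z1 * z1) / (1 + z0^2 + z1^2) - 1) * b1))
     = a0 * c0 + a1 * c1 := by
    rw [hc0, hc1]; field_simp; ring
  have e2 : c0 ^ 2 + c1 ^ 2 = b0 ^ 2 + b1 ^ 2 - 4 * (z0 * b0 + z1 * b1) ^ 2 / (1 + z0^2 + z1^2) ^ 2 := by
    rw [hc0, hc1]; field_simp; ring
  have e3 : 0 ≤ 4 * (z0 * b0 + z1 * b1) ^ 2 / (1 + z0^2 + z1^2) ^ 2 := by positivity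
  rw [e1]
  calc (a0 * c0 + a1 * c1) ^ 2 ≤ (a0 ^ 2 + a1 ^ 2) * (c0 ^ 2 + c1 ^ 2) := by nlinarith [sq_nonneg (a0 * c1 - a1 * c0)]
    _ ≤ _ := mul_le_mul_of_nonneg_left (by linarith) (by positivity)

end

section
lemma cont_fd {u : E2 → ℝ} (hu : ContDiff ℝ 1 u) (e : E2) : Continuous (fun x => fderiv ℝ u x e) :=
  (hu.continuous_fderiv one_ne_zero).clm_apply continuous_const

lemma hcs_fd {u : E2 → ℝ} (hc : HasCompactSupport u) (e : E2) :
    HasCompactSupport (fun x => fderiv ℝ u x e) := hc.fderiv_apply (𝕜 := ℝ) e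

lemma ibp1 {u K : E2 → ℝ} (hu : ContDiff ℝ 1 u) (hc : HasCompactSupport u) (hK : ContDiff ℝ 1 K)
    (e : E2) : ∫ x, K x * fderiv ℝ u x e = -∫ x, fderiv ℝ K x e * u x := by
  apply integral_mul_fderiv_eq_neg_fderiv_mul_of_integrable
  · exact ((cont_fd hK e).mul hu.continuous).integrable_of_hasCompactSupport hc.mul_left
  · exact (hK.continuous.mul (cont_fd hu e)).integrable_of_hasCompactSupport (hcs_fd hc e).mul_left
  · exact (hK.continuous.mul hu.continuous).integrable_of_hasCompactSupport hc.mul_left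
  · intro x _; exact hK.differentiable one_ne_zero x
  · intro x _; exact hu.differentiable one_ne_zero x

lemma fd_const_sub {K : E2 → ℝ} (hK : ContDiff ℝ 1 K) (x y e : E2) :
    fderiv ℝ (fun y => K (x - y)) y e = - fderiv ℝ K (x - y) e := by
  have h1 : HasFDerivAt (fun y : E2 => x - y) (-(ContinuousLinearMap.id ℝ E2)) y :=
    (hasFDerivAt_id y).const_sub x
  have h2 := ((hK.differentiable one_ne_zero (x - y)).hasFDerivAt).comp y h1
  have h3 := h2.fderiv
  change fderiv ℝ (K ∘ fun y => x - y) y e = _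
  rw [h3]; simp

lemma hcs_prod {f g : E2 → ℝ} (hf : HasCompactSupport f) (hg : HasCompactSupport g) (k : E2 → E2 → ℝ) :
    HasCompactSupport (Function.uncurry fun x y => f x * g y * k x y) := by
  apply HasCompactSupport.intro (hf.isCompact.prod hg.isCompact)
  rintro ⟨x, y⟩ hxy
  simp only [Set.mem_prod, not_and_or] at hxy
  simp only [Function.uncurry]
  rcases hxy with h | h
  · rw [image_eq_zero_of_notMem_tsupport h]; simp
  · rw [image_eq_zero_of_notMem_tsupport h]; simp

lemma step1 {u : E2 → ℝ} (hu : ContDiff ℝ 1 u) (hc : HasCompactSupport u) (j : Fin 2) (y : E2) :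
    ∫ x, (fderiv ℝ u x (e2 0) * RK 0 j (x - y) + fderiv ℝ u x (e2 1) * RK 1 j (x - y))
      = - ∫ x, u x * DK j (x - y) := by
  have hs : ∀ i, ContDiff ℝ 1 (fun x => RK i j (x - y)) := fun i =>
    (contDiff_RK i j).comp (contDiff_id.sub contDiff_const)
  have hi : ∀ i, Integrable (fun x => fderiv ℝ u x (e2 i) * RK i j (x - y)) := fun i =>
    ((cont_fd hu _).mul (hs i).continuous).integrable_of_hasCompactSupport (hcs_fd hc _).mul_right
  have hi' : ∀ i, Integrable (fun x => fderiv ℝ (RK i j) (x - y) (e2 i) * u x) := fun i => by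
    have := (cont_fd (hs i) (e2 i)).mul hu.continuous
    simp only [fderiv_comp_sub] at this
    exact this.integrable_of_hasCompactSupport hc.mul_left
  rw [integral_add (hi 0) (hi 1)]
  have h : ∀ i, ∫ x, fderiv ℝ u x (e2 i) * RK i j (x - y) = - ∫ x, fderiv ℝ (RK i j) (x - y) (e2 i) * u x := by
    intro i
    have := ibp1 hu hc (hs i) (e2 i)
    simp only [fderiv_comp_sub] at this
    rw [← this]; congr 1; funext x; ring
  rw [h 0, h 1, ← neg_add, ← integral_add (hi' 0) (hi' 1)]
  congr 2; funext x; rw [← add_mul, div_RK]; ring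

lemma step2 {u : E2 → ℝ} (hu : ContDiff ℝ 1 u) (hc : HasCompactSupport u) (x : E2) :
    ∫ y, (fderiv ℝ u y (e2 0) * DK 0 (x - y) + fderiv ℝ u y (e2 1) * DK 1 (x - y))
      = ∫ y, u y * kK (x - y) := by
  have hs : ∀ i, ContDiff ℝ 1 (fun y => DK i (x - y)) := fun i =>
    (contDiff_DK i).comp (contDiff_const.sub contDiff_id)
  have hi : ∀ i, Integrable (fun y => fderiv ℝ u y (e2 i) * DK i (x - y)) := fun i =>
    ((cont_fd hu _).mul (hs i).continuous).integrable_of_hasCompactSupport (hcs_fd hc _).mul_right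
  have hi' : ∀ i, Integrable (fun y => -fderiv ℝ (DK i) (x - y) (e2 i) * u y) := fun i => by
    have := (cont_fd (hs i) (e2 i)).mul hu.continuous
    simp only [fd_const_sub (contDiff_DK i)] at this
    exact this.integrable_of_hasCompactSupport hc.mul_left
  rw [integral_add (hi 0) (hi 1)]
  have h : ∀ i, ∫ y, fderiv ℝ u y (e2 i) * DK i (x - y) = - ∫ y, -fderiv ℝ (DK i) (x - y) (e2 i) * u y := by
    intro i
    have := ibp1 hu hc (hs i) (e2 i)
    simp only [fd_const_sub (contDiff_DK i)] at this
    rw [← this]; congr 1; funext x; ring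
  rw [h 0, h 1, ← neg_add, ← integral_add (hi' 0) (hi' 1), ← integral_neg]
  congr 1; funext y; rw [← div_DK]; ring

/-- the quadratic form -/
def QF (u : E2 → ℝ) (x y : E2) : ℝ :=
  (fderiv ℝ u x (e2 0) * RK 0 0 (x - y) * fderiv ℝ u y (e2 0)
   + fderiv ℝ u x (e2 1) * RK 1 0 (x - y) * fderiv ℝ u y (e2 0))
   + (fderiv ℝ u x (e2 0) * RK 0 1 (x - y) * fderiv ℝ u y (e2 1)
   + fderiv ℝ u x (e2 1) * RK 1 1 (x - y) * fderiv ℝ u y (e2 1))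

lemma fd_norm (u : E2 → ℝ) (x : E2) :
    ‖fderiv ℝ u x‖ = √((fderiv ℝ u x (e2 0)) ^ 2 + (fderiv ℝ u x (e2 1)) ^ 2) := by
  rw [← clm_norm_sq, Real.sqrt_sq (norm_nonneg _)]

lemma QF_bound (u : E2 → ℝ) (x y : E2) : - QF u x y ≤ ‖fderiv ℝ u x‖ * ‖fderiv ℝ u y‖ := by
  rw [fd_norm, fd_norm]
  refine le_trans (le_of_eq ?_) (quad_bound _ _ _ _ ((x - y) 0) ((x - y) 1))
  simp [QF, RK, rho]

lemma QF_int {u : E2 → ℝ} (hu : ContDiff ℝ 1 u) (hc : HasCompactSupport u) :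
    ∫ y, ∫ x, - QF u x y = ∫ x, ∫ y, u x * u y * kK (x - y) := by
  have hcu := hu.continuous
  have hb : ∀ j y, ∫ x, (fderiv ℝ u x (e2 0) * RK 0 j (x - y) * fderiv ℝ u y (e2 j)
      + fderiv ℝ u x (e2 1) * RK 1 j (x - y) * fderiv ℝ u y (e2 j))
      = - ∫ x, u x * fderiv ℝ u y (e2 j) * DK j (x - y) := by
    intro j y
    have h1 := congrArg (· * fderiv ℝ u y (e2 j)) (step1 hu hc j y)
    simp only [neg_mul] at h1
    rw [← integral_mul_const, ← integral_mul_const] at h1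
    have a1 : (fun x => (fderiv ℝ u x (e2 0) * RK 0 j (x - y) * fderiv ℝ u y (e2 j)
      + fderiv ℝ u x (e2 1) * RK 1 j (x - y) * fderiv ℝ u y (e2 j))) = fun x =>
      (fderiv ℝ u x (e2 0) * RK 0 j (x - y) + fderiv ℝ u x (e2 1) * RK 1 j (x - y)) * fderiv ℝ u y (e2 j) := by
      funext x; ring
    have a2 : (fun x => u x * fderiv ℝ u y (e2 j) * DK j (x - y)) = fun x => u x * DK j (x - y) * fderiv ℝ u y (e2 j) := by
      funext x; ring
    rw [a1, a2, h1]
  have hRi : ∀ i j y, Integrable (fun x => fderiv ℝ u x (e2 i) * RK i j (x - y) * fderiv ℝ u y (e2 j)) := by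
    intro i j y
    have := (contDiff_RK i j).continuous
    have := cont_fd hu (e2 i)
    exact Continuous.integrable_of_hasCompactSupport (by fun_prop) (hcs_fd hc _).mul_right.mul_right
  have e1 : ∀ y, ∫ x, - QF u x y = (∫ x, u x * fderiv ℝ u y (e2 0) * DK 0 (x - y))
      + ∫ x, u x * fderiv ℝ u y (e2 1) * DK 1 (x - y) := by
    intro y
    unfold QF
    have b1 : ∀ j, Integrable (fun x => (fderiv ℝ u x (e2 0) * RK 0 j (x - y) * fderiv ℝ u y (e2 j)
      + fderiv ℝ u x (e2 1) * RK 1 j (x - y) * fderiv ℝ u y (e2 j))) := fun j => (hRi 0 j y).add (hRi 1 j y)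
    rw [integral_neg, integral_add (b1 0) (b1 1), hb, hb]
    ring
  simp_rw [e1]
  have hDc : ∀ j, Continuous (Function.uncurry fun x y => u x * fderiv ℝ u y (e2 j) * DK j (x - y)) := by
    intro j
    have := (contDiff_DK j).continuous
    have := cont_fd hu (e2 j)
    simp only [Function.uncurry_def]
    fun_prop
  have hDs : ∀ j, HasCompactSupport (Function.uncurry fun x y => u x * fderiv ℝ u y (e2 j) * DK j (x - y)) :=
    fun j => hcs_prod hc (hcs_fd hc _) _
  have hDi : ∀ j, Integrable (Function.uncurry fun x y => u x * fderiv ℝ u y (e2 j) * DK j (x - y))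
     ((volume : Measure E2).prod volume) :=
    fun j => (hDc j).integrable_of_hasCompactSupport (hDs j)
  have c1 : ∀ j, Integrable (fun y => ∫ x, u x * fderiv ℝ u y (e2 j) * DK j (x - y)) := fun j =>
    (hDi j).integral_prod_right
  have c2 : ∀ j, Integrable (fun x => ∫ y, u x * fderiv ℝ u y (e2 j) * DK j (x - y)) := fun j =>
    (hDi j).integral_prod_left
  rw [integral_add (c1 0) (c1 1),
    ← integral_integral_swap_of_hasCompactSupport (hDc 0) (hDs 0),
    ← integral_integral_swap_of_hasCompactSupport (hDc 1) (hDs 1),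
    ← integral_add (c2 0) (c2 1)]
  congr 1; funext x
  have hi : ∀ i, Integrable (fun y => u x * fderiv ℝ u y (e2 i) * DK i (x - y)) := fun i => by
    have := (contDiff_DK i).continuous
    have := cont_fd hu (e2 i)
    exact Continuous.integrable_of_hasCompactSupport (by fun_prop) (hcs_fd hc _).mul_left.mul_right
  rw [← integral_add (hi 0) (hi 1)]
  have := congrArg (u x * ·) (step2 hu hc x)
  rw [← integral_const_mul, ← integral_const_mul] at this
  calc _ = ∫ a, u x * ((fderiv ℝ u a) (e2 0) * DK 0 (x - a) + (fderiv ℝ u a) (e2 1) * DK 1 (x - a)) := by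
        congr 1; funext y; ring
    _ = _ := this
    _ = _ := by congr 1; funext y; ring

lemma sob1 {u : E2 → ℝ} (hu : ContDiff ℝ 1 u) (hc : HasCompactSupport u) :
    ∫ x, ∫ y, u x * u y * kK (x - y) ≤ (∫ x, ‖fderiv ℝ u x‖) ^ 2 := by
  rw [← QF_int hu hc]
  have hcf : Continuous (fderiv ℝ u) := hu.continuous_fderiv one_ne_zero
  have hfi : Integrable (fun x => ‖fderiv ℝ u x‖) :=
    hcf.norm.integrable_of_hasCompactSupport (hc.fderiv (𝕜 := ℝ)).norm
  have hQ : Integrable (Function.uncurry fun y x => - QF u x y) ((volume : Measure E2).prod volume) := by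
    apply Continuous.integrable_of_hasCompactSupport
    · have h1 := (contDiff_RK 0 0).continuous
      have h2 := (contDiff_RK 0 1).continuous
      have h3 := (contDiff_RK 1 0).continuous
      have h4 := (contDiff_RK 1 1).continuous
      have h5 := cont_fd hu (e2 0)
      have h6 := cont_fd hu (e2 1)
      simp only [Function.uncurry_def, QF]
      fun_prop
    · apply HasCompactSupport.intro (hc.isCompact.prod hc.isCompact)
      rintro ⟨y, x⟩ hxy
      simp only [Set.mem_prod, not_and_or] at hxy
      have hz : ∀ z, z ∉ tsupport u → fderiv ℝ u z = 0 := fun z hz =>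
        fderiv_of_notMem_tsupport ℝ hz
      simp only [Function.uncurry, QF]
      rcases hxy with h | h
      · rw [hz _ h]; simp
      · rw [hz _ h]; simp
  have h2 : (∫ x, ‖fderiv ℝ u x‖) ^ 2 = ∫ y, ∫ x, ‖fderiv ℝ u x‖ * ‖fderiv ℝ u y‖ := by
    simp_rw [integral_mul_const, integral_const_mul]
    ring
  rw [h2]
  have hP : Integrable (Function.uncurry fun y x => ‖fderiv ℝ u x‖ * ‖fderiv ℝ u y‖) ((volume : Measure E2).prod volume) := by
    have := hfi.mul_prod hfi
    refine this.congr (Eventually.of_forall ?_)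
    rintro ⟨a, b⟩; simp [mul_comm]
  apply integral_mono hQ.integral_prod_left hP.integral_prod_left
  intro y
  apply integral_mono_ae
  · refine Continuous.integrable_of_hasCompactSupport (f := fun x => - QF u x y) ?_ ?_
    · have h1 := (contDiff_RK 0 0).continuous
      have h2 := (contDiff_RK 0 1).continuous
      have h3 := (contDiff_RK 1 0).continuous
      have h4 := (contDiff_RK 1 1).continuous
      have h5 := cont_fd hu (e2 0)
      have h6 := cont_fd hu (e2 1)
      simp only [QF]
      fun_prop
    · apply HasCompactSupport.intro hc.isCompact
      intro x hx
      have : fderiv ℝ u x = 0 := fderiv_of_notMem_tsupport ℝ hx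
      simp [QF, this]
  · exact hfi.mul_const ‖fderiv ℝ u y‖
  · exact Eventually.of_forall fun x => QF_bound u x y
end

section
lemma finrank_E2 : Module.finrank ℝ E2 = 2 := by simp [E2]

lemma sob_scale {u : E2 → ℝ} (hu : ContDiff ℝ 1 u) (hc : HasCompactSupport u) {l : ℝ} (hl : 0 < l) :
    ∫ x, ∫ z, u x * u (x - l • z) * kK z ≤ (∫ x, ‖fderiv ℝ u x‖) ^ 2 := by
  have h := sob1 (u := fun x => u (l • x)) (hu.comp (contDiff_id.const_smul l))
    (hc.comp_smul hl.ne')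
  have e1 : ∫ x, ‖fderiv ℝ (fun x => u (l • x)) x‖ = l⁻¹ * ∫ x, ‖fderiv ℝ u x‖ := by
    have : ∀ x, ‖fderiv ℝ (fun x => u (l • x)) x‖ = l * ‖fderiv ℝ u (l • x)‖ := by
      intro x
      rw [fderiv_comp_smul, norm_smul, Real.norm_of_nonneg hl.le]
    simp_rw [this]
    rw [integral_const_mul, Measure.integral_comp_smul volume (fun x => ‖fderiv ℝ u x‖) l, finrank_E2,
      abs_of_pos (by positivity)]
    simp only [smul_eq_mul]
    field_simp
  have e2 : ∫ x, ∫ y, u (l • x) * u (l • y) * kK (x - y) = (l⁻¹)^2 * ∫ x, ∫ z, u x * u (x - l • z) * kK z := by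
    have : ∀ x, ∫ y, u (l • x) * u (l • y) * kK (x - y) = ∫ z, u (l • x) * u (l • x - l • z) * kK z := by
      intro x
      rw [← integral_sub_left_eq_self _ volume x]
      congr 1; funext z
      rw [smul_sub]; simp
    simp_rw [this]
    rw [Measure.integral_comp_smul volume (fun x => ∫ z, u x * u (x - l • z) * kK z) l, finrank_E2,
      abs_of_pos (by positivity)]
    simp
  rw [e1, e2, mul_pow] at h
  exact le_of_mul_le_mul_left h (by positivity)

lemma rho_eq (z : E2) : rho z = 1 + ‖z‖ ^ 2 := by
  rw [EuclideanSpace.norm_sq_eq, Fin.sum_univ_two]; simp [rho]; ring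

lemma kK_bound (z : E2) : |kK z| ≤ 16 * (1 + ‖z‖ ^ 2) ^ (-(4:ℝ) / 2) := by
  have h : (1 + ‖z‖ ^ 2) ^ (-(4:ℝ) / 2) = 1 / rho z ^ 2 := by
    rw [rho_eq, show (-(4:ℝ)/2) = -(2:ℕ) by norm_num, Real.rpow_neg (by positivity), Real.rpow_natCast]
    simp
  rw [h]
  unfold kK
  have h1 : 1 ≤ rho z := by rw [rho_eq]; nlinarith [sq_nonneg ‖z‖]
  rw [abs_div, abs_of_pos (a := rho z ^ 3) (by positivity), div_le_iff₀ (by positivity)]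
  have : 16 * (1 / rho z ^ 2) * rho z ^ 3 = 16 * rho z := by field_simp
  rw [this, abs_le]
  constructor <;> linarith

lemma kK_int : Integrable kK := by
  have h := (integrable_rpow_neg_one_add_norm_sq (E := E2) (μ := volume) (r := 4)
    (by rw [finrank_E2]; norm_num)).const_mul 16
  refine h.mono' contDiff_kK.continuous.aestronglyMeasurable (Eventually.of_forall fun z => ?_)
  exact kK_bound z

lemma kK_total : ∫ z, kK z = 4 * π := by
  have hk : ∀ z : E2, kK z = (fun y : ℝ => (16 - 4 * (1 + y ^ 2)) / (1 + y ^ 2) ^ 3) ‖z‖ := by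
    intro z; simp only [kK, rho_eq]
  have hi := kK_int
  have hk' : kK = fun z => (fun y : ℝ => (16 - 4 * (1 + y ^ 2)) / (1 + y ^ 2) ^ 3) ‖z‖ := funext hk
  rw [hk'] at hi ⊢
  rw [integrable_fun_norm_addHaar (E := E2) volume (f := fun y : ℝ => (16 - 4 * (1 + y ^ 2)) / (1 + y ^ 2) ^ 3)] at hi
  rw [integral_fun_norm_addHaar volume (fun y : ℝ => (16 - 4 * (1 + y ^ 2)) / (1 + y ^ 2) ^ 3)]
  rw [finrank_E2] at hi ⊢
  have hv : (volume : Measure E2).real (ball 0 1) = π := by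
    rw [Measure.real, EuclideanSpace.volume_ball_fin_two]
    simp [Real.pi_pos.le]
  rw [hv]
  have hI := integral_Ioi_of_hasDerivAt_of_tendsto (a := 0) (m := 0)
    (f := fun y : ℝ => (-4 / (1 + y ^ 2) ^ 2 + 2 / (1 + y^2)))
    (f' := fun y : ℝ => y ^ (2 - 1) • ((16 - 4 * (1 + y ^ 2)) / (1 + y ^ 2) ^ 3)) ?_ ?_ hi ?_
  · rw [hI]; norm_num; ring
  · apply Continuous.continuousWithinAt
    refine (continuous_const.div (by fun_prop) ?_).add (continuous_const.div (by fun_prop) ?_)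
    · intro y; positivity
    · intro y; positivity
  · intro y _
    have h1 : HasDerivAt (fun y : ℝ => 1 + y ^ 2) (2 * y) y := by
      simpa using (hasDerivAt_pow 2 y).const_add 1
    have h := ((hasDerivAt_const y (-4:ℝ)).div (h1.pow 2) (by simp; positivity)).add
      ((hasDerivAt_const y (2:ℝ)).div h1 (by positivity))
    refine h.congr_deriv ?_
    have : (0:ℝ) < 1 + y ^ 2 := by positivity
    simp
    field_simp
    ring
  · have ht : Tendsto (fun y : ℝ => 1 + y ^ 2) atTop atTop :=
      tendsto_atTop_add_const_left _ _ (tendsto_pow_atTop two_ne_zero)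
    have h1 : Tendsto (fun y : ℝ => -4 / (1 + y ^ 2) ^ 2) atTop (𝓝 0) :=
      tendsto_const_nhds.div_atTop ((tendsto_pow_atTop two_ne_zero).comp ht)
    have h2 : Tendsto (fun y : ℝ => 2 / (1 + y ^ 2)) atTop (𝓝 0) :=
      tendsto_const_nhds.div_atTop ht
    simpa using h1.add h2

theorem sobolev {u : E2 → ℝ} (hu : ContDiff ℝ 1 u) (hc : HasCompactSupport u) :
    4 * π * ∫ x, u x ^ 2 ≤ (∫ x, ‖fderiv ℝ u x‖) ^ 2 := by
  have hcu := hu.continuous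
  have hck := contDiff_kK.continuous
  obtain ⟨C, hC⟩ := hc.exists_bound_of_continuous hcu
  have hui : Integrable u := hcu.integrable_of_hasCompactSupport hc
  let F : ℕ → E2 × E2 → ℝ := fun n q => u q.1 * u (q.1 - (1 / ((n:ℝ) + 1)) • q.2) * kK q.2
  have hb : Integrable (fun q : E2 × E2 => (C * |u q.1|) * |kK q.2|) ((volume : Measure E2).prod volume) :=
    (hui.abs.const_mul C).mul_prod kK_int.abs
  have hFb : ∀ n, ∀ q, ‖F n q‖ ≤ (C * |u q.1|) * |kK q.2| := by
    intro n q
    simp only [F, norm_mul, Real.norm_eq_abs]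
    rw [mul_comm C]
    gcongr
    exact hC _
  have hFc : ∀ n, Continuous (F n) := by intro n; simp only [F]; fun_prop
  have hFi : ∀ n, Integrable (F n) ((volume : Measure E2).prod volume) := fun n =>
    hb.mono' (hFc n).aestronglyMeasurable (Eventually.of_forall (hFb n))
  have hlim : Tendsto (fun n => ∫ q, F n q ∂((volume : Measure E2).prod volume)) atTop
      (𝓝 (∫ q, (u q.1 ^ 2) * kK q.2 ∂((volume : Measure E2).prod volume))) := by
    apply tendsto_integral_of_dominated_convergence _ (fun n => (hFc n).aestronglyMeasurable) hb
    · intro n; exact Eventually.of_forall (hFb n)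
    · refine Eventually.of_forall fun q => ?_
      have h0 : Tendsto (fun n : ℕ => q.1 - (1 / ((n:ℝ) + 1)) • q.2) atTop (𝓝 (q.1 - (0:ℝ) • q.2)) :=
        tendsto_const_nhds.sub (tendsto_one_div_add_atTop_nhds_zero_nat.smul_const _)
      have h1 := (hcu.tendsto _).comp h0
      simp only [zero_smul, sub_zero] at h1
      have h2 := (h1.const_mul (u q.1)).mul_const (kK q.2)
      simpa [F, sq, Function.comp_def] using h2
  rw [integral_prod_mul (fun x => u x ^ 2) kK, kK_total, mul_comm] at hlim
  refine le_of_tendsto hlim (Eventually.of_forall fun n => ?_)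
  rw [integral_prod _ (hFi n)]
  exact sob_scale hu hc (by positivity)
end

section
/-- Cutoff profile. -/
def trap (t s e r : ℝ) : ℝ := max 0 (min 1 (min (r - t) (s - r) / e))

lemma trap_cont (t s e : ℝ) : Continuous (trap t s e) := by
  unfold trap; fun_prop
lemma trap_nonneg (t s e r : ℝ) : 0 ≤ trap t s e r := le_max_left _ _
lemma trap_le_one (t s e r : ℝ) : trap t s e r ≤ 1 := max_le zero_le_one (min_le_left _ _)
lemma trap_zero_left {t s e r : ℝ} (he : 0 < e) (h : r ≤ t) : trap t s e r = 0 := by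
  unfold trap
  apply max_eq_left
  refine le_trans (min_le_right _ _) ?_
  apply div_nonpos_of_nonpos_of_nonneg _ he.le
  exact le_trans (min_le_left _ _) (by linarith)
lemma trap_zero_right {t s e r : ℝ} (he : 0 < e) (h : s ≤ r) : trap t s e r = 0 := by
  unfold trap
  apply max_eq_left
  refine le_trans (min_le_right _ _) ?_
  apply div_nonpos_of_nonpos_of_nonneg _ he.le
  exact le_trans (min_le_right _ _) (by linarith)
lemma trap_one {t s e r : ℝ} (he : 0 < e) (h1 : t + e ≤ r) (h2 : r ≤ s - e) : trap t s e r = 1 := by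
  unfold trap
  have : 1 ≤ min (r - t) (s - r) / e := by
    rw [le_div_iff₀ he, one_mul]; apply le_min <;> linarith
  rw [min_eq_left this]; simp

/-- The abstract level-set set-up. -/
structure Core (q : E2 → ℝ) (I : Set ℝ) : Prop where
  opn : IsOpen {x | q x ∈ I}
  diff : ContDiffOn ℝ 1 q {x | q x ∈ I}
  meas : Measurable q
  fin : ∀ t ∈ I, volume {x | t < q x} ≠ ⊤
  weak : ∀ t ∈ I, ∀ s ∈ I, t < s → ∀ ψ : ℝ → ℝ, Continuous ψ → (∀ r, 0 ≤ ψ r) →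
    (∀ r, r ≤ t → ψ r = 0) → (∀ r, s ≤ r → ψ r = 0) →
    ContDiff ℝ 1 (fun x => ∫ y in t..(q x), ψ y) ∧ HasCompactSupport (fun x => ∫ y in t..(q x), ψ y) ∧
    (∀ x, fderiv ℝ (fun x => ∫ y in t..(q x), ψ y) x = ψ (q x) • fderiv ℝ q x) ∧
    ∫ x, ψ (q x) * ‖fderiv ℝ q x‖ ^ 2 = 2 * ∫ x, ∫ y in t..(q x), ψ y

def lev (q : E2 → ℝ) (t : ℝ) : ℝ := volume.real {x | t < q x}

lemma lev_nonneg (q : E2 → ℝ) (t : ℝ) : 0 ≤ lev q t := measureReal_nonneg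

lemma hcs_sq {f : E2 → ℝ} (hf : HasCompactSupport f) : HasCompactSupport (fun x => f x ^ 2) := by
  have h : (fun x => f x ^ 2) = f * f := by ext x; simp [sq]
  rw [h]; exact hf.mul_left

section
variable {q : E2 → ℝ} {I : Set ℝ}

lemma Core.lev_anti (H : Core q I) {t s : ℝ} (ht : t ∈ I) (hts : t ≤ s) : lev q s ≤ lev q t := by
  apply measureReal_mono _ (H.fin t ht)
  intro x hx; exact lt_of_le_of_lt hts hx

lemma Core.int_sq (H : Core q I) {t s : ℝ} (ht : t ∈ I) (hs : s ∈ I) (hts : t < s)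
    {ψ : ℝ → ℝ} (hc : Continuous ψ) (h0 : ∀ r, 0 ≤ ψ r) (h1 : ∀ r, r ≤ t → ψ r = 0)
    (h2 : ∀ r, s ≤ r → ψ r = 0) : Integrable (fun x => ψ (q x) * ‖fderiv ℝ q x‖ ^ 2) := by
  obtain ⟨a, b, c, -⟩ := H.weak t ht s hs hts (fun r => √(ψ r)) hc.sqrt (fun r => Real.sqrt_nonneg _)
    (fun r hr => by simp [h1 r hr]) (fun r hr => by simp [h2 r hr])
  have hcont := a.continuous_fderiv one_ne_zero
  have : Integrable (fun x => ‖fderiv ℝ (fun x => ∫ y in t..(q x), √(ψ y)) x‖ ^ 2) := by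
    apply (hcont.norm.pow 2).integrable_of_hasCompactSupport
    exact hcs_sq (b.fderiv (𝕜 := ℝ)).norm
  refine this.congr (Eventually.of_forall fun x => ?_)
  simp only [c, norm_smul, mul_pow, Real.norm_eq_abs, sq_abs]
  rw [Real.sq_sqrt (h0 _)]

set_option maxHeartbeats 1000000 in
lemma Core.main_ineq (H : Core q I) {t s e l : ℝ} (ht : t ∈ I) (hs : s ∈ I) (he : 0 < e)
    (hts : 2 * e < s - t) (hl : 0 ≤ l) :
    Integrable (fun x => trap t s e (q x) * (‖fderiv ℝ q x‖ - l) ^ 2) ∧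
    ∫ x, trap t s e (q x) * (‖fderiv ℝ q x‖ - l) ^ 2 ≤
      2 * (s - t) * lev q t - 2 * l * (√(4 * π * lev q s) * (s - t - 2 * e))
        + l ^ 2 * (lev q t - lev q s) := by
  have hts' : t < s := by linarith
  set ψ := trap t s e with hψ
  have hc : Continuous ψ := trap_cont t s e
  have h0 : ∀ r, 0 ≤ ψ r := trap_nonneg t s e
  have h1 : ∀ r, r ≤ t → ψ r = 0 := fun r hr => trap_zero_left he hr
  have h2 : ∀ r, s ≤ r → ψ r = 0 := fun r hr => trap_zero_right he hr
  obtain ⟨ha, hb, hcd, hw⟩ := H.weak t ht s hs hts' ψ hc h0 h1 h2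
  set u : E2 → ℝ := fun x => ∫ y in t..(q x), ψ y with hu
  have hii : ∀ a b, IntervalIntegrable ψ volume a b := fun a b => hc.intervalIntegrable a b
  -- properties of the primitive
  have hφ0 : ∀ r, r ≤ t → ∫ y in t..r, ψ y = 0 := by
    intro r hr
    rw [intervalIntegral.integral_congr (g := fun _ => 0)]
    · simp
    · intro y hy
      rw [uIcc_of_ge hr] at hy
      exact h1 y hy.2
  have hφs : ∀ r, s ≤ r → ∫ y in t..r, ψ y = ∫ y in t..s, ψ y := by
    intro r hr
    rw [← intervalIntegral.integral_add_adjacent_intervals (hii t s) (hii s r)]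
    rw [intervalIntegral.integral_congr (a := s) (b := r) (g := fun _ => 0)]
    · simp
    · intro y hy
      rw [uIcc_of_le hr] at hy
      exact h2 y hy.1
  have hh1 : s - t - 2 * e ≤ ∫ y in t..s, ψ y := by
    have e1 : ∫ y in (t+e)..(s-e), ψ y = s - t - 2 * e := by
      rw [intervalIntegral.integral_congr (g := fun _ => (1:ℝ))]
      · simp; ring
      · intro y hy
        rw [uIcc_of_le (by linarith)] at hy
        exact trap_one he hy.1 hy.2
    rw [← e1]
    apply intervalIntegral.integral_mono_interval (by linarith) (by linarith) (by linarith) _ (hii _ _)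
    exact Eventually.of_forall h0
  have hφle : ∀ r, ∫ y in t..r, ψ y ≤ s - t := by
    intro r
    rcases le_total r t with hr | hr
    · rw [hφ0 r hr]; linarith
    · have hle : ∀ r', t ≤ r' → ∫ y in t..r', ψ y ≤ r' - t := by
        intro r' hr'
        calc _ ≤ ∫ y in t..r', (1:ℝ) := intervalIntegral.integral_mono_on hr' (hii _ _) (by simp)
              (fun y _ => trap_le_one t s e y)
          _ = _ := by simp
      rcases le_total r s with hrs | hrs
      · linarith [hle r hr]
      · rw [hφs r hrs]; exact hle s hts'.le
  have hφnn : ∀ r, 0 ≤ ∫ y in t..r, ψ y := by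
    intro r
    rcases le_total r t with hr | hr
    · rw [hφ0 r hr]
    · exact intervalIntegral.integral_nonneg hr (fun y _ => h0 y)
  have hmT : MeasurableSet {x | t < q x} := measurableSet_lt measurable_const H.meas
  have hmS : MeasurableSet {x | s < q x} := measurableSet_lt measurable_const H.meas
  have hfT := H.fin t ht
  have hfS := H.fin s hs
  have hsub : {x | s < q x} ⊆ {x | t < q x} := fun x hx => lt_trans hts' hx
  have hI := H.int_sq ht hs hts' hc h0 h1 h2
  have hui : Integrable u := ha.continuous.integrable_of_hasCompactSupport hb
  -- X
  have hX : ∫ x, ψ (q x) * ‖fderiv ℝ q x‖ ^ 2 ≤ 2 * (s - t) * lev q t := by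
    rw [hw]
    have : ∫ x, u x ≤ ∫ x, {x | t < q x}.indicator (fun _ => s - t) x := by
      apply integral_mono hui ((integrable_indicator_iff hmT).2 (integrableOn_const hfT))
      intro x
      by_cases hx : t < q x
      · rw [indicator_of_mem (by exact hx)]; exact hφle _
      · rw [indicator_of_notMem (by exact hx)]; exact (hφ0 _ (not_lt.1 hx)).le
    rw [integral_indicator hmT, setIntegral_const, smul_eq_mul] at this
    unfold lev; nlinarith
  -- Z
  have hZi : Integrable (fun x => ψ (q x)) := by
    have : Integrable ({x | t < q x}.indicator (fun _ => (1:ℝ))) :=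
      (integrable_indicator_iff hmT).2 (integrableOn_const hfT)
    refine this.mono' (hc.measurable.comp H.meas).aestronglyMeasurable (Eventually.of_forall fun x => ?_)
    rw [Real.norm_of_nonneg (h0 _)]
    by_cases hx : t < q x
    · rw [indicator_of_mem (by exact hx)]; exact trap_le_one _ _ _ _
    · rw [indicator_of_notMem (by exact hx)]; exact (h1 _ (not_lt.1 hx)).le
  have hZ : ∫ x, ψ (q x) ≤ lev q t - lev q s := by
    have hd : MeasurableSet ({x | t < q x} \ {x | s < q x}) := hmT.diff hmS
    have hdf : volume ({x | t < q x} \ {x | s < q x}) ≠ ⊤ :=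
      ne_top_of_le_ne_top hfT (measure_mono sdiff_subset)
    have : ∫ x, ψ (q x) ≤ ∫ x, ({x | t < q x} \ {x | s < q x}).indicator (fun _ => (1:ℝ)) x := by
      apply integral_mono hZi ((integrable_indicator_iff hd).2 (integrableOn_const hdf))
      intro x
      by_cases hx : x ∈ ({x | t < q x} \ {x | s < q x})
      · rw [indicator_of_mem hx]; exact trap_le_one _ _ _ _
      · rw [indicator_of_notMem hx]
        simp only [Set.mem_sdiff, mem_ofPred_eq, not_and_or, not_not] at hx
        rcases hx with hx | hx
        · exact (h1 _ (not_lt.1 hx)).le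
        · exact (h2 _ hx.le).le
    rw [integral_indicator hd, setIntegral_const, smul_eq_mul, mul_one] at this
    rw [measureReal_sdiff hsub hmS hfT] at this
    exact this
  -- Y
  have hfd : ∀ x, ‖fderiv ℝ u x‖ = ψ (q x) * ‖fderiv ℝ q x‖ := by
    intro x; rw [hcd, norm_smul, Real.norm_of_nonneg (h0 _)]
  have hYi : Integrable (fun x => ψ (q x) * ‖fderiv ℝ q x‖) := by
    have := (ha.continuous_fderiv one_ne_zero).norm.integrable_of_hasCompactSupport (μ := volume)
      (hb.fderiv (𝕜 := ℝ)).norm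
    exact this.congr (Eventually.of_forall hfd)
  have hY : √(4 * π * lev q s) * (s - t - 2 * e) ≤ ∫ x, ψ (q x) * ‖fderiv ℝ q x‖ := by
    have hsob := sobolev ha hb
    simp_rw [hfd] at hsob
    have hnn : 0 ≤ ∫ x, ψ (q x) * ‖fderiv ℝ q x‖ :=
      integral_nonneg fun x => mul_nonneg (h0 _) (norm_nonneg _)
    have h3 : (s - t - 2 * e) ^ 2 * lev q s ≤ ∫ x, u x ^ 2 := by
      have hu2 : Integrable (fun x => u x ^ 2) :=
        (ha.continuous.pow 2).integrable_of_hasCompactSupport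
          (hcs_sq hb)
      have : ∫ x, {x | s < q x}.indicator (fun _ => (s - t - 2 * e) ^ 2) x ≤ ∫ x, u x ^ 2 := by
        apply integral_mono ((integrable_indicator_iff hmS).2 (integrableOn_const hfS)) hu2
        intro x
        by_cases hx : s < q x
        · rw [indicator_of_mem (by exact hx)]
          simp only [hu]
          rw [hφs _ hx.le]
          exact pow_le_pow_left₀ (by linarith) hh1 2
        · rw [indicator_of_notMem (by exact hx)]; positivity
      rw [integral_indicator hmS, setIntegral_const, smul_eq_mul] at this
      unfold lev; linarith
    apply le_of_sq_le_sq _ hnn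
    rw [mul_pow, Real.sq_sqrt (by have := lev_nonneg q s; positivity)]
    refine le_trans ?_ hsob
    nlinarith [Real.pi_pos]
  have hexp : ∀ x, ψ (q x) * (‖fderiv ℝ q x‖ - l) ^ 2 =
      (ψ (q x) * ‖fderiv ℝ q x‖ ^ 2 - 2 * l * (ψ (q x) * ‖fderiv ℝ q x‖)) + l ^ 2 * ψ (q x) := by
    intro x; ring
  simp_rw [hexp]
  have hA : Integrable (fun x => ψ (q x) * ‖fderiv ℝ q x‖ ^ 2 - 2 * l * (ψ (q x) * ‖fderiv ℝ q x‖)) :=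
    hI.sub (hYi.const_mul _)
  refine ⟨hA.add (hZi.const_mul _), ?_⟩
  rw [integral_add hA (hZi.const_mul _), integral_sub hI (hYi.const_mul _), integral_const_mul,
    integral_const_mul]
  have g1 := mul_le_mul_of_nonneg_left hY (by positivity : 0 ≤ 2 * l)
  have g2 := mul_le_mul_of_nonneg_left hZ (by positivity : 0 ≤ l ^ 2)
  linarith

end
end

section
section
variable {q : E2 → ℝ} {I : Set ℝ}

lemma Core.quad (H : Core q I) {t s l : ℝ} (ht : t ∈ I) (hs : s ∈ I) (hts : t < s) (hl : 0 ≤ l) :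
    0 ≤ 2 * (s - t) * lev q t - 2 * l * (√(4 * π * lev q s) * (s - t))
        + l ^ 2 * (lev q t - lev q s) := by
  have hlim : Tendsto (fun e : ℝ => 2 * (s - t) * lev q t - 2 * l * (√(4 * π * lev q s) * (s - t - 2 * e))
        + l ^ 2 * (lev q t - lev q s)) (𝓝[>] 0) (𝓝 (2 * (s - t) * lev q t - 2 * l * (√(4 * π * lev q s) * (s - t - 2 * 0))
        + l ^ 2 * (lev q t - lev q s))) := by
    apply Tendsto.mono_left _ nhdsWithin_le_nhds
    apply Continuous.tendsto
    fun_prop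
  simp only [mul_zero, sub_zero] at hlim
  apply ge_of_tendsto hlim
  have h1 : ∀ᶠ e : ℝ in 𝓝[>] 0, e < (s - t) / 2 := by
    apply nhdsWithin_le_nhds
    exact gt_mem_nhds (by linarith)
  filter_upwards [h1, self_mem_nhdsWithin] with e he he0
  have := (H.main_ineq ht hs he0 (by linarith) hl).2
  refine le_trans (integral_nonneg fun x => ?_) this
  exact mul_nonneg (trap_nonneg _ _ _ _) (sq_nonneg _)

lemma Core.step (H : Core q I) {t s : ℝ} (ht : t ∈ I) (hs : s ∈ I) (hts : t < s) :
    2 * π * (s - t) * lev q s ≤ lev q t * (lev q t - lev q s) := by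
  have h1 := H.lev_anti ht hts.le
  have h2 := lev_nonneg q s
  have h3 := lev_nonneg q t
  have hst : 0 < s - t := by linarith
  have := discrim_le_zero (a := lev q t - lev q s) (b := - (2 * (√(4 * π * lev q s) * (s - t))))
    (c := 2 * (s - t) * lev q t) (by
      intro l
      rcases le_or_gt 0 l with hl | hl
      · have := H.quad ht hs hts hl
        nlinarith
      · have g1 : 0 ≤ (lev q t - lev q s) * (l * l) := mul_nonneg (by linarith) (by nlinarith)
        have g2 : 0 ≤ 2 * (s - t) * lev q t := by positivity
        have g3 : 0 ≤ (2 * (√(4 * π * lev q s) * (s - t))) * (-l) := by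
          apply mul_nonneg (by positivity) (by linarith)
        linarith)
  unfold discrim at this
  have hsq := Real.sq_sqrt (by positivity : 0 ≤ 4 * π * lev q s)
  have h5 : (s - t) * (2 * π * (s - t) * lev q s) ≤ (s - t) * (lev q t * (lev q t - lev q s)) := by
    have e1 : (-(2 * (√(4 * π * lev q s) * (s - t))))^2 = 4 * (√(4 * π * lev q s))^2 * (s - t)^2 := by ring
    rw [e1, hsq] at this
    linarith
  exact le_of_mul_le_mul_left h5 hst

lemma telescoping {f : ℝ → ℝ} {t s c : ℝ} (hts : t < s) (hc : 0 ≤ c)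
    (hanti : ∀ a ∈ Icc t s, ∀ b ∈ Icc t s, a ≤ b → f b ≤ f a) (hpos : 0 < f s)
    (hstep : ∀ a ∈ Icc t s, ∀ b ∈ Icc t s, a < b → c * (b - a) * f b ≤ f a * (f a - f b)) :
    c * (s - t) ≤ f t - f s := by
  have key : ∀ n : ℕ, c * (s - t) ≤ (1 + c * ((s - t) / (n+1)) / f s) * (f t - f s) := by
    intro n
    set h := (s - t) / ((n:ℝ)+1) with hh
    have hn : (0:ℝ) < n + 1 := by positivity
    have hhp : 0 < h := by apply div_pos _ hn; linarith
    have hnh : ((n:ℝ)+1) * h = s - t := by rw [hh]; field_simp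
    have hmem : ∀ i : ℕ, i ≤ n + 1 → t + i * h ∈ Icc t s := by
      intro i hi
      have hi' : (i:ℝ) ≤ n + 1 := by exact_mod_cast hi
      constructor
      · have : 0 ≤ (i:ℝ) * h := by positivity
        linarith
      · have : (i:ℝ) * h ≤ (n+1) * h := by gcongr
        linarith
    have hsm : s ∈ Icc t s := ⟨hts.le, le_rfl⟩
    have hi : ∀ i ∈ Finset.range (n+1), c * h ≤ (1 + c * h / f s) * (f (t + i * h) - f (t + (i+1:ℕ) * h)) := by
      intro i hi
      have hi := Finset.mem_range.1 hi
      have m1 := hmem i hi.le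
      have m2 := hmem (i+1) hi
      have hlt : t + i * h < t + (i+1:ℕ) * h := by push_cast; linarith
      have g1 := hstep _ m1 _ m2 hlt
      have g2 := hanti _ m1 _ m2 hlt.le
      have g3 := hanti _ m1 _ hsm m1.2
      have e1 : t + ((i+1:ℕ):ℝ) * h - (t + i * h) = h := by push_cast; ring
      rw [e1] at g1
      set A := f (t + i * h)
      set B := f (t + (i+1:ℕ) * h)
      have hA : 0 < A := by linarith
      have : c * h * (A - B) / A ≤ c * h * (A - B) / f s := by
        apply div_le_div_of_nonneg_left _ hpos g3
        apply mul_nonneg (by positivity) (by linarith)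
      have h4 : c * h - c * h * (A - B) / A ≤ A - B := by
        rw [sub_le_iff_le_add, ← sub_le_iff_le_add', le_div_iff₀ hA]
        linarith
      have h5 : (1 + c * h / f s) * (A - B) = (A - B) + c * h * (A - B) / f s := by ring
      rw [h5]; linarith
    have hsum := Finset.sum_le_sum hi
    rw [← Finset.mul_sum (s := Finset.range (n+1)) (a := 1 + c * h / f s), Finset.sum_range_sub' (fun i : ℕ => f (t + i * h))] at hsum
    simp only [Finset.sum_const, Finset.card_range, nsmul_eq_mul, Nat.cast_zero, zero_mul, add_zero] at hsum
    push_cast at hsum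
    rw [hnh] at hsum
    have e2 : t + (s - t) = s := by ring
    rw [e2] at hsum
    calc c * (s - t) = (n+1) * (c * h) := by rw [← hnh]; ring
      _ ≤ _ := hsum
  have hlim : Tendsto (fun n : ℕ => (1 + c * ((s - t) / ((n:ℝ)+1)) / f s) * (f t - f s)) atTop
      (𝓝 ((1 + c * 0 / f s) * (f t - f s))) := by
    have : Tendsto (fun n : ℕ => (s - t) / ((n:ℝ)+1)) atTop (𝓝 0) := by
      have := (tendsto_one_div_add_atTop_nhds_zero_nat (𝕜 := ℝ)).const_mul (s - t)
      simpa [div_eq_mul_inv] using this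
    apply Tendsto.mul_const
    apply Tendsto.const_add
    apply Tendsto.div_const
    exact this.const_mul c
  have := ge_of_tendsto' hlim key
  simpa using this

lemma Core.drop (H : Core q I) (hI : OrdConnected I) {t s : ℝ} (ht : t ∈ I) (hs : s ∈ I) (hts : t < s)
    (hpos : 0 < lev q s) : 2 * π * (s - t) ≤ lev q t - lev q s := by
  apply telescoping (f := lev q) hts (by positivity) _ hpos
  · intro a ha b hb hab
    exact H.step (hI.out ht hs ha) (hI.out ht hs hb) hab
  · intro a ha b hb hab
    exact H.lev_anti (hI.out ht hs ha) hab

lemma const_of_quad {g : ℝ → ℝ} {a b C : ℝ} (hab : a < b)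
    (h : ∀ t ∈ Icc a b, ∀ s ∈ Icc a b, t < s → |g t - g s| ≤ C * (s - t)^2) : g b = g a := by
  have h' : ∀ t ∈ Icc a b, ∀ s ∈ Icc a b, |g s - g t| ≤ C * (s - t)^2 := by
    intro t ht s hs
    rcases lt_trichotomy t s with h1 | h1 | h1
    · rw [abs_sub_comm]; exact h t ht s hs h1
    · subst h1; simp
    · have := h s hs t ht h1; nlinarith
  have hd : ∀ t ∈ Icc a b, HasDerivWithinAt g 0 (Icc a b) t := by
    intro t ht
    rw [hasDerivWithinAt_iff_isLittleO]
    have h1 : (fun s => g s - g t - (s - t) • (0:ℝ)) =O[𝓝[Icc a b] t] (fun s => (s - t)^2) := by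
      apply Asymptotics.IsBigO.of_bound C
      filter_upwards [self_mem_nhdsWithin] with s hs
      simpa using h' t ht s hs
    refine h1.trans_isLittleO ?_
    have : (fun s : ℝ => (s - t)^2) = (fun s => (s - t) * (s - t)) := by ext; ring
    rw [this]
    have h2 : (fun s : ℝ => s - t) =o[𝓝[Icc a b] t] (fun _ => (1:ℝ)) := by
      rw [Asymptotics.isLittleO_one_iff]
      apply Tendsto.mono_left _ nhdsWithin_le_nhds
      have : Continuous (fun s : ℝ => s - t) := by fun_prop
      simpa using this.tendsto t
    simpa using h2.mul_isBigO (Asymptotics.isBigO_refl (fun s : ℝ => s - t) _)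
  have hc : ContinuousOn g (Icc a b) := fun t ht => (hd t ht).continuousWithinAt
  apply constant_of_derivWithin_zero (fun t ht => (hd t ht).differentiableWithinAt) _ b ⟨hab.le, le_rfl⟩
  intro t ht
  exact (hd t ⟨ht.1, ht.2.le⟩).derivWithin (uniqueDiffOn_Icc hab t ⟨ht.1, ht.2.le⟩)

/-- key estimate for rigidity -/
lemma Core.small (H : Core q I) {K : ℝ} (hK : ∀ τ ∈ I, lev q τ = K - 2 * π * τ)
    {t s e κ : ℝ} {B : Set E2} (hB : MeasurableSet B) (ht : t - e ∈ I) (hs : s + e ∈ I) (hts : t < s) (he : 0 < e)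
    (hκ : ∀ y ∈ B, κ ^ 2 ≤ (‖fderiv ℝ q y‖ - √(lev q (s+e) / π)) ^ 2) :
    κ ^ 2 * volume.real (B ∩ {x | t < q x ∧ q x ≤ s}) ≤ 4 * π * (s - t + 2 * e)^2 + 8 * lev q (s + e) * e := by
  have hl : 0 ≤ √(lev q (s+e) / π) := Real.sqrt_nonneg _
  obtain ⟨h1, h2⟩ := H.main_ineq ht hs he (by linarith) hl
  have hFn : 0 ≤ lev q (s + e) := lev_nonneg _ _
  have e1 : √(lev q (s+e) / π) * √(4 * π * lev q (s+e)) = 2 * lev q (s+e) := by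
    rw [← Real.sqrt_mul (by positivity)]
    rw [show lev q (s+e) / π * (4 * π * lev q (s+e)) = (2 * lev q (s+e))^2 by field_simp; ring]
    exact Real.sqrt_sq (by positivity)
  have e2 : √(lev q (s+e) / π) ^ 2 = lev q (s+e) / π := Real.sq_sqrt (by positivity)
  have e3 : lev q (t - e) = lev q (s + e) + 2 * π * (s - t + 2 * e) := by
    rw [hK _ ht, hK _ hs]; ring
  set F := lev q (s+e) with hF
  set l := √(F / π) with hl'
  have hms : MeasurableSet (B ∩ {x | t < q x ∧ q x ≤ s}) := by
    apply hB.inter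
    exact (measurableSet_lt measurable_const H.meas).inter (measurableSet_le H.meas measurable_const)
  have hfin : volume (B ∩ {x | t < q x ∧ q x ≤ s}) ≠ ⊤ := by
    apply ne_top_of_le_ne_top (H.fin _ ht) (measure_mono _)
    intro x hx
    have := hx.2.1
    simp only [mem_ofPred_eq]; linarith
  have h3 : κ ^ 2 * volume.real (B ∩ {x | t < q x ∧ q x ≤ s}) ≤
      ∫ x, trap (t - e) (s + e) e (q x) * (‖fderiv ℝ q x‖ - l) ^ 2 := by
    have : ∫ x, (B ∩ {x | t < q x ∧ q x ≤ s}).indicator (fun _ => κ ^ 2) x ≤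
      ∫ x, trap (t - e) (s + e) e (q x) * (‖fderiv ℝ q x‖ - l) ^ 2 := by
      apply integral_mono ((integrable_indicator_iff hms).2 (integrableOn_const hfin)) h1
      intro x
      by_cases hx : x ∈ (B ∩ {x | t < q x ∧ q x ≤ s})
      · rw [indicator_of_mem hx]
        simp only
        rw [trap_one he (by linarith [hx.2.1]) (by linarith [hx.2.2]), one_mul]
        exact hκ x hx.1
      · rw [indicator_of_notMem hx]; exact mul_nonneg (trap_nonneg _ _ _ _) (sq_nonneg _)
    rw [integral_indicator hms, setIntegral_const, smul_eq_mul] at this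
    linarith
  refine h3.trans (h2.trans (le_of_eq ?_))
  rw [e2, e3]
  have : 2 * l * (√(4 * π * F) * (s + e - (t - e) - 2 * e)) = 2 * (l * √(4 * π * F)) * (s - t) := by ring
  rw [this, e1]
  field_simp
  ring

lemma Core.rigid (H : Core q I) (hI : IsOpen I) {K : ℝ} (hK : ∀ τ ∈ I, lev q τ = K - 2 * π * τ)
    {x : E2} (hx : q x ∈ I) : ‖fderiv ℝ q x‖ ^ 2 = (K - 2 * π * q x) / π := by
  by_contra hne
  set t0 := q x with ht0
  have hne' : ‖fderiv ℝ q x‖ ≠ √(lev q t0 / π) := by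
    intro h; apply hne
    rw [h, Real.sq_sqrt (div_nonneg (lev_nonneg _ _) pi_pos.le), hK _ hx]
  -- continuity of (y, τ) ↦ ‖∇q y‖ - √(lev τ/π)
  have hfc : ContinuousAt (fun y => ‖fderiv ℝ q y‖) x := by
    have := (H.diff.continuousOn_fderiv_of_isOpen H.opn le_rfl).continuousAt (H.opn.mem_nhds hx)
    exact this.norm
  have hqc : ContinuousAt q x := (H.diff.continuousOn).continuousAt (H.opn.mem_nhds hx)
  set d := |‖fderiv ℝ q x‖ - √(lev q t0 / π)| with hd
  have hdp : 0 < d := abs_pos.2 (sub_ne_zero.2 hne')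
  obtain ⟨r, hr, hr1⟩ : ∃ r > 0, ∀ y ∈ ball x r, y ∈ {x | q x ∈ I} ∧ |‖fderiv ℝ q y‖ - ‖fderiv ℝ q x‖| < d / 4 := by
    have h1 : ∀ᶠ y in 𝓝 x, y ∈ {x | q x ∈ I} := H.opn.mem_nhds hx
    have h2 : ∀ᶠ y in 𝓝 x, |‖fderiv ℝ q y‖ - ‖fderiv ℝ q x‖| < d / 4 := by
      have := Metric.tendsto_nhds.1 hfc (d/4) (by positivity)
      simpa [Real.dist_eq] using this
    obtain ⟨r, hr, h⟩ := Metric.eventually_nhds_iff_ball.1 (h1.and h2)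
    exact ⟨r, hr, h⟩
  obtain ⟨δ, hδ, hδ1⟩ : ∃ δ > 0, ∀ τ ∈ ball t0 δ, τ ∈ I ∧ |√((K - 2 * π * τ) / π) - √((K - 2 * π * t0) / π)| < d / 4 := by
    have h1 : ∀ᶠ τ in 𝓝 t0, τ ∈ I := hI.mem_nhds hx
    have hcon : Continuous (fun τ : ℝ => √((K - 2 * π * τ) / π)) := by fun_prop
    have h2 : ∀ᶠ τ in 𝓝 t0, |√((K - 2 * π * τ) / π) - √((K - 2 * π * t0) / π)| < d / 4 := by
      have := Metric.tendsto_nhds.1 (hcon.tendsto t0) (d/4) (by positivity)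
      simpa [Real.dist_eq] using this
    exact Metric.eventually_nhds_iff_ball.1 (h1.and h2)
  set B := ball x r with hB
  set ρ := min (δ / 4) (1/4) with hρ
  have hρ0 : 0 < ρ := by positivity
  have hρ1 : ρ ≤ δ / 4 := min_le_left _ _
  have hρ2 : ρ ≤ 1/4 := min_le_right _ _
  set g : ℝ → ℝ := fun τ => volume.real (B ∩ {y | τ < q y}) with hg
  have hBf : ∀ S : Set E2, volume (B ∩ S) ≠ ⊤ := fun S =>
    ne_top_of_le_ne_top measure_ball_lt_top.ne (measure_mono inter_subset_left)
  have hgd : ∀ t s, t < s → g t - g s = volume.real (B ∩ {y | t < q y ∧ q y ≤ s}) := by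
    intro t s hts
    have hms : MeasurableSet (B ∩ {y | s < q y}) :=
      measurableSet_ball.inter (measurableSet_lt measurable_const H.meas)
    have := measureReal_sdiff (μ := volume) (s₂ := B ∩ {y | s < q y}) (s₁ := B ∩ {y | t < q y})
      (inter_subset_inter_right _ (fun y hy => lt_trans hts hy)) hms (hBf _)
    simp only [hg]
    rw [← this]
    congr 1
    ext y
    simp only [Set.mem_sdiff, mem_inter_iff, mem_ofPred_eq, not_and, not_lt]
    tauto
  have hlt : ∀ t ∈ Icc (t0 - ρ) (t0 + ρ), ∀ s ∈ Icc (t0 - ρ) (t0 + ρ), t < s →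
      |g t - g s| ≤ ((36 * π + 8 * (lev q (t0 - ρ))) / (d/2)^2) * (s - t)^2 := by
    intro t ht s hs hts
    have hst : s - t ≤ 1/2 := by linarith [ht.1, hs.2]
    set e := (s - t)^2 with he
    have hst0 : 0 < s - t := by linarith
    have he0 : 0 < e := by positivity
    have he1 : e ≤ ρ := by
      rw [he]
      have : s - t ≤ 2 * ρ := by linarith [ht.1, hs.2]
      nlinarith
    have he2 : e ≤ s - t := by rw [he]; nlinarith
    have m1 : t - e ∈ ball t0 δ := by
      rw [mem_ball, Real.dist_eq, abs_lt]; constructor <;> linarith [ht.1, ht.2]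
    have m2 : s + e ∈ ball t0 δ := by
      rw [mem_ball, Real.dist_eq, abs_lt]; constructor <;> linarith [hs.1, hs.2]
    have m3 : t0 - ρ ∈ ball t0 δ := by
      rw [mem_ball, Real.dist_eq, abs_lt]; constructor <;> linarith
    have hsm := H.small hK (κ := d/2) (B := B) measurableSet_ball (hδ1 _ m1).1 (hδ1 _ m2).1 hts he0 (by
      intro y hy
      have a1 := (hr1 y hy).2
      have a2 := (hδ1 _ m2).2
      rw [← hK _ (hδ1 _ m2).1, ← hK _ hx] at a2
      have a3 : d / 2 ≤ |‖fderiv ℝ q y‖ - √(lev q (s + e) / π)| := by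
        have : d ≤ |‖fderiv ℝ q y‖ - √(lev q (s + e) / π)| + |‖fderiv ℝ q y‖ - ‖fderiv ℝ q x‖| + |√(lev q (s + e) / π) - √(lev q t0 / π)| := by
          rw [hd]
          rw [abs_sub_comm ‖fderiv ℝ q y‖ ‖fderiv ℝ q x‖]
          calc _ = |(‖fderiv ℝ q y‖ - √(lev q (s + e) / π)) + (‖fderiv ℝ q x‖ - ‖fderiv ℝ q y‖) + (√(lev q (s + e) / π) - √(lev q t0 / π))| := by congr 1; ring
            _ ≤ _ := abs_add_three _ _ _
        linarith
      rw [← sq_abs (‖fderiv ℝ q y‖ - _)]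
      exact pow_le_pow_left₀ (by positivity) a3 2)
    rw [hgd t s hts, abs_of_nonneg measureReal_nonneg]
    rw [div_mul_eq_mul_div, le_div_iff₀ (by positivity)]
    have b1 : lev q (s + e) ≤ lev q (t0 - ρ) := H.lev_anti (hδ1 _ m3).1 (by linarith [hs.1])
    have b2 : (s - t + 2 * e)^2 ≤ 9 * (s - t)^2 := by
      have : (s - t + 2 * e)^2 ≤ (3 * (s-t))^2 := pow_le_pow_left₀ (by positivity) (by linarith) 2
      linarith
    have b3 : 8 * lev q (s+e) * e ≤ 8 * lev q (t0 - ρ) * (s-t)^2 := by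
      rw [← he]; gcongr
    have b4 : 4 * π * (s - t + 2 * e)^2 ≤ 4 * π * (9 * (s - t)^2) := by gcongr
    linarith
  have hconst := const_of_quad (by linarith : t0 - ρ < t0 + ρ) hlt
  have hz := hgd (t0 - ρ) (t0 + ρ) (by linarith)
  rw [hconst, sub_self] at hz
  have hzero : volume (B ∩ {y | t0 - ρ < q y ∧ q y ≤ t0 + ρ}) = 0 := by
    have := (measureReal_eq_zero_iff (hBf _)).1 hz.symm
    exact this
  have hnb : B ∩ {y | t0 - ρ < q y ∧ q y ≤ t0 + ρ} ∈ 𝓝 x := by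
    apply inter_mem (ball_mem_nhds x hr)
    have : ∀ᶠ y in 𝓝 x, q y ∈ Ioo (t0 - ρ) (t0 + ρ) := hqc.eventually (Ioo_mem_nhds (by linarith) (by linarith))
    filter_upwards [this] with y hy
    exact ⟨hy.1, hy.2.le⟩
  exact (Measure.measure_pos_of_mem_nhds volume hnb).ne' hzero

end
end

section
/-- dot product of gradients -/
def gdot (f g : E2 → ℝ) (x : E2) : ℝ :=
  fderiv ℝ f x (e2 0) * fderiv ℝ g x (e2 0) + fderiv ℝ f x (e2 1) * fderiv ℝ g x (e2 1)

lemma contDiff_of_ts {f : E2 → ℝ} (h : ∀ x ∈ tsupport f, ContDiffAt ℝ 1 f x) : ContDiff ℝ 1 f := by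
  rw [contDiff_iff_contDiffAt]
  intro x
  by_cases hx : x ∈ tsupport f
  · exact h x hx
  · have : f =ᶠ[𝓝 x] fun _ => 0 := notMem_tsupport_iff_eventuallyEq.1 hx
    exact contDiffAt_const.congr_of_eventuallyEq this

lemma int_fd_zero {g : E2 → ℝ} (hg : ContDiff ℝ 1 g) (hc : HasCompactSupport g) (e : E2) :
    ∫ x, fderiv ℝ g x e = 0 := by
  have := ibp1 hg hc (K := fun _ => 1) contDiff_const e
  simpa using this

lemma contDiffOn_pd {D : Set E2} {p : E2 → ℝ} (hD : IsOpen D) (hp : ContDiffOn ℝ 2 p D) (e : E2) :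
    ContDiffOn ℝ 1 (fun x => fderiv ℝ p x e) D := by
  have h1 : ContDiffOn ℝ 1 (fderiv ℝ p) D := hp.fderiv_of_isOpen hD (by norm_num)
  exact h1.clm_apply contDiffOn_const

lemma weak_loc {D : Set E2} {p η : E2 → ℝ} {k : ℝ} (hD : IsOpen D) (hp : ContDiffOn ℝ 2 p D)
    (hl : ∀ x ∈ D, lap p x = k) (hη : ContDiff ℝ 1 η) (hc : HasCompactSupport η) (hs : tsupport η ⊆ D) :
    ∫ x in D, gdot p η x = - k * ∫ x, η x := by
  have hG : ∀ e : E2, ContDiff ℝ 1 (fun x => fderiv ℝ p x e * η x) ∧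
      HasCompactSupport (fun x => fderiv ℝ p x e * η x) ∧
      (∀ x ∈ D, fderiv ℝ (fun x => fderiv ℝ p x e * η x) x e =
        fderiv ℝ (fun y => fderiv ℝ p y e) x e * η x + fderiv ℝ p x e * fderiv ℝ η x e) ∧
      (∀ x ∉ D, fderiv ℝ (fun x => fderiv ℝ p x e * η x) x e = 0) := by
    intro e
    have hd := contDiffOn_pd hD hp e
    have hts : tsupport (fun x => fderiv ℝ p x e * η x) ⊆ tsupport η :=
      closure_mono (fun x hx => by
        simp only [mem_support] at hx ⊢
        exact right_ne_zero_of_mul hx)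
    refine ⟨?_, ?_, ?_, ?_⟩
    · apply contDiff_of_ts
      intro x hx
      have hxD : x ∈ D := hs (hts hx)
      exact (hd.contDiffAt (hD.mem_nhds hxD)).mul hη.contDiffAt
    · exact HasCompactSupport.mul_left hc
    · intro x hx
      have h1 : HasFDerivAt (fun y => fderiv ℝ p y e) _ x :=
        ((hd.contDiffAt (hD.mem_nhds hx)).differentiableAt one_ne_zero).hasFDerivAt
      have h2 := (hη.differentiable one_ne_zero x).hasFDerivAt
      rw [show (fun x => fderiv ℝ p x e * η x) = (fun y => fderiv ℝ p y e) * η from rfl, (h1.mul h2).fderiv]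
      simp; ring
    · intro x hx
      have : x ∉ tsupport (fun x => fderiv ℝ p x e * η x) := fun h => hx (hs (hts h))
      rw [fderiv_of_notMem_tsupport ℝ this]; simp
  have key : ∀ x, fderiv ℝ (fun x => fderiv ℝ p x (e2 0) * η x) x (e2 0) +
      fderiv ℝ (fun x => fderiv ℝ p x (e2 1) * η x) x (e2 1) =
      D.indicator (gdot p η) x + k * η x := by
    intro x
    by_cases hx : x ∈ D
    · rw [(hG _).2.2.1 x hx, (hG _).2.2.1 x hx, indicator_of_mem hx, ← hl x hx]
      unfold gdot lap; ring
    · rw [(hG _).2.2.2 x hx, (hG _).2.2.2 x hx, indicator_of_notMem hx]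
      have : η x = 0 := image_eq_zero_of_notMem_tsupport (fun h => hx (hs h))
      simp [this]
  have hi : ∀ e, Integrable (fun x => fderiv ℝ (fun x => fderiv ℝ p x e * η x) x e) := fun e =>
    (cont_fd (hG e).1 e).integrable_of_hasCompactSupport (hcs_fd (hG e).2.1 e)
  have hηi : Integrable η := hη.continuous.integrable_of_hasCompactSupport hc
  have hsum := integral_add (hi (e2 0)) (hi (e2 1))
  rw [int_fd_zero (hG _).1 (hG _).2.1, int_fd_zero (hG _).1 (hG _).2.1] at hsum
  simp_rw [key] at hsum
  have hgi : Integrable (D.indicator (gdot p η)) := by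
    have : D.indicator (gdot p η) = fun x => (fderiv ℝ (fun x => fderiv ℝ p x (e2 0) * η x) x (e2 0) +
      fderiv ℝ (fun x => fderiv ℝ p x (e2 1) * η x) x (e2 1)) - k * η x := by
      ext x; rw [key]; ring
    rw [this]
    exact ((hi _).add (hi _)).sub (hηi.const_mul k)
  rw [integral_add hgi (hηi.const_mul k), integral_const_mul, integral_indicator hD.measurableSet] at hsum
  linarith

lemma core_mk {D : Set E2} {p q : E2 → ℝ} {I : Set ℝ} (hD : IsOpen D) (hp : ContDiffOn ℝ 1 p D)
    (hI : IsOpen I)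
    (hqp : ∀ x ∈ D, q x = p x) (hqI : ∀ x, q x ∈ I → x ∈ D) (hm : Measurable q)
    (hqI' : ∀ x ∉ D, ∀ t ∈ I, ∀ s ∈ I, q x ≤ t ∨ s ≤ q x)
    (K : ℝ → Set E2) (hKc : ∀ t ∈ I, IsCompact (K t)) (hK : ∀ t ∈ I, ∀ x, t < q x → x ∈ K t)
    (hKD : ∀ t ∈ I, ∀ x ∈ K t, x ∉ D → ∀ s ∈ I, ∀ᶠ y in 𝓝 x, s < q y)
    (hw : ∀ t ∈ I, ∀ s ∈ I, t < s → ∀ η : E2 → ℝ, ContDiff ℝ 1 η → HasCompactSupport η →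
      (∀ x, q x ≤ t → η x = 0) → ∀ κ, (∀ x, s ≤ q x → η x = κ) →
      ∫ x in D, gdot p η x = 2 * ∫ x, η x) : Core q I := by
  have hopn : {x | q x ∈ I} = D ∩ p ⁻¹' I := by
    ext x; simp only [mem_ofPred_eq, mem_inter_iff, mem_preimage]
    constructor
    · intro h; have := hqI x h; exact ⟨this, by rwa [← hqp x this]⟩
    · intro h; rw [hqp x h.1]; exact h.2
  have hfq : ∀ x ∈ D, q =ᶠ[𝓝 x] p := fun x hx => by
    filter_upwards [hD.mem_nhds hx] with y hy using hqp y hy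
  refine ⟨?_, ?_, hm, ?_, ?_⟩
  · rw [hopn]; exact hp.continuousOn.isOpen_inter_preimage hD hI
  · rw [hopn]
    exact (hp.mono inter_subset_left).congr (fun x hx => hqp x hx.1)
  · intro t ht
    exact ne_top_of_le_ne_top (hKc t ht).measure_lt_top.ne (measure_mono (hK t ht))
  intro t ht s hs hts ψ hc h0 h1 h2
  set φ : ℝ → ℝ := fun r => ∫ y in t..r, ψ y with hφ
  have hφd : ∀ r, HasDerivAt φ (ψ r) r := fun r =>
    intervalIntegral.integral_hasDerivAt_right (hc.intervalIntegrable _ _)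
      hc.aestronglyMeasurable.stronglyMeasurableAtFilter hc.continuousAt
  have hφC : ContDiff ℝ 1 φ := by
    rw [contDiff_one_iff_deriv]
    refine ⟨fun r => (hφd r).differentiableAt, ?_⟩
    have : deriv φ = ψ := funext fun r => (hφd r).deriv
    rw [this]; exact hc
  have hφ0 : ∀ r, r ≤ t → φ r = 0 := by
    intro r hr
    simp only [hφ]
    rw [intervalIntegral.integral_congr (g := fun _ => 0)]
    · simp
    · intro y hy
      rw [uIcc_of_ge hr] at hy
      exact h1 y hy.2
  have hφs : ∀ r, s ≤ r → φ r = φ s := by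
    intro r hr
    simp only [hφ]
    rw [← intervalIntegral.integral_add_adjacent_intervals (hc.intervalIntegrable t s) (hc.intervalIntegrable s r)]
    rw [intervalIntegral.integral_congr (a := s) (b := r) (g := fun _ => 0)]
    · simp
    · intro y hy
      rw [uIcc_of_le hr] at hy
      exact h2 y hy.1
  change ContDiff ℝ 1 (fun x => φ (q x)) ∧ HasCompactSupport (fun x => φ (q x)) ∧
    (∀ x, fderiv ℝ (fun x => φ (q x)) x = ψ (q x) • fderiv ℝ q x) ∧
    ∫ x, ψ (q x) * ‖fderiv ℝ q x‖ ^ 2 = 2 * ∫ x, φ (q x)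
  have hts' : tsupport (fun x => φ (q x)) ⊆ K t := by
    apply closure_minimal _ (hKc t ht).isClosed
    intro x hx
    apply hK t ht
    by_contra h
    exact hx (hφ0 _ (not_lt.1 h))
  have hcs : HasCompactSupport (fun x => φ (q x)) := (hKc t ht).of_isClosed_subset (isClosed_tsupport _) hts'
  have hcst : ∀ x ∈ K t, x ∉ D → (fun x => φ (q x)) =ᶠ[𝓝 x] fun _ => φ s := by
    intro x hx hxD
    filter_upwards [hKD t ht x hx hxD s hs] with y hy using hφs _ hy.le
  have hC : ContDiff ℝ 1 (fun x => φ (q x)) := by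
    apply contDiff_of_ts
    intro x hx
    by_cases hxD : x ∈ D
    · have : ContDiffAt ℝ 1 q x := (hp.contDiffAt (hD.mem_nhds hxD)).congr_of_eventuallyEq (hfq x hxD)
      exact hφC.contDiffAt.comp x this
    · exact contDiffAt_const.congr_of_eventuallyEq (hcst x (hts' hx) hxD)
  have hψz : ∀ x ∉ D, ψ (q x) = 0 := by
    intro x hx
    rcases hqI' x hx t ht s hs with h | h
    · exact h1 _ h
    · exact h2 _ h
  have hfd : ∀ x, fderiv ℝ (fun x => φ (q x)) x = ψ (q x) • fderiv ℝ q x := by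
    intro x
    by_cases hxD : x ∈ D
    · have h3 : HasFDerivAt q (fderiv ℝ q x) x := by
        have := ((hp.contDiffAt (hD.mem_nhds hxD)).congr_of_eventuallyEq (hfq x hxD)).differentiableAt one_ne_zero
        exact this.hasFDerivAt
      exact ((hφd (q x)).comp_hasFDerivAt x h3).fderiv
    · rw [hψz x hxD, zero_smul]
      by_cases hx : x ∈ tsupport (fun x => φ (q x))
      · rw [(hcst x (hts' hx) hxD).fderiv_eq]; simp
      · exact fderiv_of_notMem_tsupport ℝ hx
  refine ⟨hC, hcs, hfd, ?_⟩
  rw [← hw t ht s hs hts _ hC hcs (fun x hx => hφ0 _ hx) (φ s) (fun x hx => hφs _ hx)]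
  rw [← setIntegral_eq_integral_of_forall_compl_eq_zero (s := D) (fun x hx => by rw [hψz x hx, zero_mul])]
  apply setIntegral_congr_fun hD.measurableSet
  intro x hx
  simp only [gdot]
  rw [hfd, (hfq x hx).fderiv_eq, clm_norm_sq]
  simp; ring

lemma coreA {D : Set E2} {p : E2 → ℝ} {m : ℝ} (hD : IsOpen D) (hDb : Bornology.IsBounded D)
    (hp : ContDiffOn ℝ 2 p D) (hpc : ContinuousOn p (closure D))
    (hl : ∀ x ∈ D, lap p x = -2) (hm : 0 ≤ m) (hf : ∀ x ∈ frontier D, p x ≤ m) :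
    Core (D.indicator p) (Ioi m) := by
  have hmeas : Measurable (D.indicator p) := by
    classical
    rw [← Set.piecewise_eq_indicator]
    exact ContinuousOn.measurable_piecewise (hpc.mono subset_closure) continuousOn_const hD.measurableSet
  have hnD : ∀ x ∉ D, D.indicator p x = 0 := fun x hx => indicator_of_notMem hx p
  have hKsub : ∀ t ∈ Ioi m, closure D ∩ p ⁻¹' Ici t ⊆ D := by
    intro t ht x hx
    by_contra h
    have : x ∈ frontier D := by rw [hD.frontier_eq]; exact ⟨hx.1, h⟩
    have h1 := hf x this
    have h2 : t ≤ p x := hx.2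
    have h3 : m < t := ht
    linarith
  have hKc : ∀ t ∈ Ioi m, IsCompact (closure D ∩ p ⁻¹' Ici t) := by
    intro t _
    have hcomp : IsCompact (closure D) := hDb.isCompact_closure
    exact hcomp.of_isClosed_subset (hpc.preimage_isClosed_of_isClosed isClosed_closure isClosed_Ici) inter_subset_left
  have hK : ∀ t ∈ Ioi m, ∀ x, t < D.indicator p x → x ∈ closure D ∩ p ⁻¹' Ici t := by
    intro t ht x hx
    have ht' : m < t := ht
    by_cases hxD : x ∈ D
    · rw [indicator_of_mem hxD] at hx
      exact ⟨subset_closure hxD, hx.le⟩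
    · rw [hnD x hxD] at hx; linarith
  refine core_mk hD (hp.of_le (by norm_num)) isOpen_Ioi (fun x hx => indicator_of_mem hx p) ?_ hmeas ?_
    (fun t => closure D ∩ p ⁻¹' Ici t) hKc hK ?_ ?_
  · intro x hx
    by_contra h
    rw [hnD x h] at hx
    have : m < 0 := hx
    linarith
  · intro x hx t ht s hs
    left; rw [hnD x hx]
    have : m < t := ht
    linarith
  · intro t ht x hx hxD
    exact absurd (hKsub t ht hx) hxD
  · intro t ht s hs hts η hη hηc h0 κ hκ
    rw [weak_loc hD hp hl hη hηc]
    · ring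
    · refine subset_trans (closure_minimal ?_ (hKc t ht).isClosed) (hKsub t ht)
      intro x hx
      apply hK t ht
      by_contra h
      exact hx (h0 x (not_lt.1 h))
end

section
def cr (a b : E2) : ℝ := a 0 * b 1 - a 1 * b 0

@[simp] lemma perp2_zero (x : E2) : perp2 x 0 = - x 1 := by simp [perp2]
@[simp] lemma perp2_one (x : E2) : perp2 x 1 = x 0 := by simp [perp2]

lemma inner_E2 (a b : E2) : inner ℝ a b = a 0 * b 0 + a 1 * b 1 := by
  simp [PiLp.inner_apply, Fin.sum_univ_two]; ring

lemma norm_sq_E2 (a : E2) : ‖a‖ ^ 2 = a 0 ^ 2 + a 1 ^ 2 := by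
  rw [EuclideanSpace.norm_sq_eq]; simp [Fin.sum_univ_two]

lemma norm_perp2 (a : E2) : ‖perp2 a‖ = ‖a‖ := by
  have : ‖perp2 a‖ ^ 2 = ‖a‖ ^ 2 := by rw [norm_sq_E2, norm_sq_E2]; simp; ring
  exact (pow_left_inj₀ (norm_nonneg _) (norm_nonneg _) two_ne_zero).1 this

lemma E2_ext {a b : E2} (h0 : a 0 = b 0) (h1 : a 1 = b 1) : a = b := by
  ext i; fin_cases i
  · exact h0
  · exact h1

/-- `perp2` as a linear map -/
def perpL : E2 →L[ℝ] E2 := LinearMap.toContinuousLinearMap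
  { toFun := perp2
    map_add' := fun x y => by apply E2_ext <;> simp; ring
    map_smul' := fun c x => by apply E2_ext <;> simp }

@[simp] lemma perpL_apply (x : E2) : perpL x = perp2 x := rfl

def Phi (w N : ℝ → E2) (z : E2) : E2 := w (z 0) + z 1 • N (z 0)

structure Collar (w N : ℝ → E2) (δ : ℝ) : Prop where
  hw : ContDiff ℝ 1 w
  hN : ContDiff ℝ 1 N
  pw : Periodic w 1
  pN : Periodic N 1
  hδ : 0 < δ
  jac : ∀ z : E2, |z 1| < δ → 0 < cr (deriv w (z 0) + z 1 • deriv N (z 0)) (N (z 0))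
  inj : ∀ z z' : E2, |z 1| < δ → |z' 1| < δ → Phi w N z = Phi w N z' →
    (∃ n : ℤ, z 0 = z' 0 + n) ∧ z 1 = z' 1

lemma Collar.mono {w N : ℝ → E2} {δ δ' : ℝ} (H : Collar w N δ) (h : 0 < δ') (hle : δ' ≤ δ) : Collar w N δ' :=
  ⟨H.hw, H.hN, H.pw, H.pN, h, fun z hz => H.jac z (hz.trans_le hle),
    fun z z' hz hz' => H.inj z z' (hz.trans_le hle) (hz'.trans_le hle)⟩

set_option maxHeartbeats 2000000 in
lemma exists_collar {w : ℝ → E2} {ℓ Ka a : ℝ} (ha : 0 < a) (hℓ : 0 < ℓ) (pw : Periodic w 1) (hw : ContDiff ℝ 1 w)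
    (hH : ∀ s t : ℝ, ‖deriv w s - deriv w t‖ ≤ Ka * |s - t| ^ a)
    (hn : ∀ t : ℝ, ‖deriv w t‖ = ℓ) (hinj : InjOn w (Ico (0:ℝ) 1)) :
    ∃ N δ, Collar w N δ ∧ ∀ t, 0 < cr (deriv w t) (N t) := by
  -- uniform continuity scale
  obtain ⟨h, hh, hh1⟩ : ∃ h > 0, ∀ s t : ℝ, |s - t| ≤ h → ‖deriv w s - deriv w t‖ ≤ ℓ / 4 := by
    have : Tendsto (fun r : ℝ => Ka * |r| ^ a) (𝓝 0) (𝓝 0) := by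
      have hc : Continuous (fun r : ℝ => Ka * |r| ^ a) :=
        continuous_const.mul ((continuous_abs).rpow_const (fun _ => Or.inr ha.le))
      have := hc.tendsto 0
      simpa [Real.zero_rpow ha.ne'] using this
    have h2 := this.eventually (gt_mem_nhds (by positivity : (0:ℝ) < ℓ/4))
    obtain ⟨h, hh, h3⟩ := Metric.eventually_nhds_iff_ball.1 h2
    refine ⟨h/2, by positivity, fun s t hst => (hH s t).trans ?_⟩
    apply (h3 (s - t) _).le
    rw [mem_ball_zero_iff, Real.norm_eq_abs]; linarith
  have hwd : ∀ t, HasDerivAt w (deriv w t) t := fun t => (hw.differentiable one_ne_zero t).hasDerivAt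
  set T : ℝ → E2 := fun t => h⁻¹ • (w (t + h) - w t) with hT
  have hTn : ∀ t, ‖T t - deriv w t‖ ≤ ℓ / 4 := by
    intro t
    have hb : ‖(w (t+h) - (t+h) • deriv w t) - (w t - t • deriv w t)‖ ≤ ℓ/4 * ‖(t + h) - t‖ := by
      apply Convex.norm_image_sub_le_of_norm_hasDerivWithin_le (f := fun τ => w τ - τ • deriv w t)
        (f' := fun τ => deriv w τ - (1:ℝ) • deriv w t) (s := Icc t (t+h)) _ _ (convex_Icc _ _)
      · exact ⟨le_rfl, by linarith⟩
      · exact ⟨by linarith, le_rfl⟩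
      · intro τ _
        exact ((hwd τ).sub ((hasDerivAt_id τ).smul_const _)).hasDerivWithinAt
      · intro τ hτ
        rw [one_smul]
        apply hh1
        rw [abs_le]; constructor <;> linarith [hτ.1, hτ.2]
    have e1 : T t - deriv w t = h⁻¹ • ((w (t+h) - (t+h) • deriv w t) - (w t - t • deriv w t)) := by
      have : (w (t+h) - (t+h) • deriv w t) - (w t - t • deriv w t) = (w (t+h) - w t) - h • deriv w t := by
        rw [add_smul]; abel
      rw [this, smul_sub, smul_smul, inv_mul_cancel₀ hh.ne', one_smul]
    rw [e1, norm_smul, norm_inv, Real.norm_of_nonneg hh.le, inv_mul_le_iff₀ hh]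
    refine hb.trans (le_of_eq ?_)
    simp [abs_of_pos hh]; ring
  have hTnn : ∀ t, ‖T t‖ ≤ 5 * ℓ / 4 := by
    intro t
    have := norm_add_le (T t - deriv w t) (deriv w t)
    rw [sub_add_cancel, hn] at this
    linarith [hTn t]
  have hTC : ContDiff ℝ 1 T := by
    simp only [hT]
    have : ContDiff ℝ 1 (fun t => w (t + h)) := hw.comp (contDiff_id.add contDiff_const)
    exact (this.sub hw).const_smul h⁻¹
  have hTd : ∀ t, HasDerivAt T (h⁻¹ • (deriv w (t+h) - deriv w t)) t := by
    intro t
    have : HasDerivAt (fun t => w (t + h)) (deriv w (t+h)) t := (hwd (t+h)).comp_add_const t h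
    exact HasDerivAt.const_smul h⁻¹ (this.sub (hwd t))
  set N : ℝ → E2 := fun t => perp2 (T t) with hN
  have hNd : ∀ t, HasDerivAt N (perp2 (h⁻¹ • (deriv w (t+h) - deriv w t))) t := fun t =>
    (perpL.hasFDerivAt (x := T t)).comp_hasDerivAt t (hTd t)
  have hNC : ContDiff ℝ 1 N := perpL.contDiff.comp hTC
  have hcrN : ∀ v t, cr v (N t) = inner ℝ v (T t) := by
    intro v t; rw [inner_E2]; simp [cr, hN]
  -- key estimate
  have key : ∀ τ t s : ℝ, |τ - t| ≤ h → |s| ≤ h / 10 → 0 < inner ℝ (deriv w τ + s • deriv N τ) (T t) := by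
    intro τ t s hτ hs
    rw [(hNd τ).deriv]
    have a1 : deriv w τ + s • perp2 (h⁻¹ • (deriv w (τ+h) - deriv w τ)) =
      deriv w t + ((deriv w τ - deriv w t) + s • perp2 (h⁻¹ • (deriv w (τ+h) - deriv w τ))) := by abel
    have a2 : T t = deriv w t + (T t - deriv w t) := by abel
    rw [a1, inner_add_left]
    nth_rewrite 1 [a2]
    rw [inner_add_right, real_inner_self_eq_norm_sq, hn]
    have b1 : -(ℓ * (ℓ/4)) ≤ inner ℝ (deriv w t) (T t - deriv w t) := by
      have := abs_real_inner_le_norm (deriv w t) (T t - deriv w t)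
      rw [hn] at this
      have h2 : ℓ * ‖T t - deriv w t‖ ≤ ℓ * (ℓ/4) := by gcongr; exact hTn t
      linarith [neg_abs_le (inner ℝ (deriv w t) (T t - deriv w t))]
    have b2 : ‖(deriv w τ - deriv w t) + s • perp2 (h⁻¹ • (deriv w (τ+h) - deriv w τ))‖ ≤ ℓ/4 + ℓ/5 := by
      refine (norm_add_le _ _).trans (add_le_add (hh1 _ _ hτ) ?_)
      rw [norm_smul, norm_perp2, norm_smul, norm_inv, Real.norm_of_nonneg hh.le, Real.norm_eq_abs]
      have : ‖deriv w (τ + h) - deriv w τ‖ ≤ 2 * ℓ := by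
        refine (norm_sub_le _ _).trans ?_; rw [hn, hn]; linarith
      calc |s| * (h⁻¹ * ‖deriv w (τ + h) - deriv w τ‖) ≤ (h/10) * (h⁻¹ * (2 * ℓ)) := by gcongr
        _ = ℓ / 5 := by field_simp; ring
    have b3 : -((ℓ/4 + ℓ/5) * (5 * ℓ/4)) ≤ inner ℝ ((deriv w τ - deriv w t) + s • perp2 (h⁻¹ • (deriv w (τ+h) - deriv w τ))) (T t) := by
      have := abs_real_inner_le_norm ((deriv w τ - deriv w t) + s • perp2 (h⁻¹ • (deriv w (τ+h) - deriv w τ))) (T t)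
      have h2 : ‖(deriv w τ - deriv w t) + s • perp2 (h⁻¹ • (deriv w (τ+h) - deriv w τ))‖ * ‖T t‖ ≤ (ℓ/4 + ℓ/5) * (5 * ℓ/4) := by
        apply mul_le_mul b2 (hTnn t) (norm_nonneg _) (by positivity)
      linarith [neg_abs_le (inner ℝ ((deriv w τ - deriv w t) + s • perp2 (h⁻¹ • (deriv w (τ+h) - deriv w τ))) (T t))]
    nlinarith
  have pT : Periodic T 1 := by
    intro t
    simp only [hT]
    rw [show t + 1 + h = (t + h) + 1 by ring, pw, pw]
  have pN : Periodic N 1 := fun t => by simp only [hN]; rw [pT]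
  -- local injectivity
  have near : ∀ z z' : E2, |z 1| ≤ h/10 → |z' 1| ≤ h/10 → |z 0 - z' 0| ≤ h → Phi w N z = Phi w N z' → z 0 = z' 0 := by
    intro z z' hz hz' hzz heq
    by_contra hne
    have hmono : StrictMonoOn (fun τ => inner ℝ (w τ + z 1 • N τ) (T (z' 0))) (Icc (z' 0 - h) (z' 0 + h)) := by
      apply strictMonoOn_of_deriv_pos (convex_Icc _ _)
      · have h1 := hw.continuous
        have h2 := hNC.continuous
        fun_prop
      · intro τ hτ
        rw [interior_Icc] at hτ
        have hd : HasDerivAt (fun τ => w τ + z 1 • N τ) (deriv w τ + z 1 • deriv N τ) τ :=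
          (hwd τ).add (HasDerivAt.const_smul (z 1) (hNC.differentiable one_ne_zero τ).hasDerivAt)
        have := hd.inner ℝ (hasDerivAt_const τ (T (z' 0)))
        rw [this.deriv]
        simp only [inner_zero_right, zero_add]
        apply key _ _ _ _ hz
        rw [abs_le]; constructor <;> linarith [hτ.1, hτ.2]
    rw [abs_le] at hzz
    have m1 : z 0 ∈ Icc (z' 0 - h) (z' 0 + h) := ⟨by linarith, by linarith⟩
    have m2 : z' 0 ∈ Icc (z' 0 - h) (z' 0 + h) := ⟨by linarith, by linarith⟩
    apply hne
    apply hmono.injOn m1 m2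
    have e1 : w (z 0) + z 1 • N (z 0) = w (z' 0) + z' 1 • N (z' 0) := heq
    simp only
    rw [e1]
    rw [inner_add_left, inner_add_left, inner_smul_left, inner_smul_left]
    have : inner ℝ (N (z' 0)) (T (z' 0)) = 0 := by rw [inner_E2]; simp [hN]; ring
    rw [this]; simp
  -- far separation
  have hwper : ∀ t t' : ℝ, w t = w t' → ∃ n : ℤ, t = t' + n := by
    intro t t' heq
    have e1 : w (Int.fract t) = w t := by
      rw [← Int.self_sub_floor]; simpa using pw.sub_int_mul_eq ⌊t⌋ (x := t)
    have e2 : w (Int.fract t') = w t' := by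
      rw [← Int.self_sub_floor]; simpa using pw.sub_int_mul_eq ⌊t'⌋ (x := t')
    have := hinj ⟨Int.fract_nonneg t, Int.fract_lt_one t⟩ ⟨Int.fract_nonneg t', Int.fract_lt_one t'⟩ (by rw [e1, e2, heq])
    refine ⟨⌊t⌋ - ⌊t'⌋, ?_⟩
    have f1 := Int.fract_add_floor t
    have f2 := Int.fract_add_floor t'
    push_cast; linarith
  obtain ⟨m, hm, hfar⟩ : ∃ m > 0, ∀ t t' : ℝ, t ∈ Icc (0:ℝ) 1 → t' - t ∈ Icc h (1 - h) → m ≤ ‖w t - w t'‖ := by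
    set S : Set (ℝ × ℝ) := (fun x : ℝ × ℝ => (x.1, x.1 + x.2)) '' (Icc (0:ℝ) 1 ×ˢ Icc h (1 - h)) with hS
    have hSc : IsCompact S := (isCompact_Icc.prod isCompact_Icc).image (by fun_prop)
    have hmemS : ∀ t t', t ∈ Icc (0:ℝ) 1 → t' - t ∈ Icc h (1-h) → (t, t') ∈ S := by
      intro t t' h1 h2
      exact ⟨(t, t' - t), ⟨h1, h2⟩, by simp⟩
    by_cases hne : S.Nonempty
    · have hcw := hw.continuous
      obtain ⟨x, hx, hmin⟩ := hSc.exists_isMinOn hne (f := fun x : ℝ × ℝ => ‖w x.1 - w x.2‖) (by fun_prop)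
      refine ⟨‖w x.1 - w x.2‖, ?_, fun t t' h1 h2 => by
        have := isMinOn_iff.1 hmin (t, t') (hmemS t t' h1 h2)
        simpa only using this⟩
      obtain ⟨y, hy, rfl⟩ := hx
      simp only
      rw [gt_iff_lt, norm_pos_iff, sub_ne_zero]
      intro heq
      obtain ⟨n, hn⟩ := hwper _ _ heq
      have h1 := hy.2.1
      have h2 := hy.2.2
      have g1 : (n:ℝ) < 0 := by linarith
      have g2 : (-1:ℝ) < n := by linarith
      have g1' : n < 0 := by exact_mod_cast g1
      have g2' : -1 < n := by exact_mod_cast g2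
      omega
    · exact ⟨1, one_pos, fun t t' h1 h2 => absurd (Set.nonempty_of_mem (hmemS t t' h1 h2)) hne⟩
  set δ := min (h/10) (m / (5 * ℓ)) with hδ
  have hδ0 : 0 < δ := by positivity
  have hδ1 : δ ≤ h/10 := min_le_left _ _
  have hδ2 : δ ≤ m / (5 * ℓ) := min_le_right _ _
  have hPper : ∀ (z : E2) (n : ℤ), Phi w N z = w (z 0 + n) + z 1 • N (z 0 + n) := by
    intro z n
    have e1 := pw.int_mul n (z 0)
    have e2 := pN.int_mul n (z 0)
    simp only [mul_one] at e1 e2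
    rw [e1, e2]; rfl
  have hNn : ∀ t, ‖N t‖ ≤ 5 * ℓ/4 := fun t => by simp only [hN]; rw [norm_perp2]; exact hTnn t
  refine ⟨N, δ, ⟨hw, hNC, pw, pN, hδ0, ?_, ?_⟩, ?_⟩
  · intro z hz
    rw [hcrN]
    exact key _ _ _ (by simpa using hh.le) (hz.le.trans hδ1)
  · intro z z' hz hz' heq
    have hex : ∃ n : ℤ, z 0 = z' 0 + n := by
      -- shift so that everything is near
      set a0 := Int.fract (z 0) with ha0
      set b0 : ℝ := a0 + Int.fract (z' 0 - a0) with hb0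
      have hA : z 0 = a0 + ⌊z 0⌋ := (Int.fract_add_floor _).symm
      have hB : z' 0 = b0 + ⌊z' 0 - a0⌋ := by
        have := Int.fract_add_floor (z' 0 - a0); rw [hb0]; linarith
      have hfr0 := Int.fract_nonneg (z' 0 - a0)
      have hfr1 := Int.fract_lt_one (z' 0 - a0)
      have ex1 : Phi w N z = w a0 + z 1 • N a0 := by
        rw [hPper z (-⌊z 0⌋)]
        have : z 0 + ((-⌊z 0⌋ : ℤ) : ℝ) = a0 := by push_cast; linarith
        rw [this]
      have ex2 : ∀ k : ℤ, Phi w N z' = w (b0 + k) + z' 1 • N (b0 + k) := by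
        intro k
        rw [hPper z' (-⌊z' 0 - a0⌋ + k)]
        have : z' 0 + ((-⌊z' 0 - a0⌋ + k : ℤ) : ℝ) = b0 + k := by push_cast; linarith
        rw [this]
      have hnear : ∀ k : ℤ, |a0 - (b0 + k)| ≤ h → ∃ n : ℤ, z 0 = z' 0 + n := by
        intro k hk
        have := near !₂[a0, z 1] !₂[b0 + k, z' 1] (by simpa using (hz.le.trans hδ1)) (by simpa using (hz'.le.trans hδ1))
          (by simpa using hk) (by
            have e1 : Phi w N !₂[a0, z 1] = Phi w N z := by rw [ex1]; simp [Phi]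
            have e2 : Phi w N !₂[b0 + k, z' 1] = Phi w N z' := by rw [ex2 k]; simp [Phi]
            rw [e1, e2, heq])
        simp at this
        refine ⟨⌊z 0⌋ + k - ⌊z' 0 - a0⌋, ?_⟩
        push_cast; linarith
      by_cases c1 : b0 - a0 ≤ h
      · apply hnear 0
        rw [abs_le]; constructor <;> push_cast <;> linarith
      by_cases c2 : 1 - h ≤ b0 - a0
      · apply hnear (-1)
        rw [abs_le]; constructor <;> push_cast <;> linarith
      · exfalso
        push Not at c1 c2
        have hf := hfar a0 b0 ⟨Int.fract_nonneg _, (Int.fract_lt_one _).le⟩ ⟨c1.le, c2.le⟩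
        have e2 := ex2 0
        simp only [Int.cast_zero, add_zero] at e2
        have e3 : w a0 - w b0 = z' 1 • N b0 - z 1 • N a0 := by
          have : w a0 + z 1 • N a0 = w b0 + z' 1 • N b0 := by rw [← ex1, ← e2, heq]
          rw [sub_eq_sub_iff_add_eq_add]; rw [this]; abel
        rw [e3] at hf
        have n1 : ‖z' 1 • N b0‖ ≤ δ * (5 * ℓ/4) := by
          rw [norm_smul, Real.norm_eq_abs]; gcongr; exact hNn _
        have n2 : ‖z 1 • N a0‖ ≤ δ * (5 * ℓ/4) := by
          rw [norm_smul, Real.norm_eq_abs]; gcongr; exact hNn _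
        have n3 := norm_sub_le (z' 1 • N b0) (z 1 • N a0)
        have n4 : δ * (5 * ℓ) ≤ m := by rwa [le_div_iff₀ (by positivity)] at hδ2
        linarith
    refine ⟨hex, ?_⟩
    obtain ⟨n, hn'⟩ := hex
    have e1 := hPper z' n
    rw [← hn'] at e1
    have e2 : Phi w N z = w (z 0) + z 1 • N (z 0) := rfl
    rw [e1, e2] at heq
    have e3 := add_left_cancel heq
    have hN0 : N (z 0) ≠ 0 := by
      intro h0
      have := key (z 0) (z 0) 0 (by simpa using hh.le) (by simp; positivity)
      rw [← hcrN, h0] at this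
      simp [cr] at this
    exact smul_left_injective ℝ hN0 e3
  · intro t
    rw [hcrN]
    have := key t t 0 (by simpa using hh.le) (by simp; positivity)
    simpa using this
end

section
lemma clm_E2 (L : E2 →L[ℝ] ℝ) (v : E2) : L v = v 0 * L (e2 0) + v 1 * L (e2 1) := by
  have : v = v 0 • e2 0 + v 1 • e2 1 := by
    apply E2_ext <;> simp [e2]
  conv_lhs => rw [this]
  simp

def cL (i : Fin 2) : E2 →L[ℝ] ℝ := EuclideanSpace.proj i
@[simp] lemma cL_apply (i : Fin 2) (v : E2) : cL i v = v i := rfl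

def PhiD (w N : ℝ → E2) (z : E2) : E2 →L[ℝ] E2 :=
  (cL 0).smulRight (deriv w (z 0) + z 1 • deriv N (z 0)) + (cL 1).smulRight (N (z 0))

lemma PhiD_apply (w N : ℝ → E2) (z v : E2) :
    PhiD w N z v = v 0 • (deriv w (z 0) + z 1 • deriv N (z 0)) + v 1 • N (z 0) := by
  simp [PhiD]

lemma det_E2 (A : E2 →L[ℝ] E2) : A.det = cr (A (e2 0)) (A (e2 1)) := by
  have h1 : A.det = LinearMap.det (A : E2 →ₗ[ℝ] E2) := rfl
  rw [h1, ← LinearMap.det_toMatrix (EuclideanSpace.basisFun (Fin 2) ℝ).toBasis, Matrix.det_fin_two]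
  simp [LinearMap.toMatrix_apply, cr, e2]
  ring

lemma PhiD_det (w N : ℝ → E2) (z : E2) :
    (PhiD w N z).det = cr (deriv w (z 0) + z 1 • deriv N (z 0)) (N (z 0)) := by
  rw [det_E2, PhiD_apply, PhiD_apply]; simp [e2]

section
variable {w N : ℝ → E2} {δ : ℝ}

lemma Collar.contDiff (H : Collar w N δ) : ContDiff ℝ 1 (Phi w N) := by
  have h0 : ContDiff ℝ 1 (fun z : E2 => z 0) := contDiff_coord 0
  have h1 : ContDiff ℝ 1 (fun z : E2 => z 1) := contDiff_coord 1
  exact (H.hw.comp h0).add (h1.smul (H.hN.comp h0))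

lemma Collar.hasFDerivAt (H : Collar w N δ) (z : E2) : HasFDerivAt (Phi w N) (PhiD w N z) z := by
  have h0 : HasFDerivAt (fun z : E2 => z 0) (cL 0) z := (cL 0).hasFDerivAt
  have h1 : HasFDerivAt (fun z : E2 => z 1) (cL 1) z := (cL 1).hasFDerivAt
  have a1 := ((H.hw.differentiable one_ne_zero (z 0)).hasDerivAt).hasFDerivAt.comp z h0
  have a2 := ((H.hN.differentiable one_ne_zero (z 0)).hasDerivAt).hasFDerivAt.comp z h0
  have := a1.add (h1.smul a2)
  refine HasFDerivAt.congr_fderiv this ?_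
  ext1 v
  rw [PhiD_apply]
  simp [smul_smul, mul_comm]
  abel

lemma Collar.det_pos (H : Collar w N δ) {z : E2} (hz : |z 1| < δ) : 0 < (PhiD w N z).det := by
  rw [PhiD_det]; exact H.jac z hz

lemma Collar.exists_inv (H : Collar w N δ) {z : E2} (hz : |z 1| < δ) :
    (∃ g : E2 → E2, ContDiffAt ℝ 1 g (Phi w N z) ∧ g (Phi w N z) = z ∧
      ∀ᶠ y in 𝓝 (Phi w N z), Phi w N (g y) = y) ∧ map (Phi w N) (𝓝 z) = 𝓝 (Phi w N z) := by
  set A := (PhiD w N z).toContinuousLinearEquivOfDetNeZero (H.det_pos hz).ne' with hA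
  have hfd : HasFDerivAt (Phi w N) (A : E2 →L[ℝ] E2) z := H.hasFDerivAt z
  have hcd : ContDiffAt ℝ 1 (Phi w N) z := H.contDiff.contDiffAt
  have hs : HasStrictFDerivAt (Phi w N) (A : E2 →L[ℝ] E2) z := hcd.hasStrictFDerivAt' hfd one_ne_zero
  refine ⟨⟨hs.localInverse (Phi w N) A z, ?_, hs.localInverse_apply_image, hs.eventually_right_inverse⟩, hs.map_nhds_eq_of_equiv⟩
  exact hcd.to_localInverse hfd one_ne_zero

/-- the open collar -/
def VC (w N : ℝ → E2) (δ : ℝ) : Set E2 := Phi w N '' {z | |z 1| < δ}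

open Classical in
/-- signed collar coordinate -/
def sg (w N : ℝ → E2) (δ : ℝ) (x : E2) : ℝ :=
  if h : ∃ z : E2, |z 1| < δ ∧ Phi w N z = x then h.choose 1 else 0

lemma Collar.sg_Phi (H : Collar w N δ) {z : E2} (hz : |z 1| < δ) : sg w N δ (Phi w N z) = z 1 := by
  have h : ∃ z' : E2, |z' 1| < δ ∧ Phi w N z' = Phi w N z := ⟨z, hz, rfl⟩
  rw [sg, dif_pos h]
  exact (H.inj _ _ h.choose_spec.1 hz h.choose_spec.2).2

lemma Collar.isOpen_V (H : Collar w N δ) : IsOpen (VC w N δ) := by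
  rw [isOpen_iff_mem_nhds]
  rintro x ⟨z, hz, rfl⟩
  rw [← (H.exists_inv hz).2]
  apply image_mem_map
  exact (isOpen_lt (by fun_prop) continuous_const).mem_nhds hz

lemma Collar.sg_contDiffAt (H : Collar w N δ) {x : E2} (hx : x ∈ VC w N δ) : ContDiffAt ℝ 1 (sg w N δ) x := by
  obtain ⟨z, hz, rfl⟩ := hx
  obtain ⟨g, g1, g2, g3⟩ := (H.exists_inv hz).1
  have h1 : ContDiffAt ℝ 1 (fun y => g y 1) (Phi w N z) := (contDiff_coord 1).contDiffAt.comp _ g1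
  apply h1.congr_of_eventuallyEq
  have h2 : ∀ᶠ y in 𝓝 (Phi w N z), |g y 1| < δ := by
    have : ContinuousAt (fun y => |g y 1|) (Phi w N z) := h1.continuousAt.abs
    apply this.eventually_lt continuousAt_const
    rw [g2]; exact hz
  filter_upwards [g3, h2] with y hy hy2
  nth_rewrite 1 [← hy]
  exact H.sg_Phi hy2

lemma Collar.sg_fderiv (H : Collar w N δ) {z : E2} (hz : |z 1| < δ) (v : E2) :
    fderiv ℝ (sg w N δ) (Phi w N z) (PhiD w N z v) = v 1 := by
  have h1 := ((H.sg_contDiffAt ⟨z, hz, rfl⟩).differentiableAt one_ne_zero).hasFDerivAt.comp z (H.hasFDerivAt z)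
  have h2 : (sg w N δ ∘ Phi w N) =ᶠ[𝓝 z] fun z => z 1 := by
    have : {z : E2 | |z 1| < δ} ∈ 𝓝 z := (isOpen_lt (by fun_prop) continuous_const).mem_nhds hz
    filter_upwards [this] with y hy using H.sg_Phi hy
  have h3 : HasFDerivAt (fun z : E2 => z 1) (cL 1) z := (cL 1).hasFDerivAt
  have := h1.unique (h3.congr_of_eventuallyEq h2)
  have h4 := congrArg (fun L => L v) this
  simpa using h4

lemma Collar.sg_grad (H : Collar w N δ) {z : E2} (hz : |z 1| < δ) :
    (PhiD w N z).det * fderiv ℝ (sg w N δ) (Phi w N z) (e2 0) = - (deriv w (z 0) + z 1 • deriv N (z 0)) 1 ∧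
    (PhiD w N z).det * fderiv ℝ (sg w N δ) (Phi w N z) (e2 1) = (deriv w (z 0) + z 1 • deriv N (z 0)) 0 := by
  have h0 := H.sg_fderiv hz (e2 0)
  have h1 := H.sg_fderiv hz (e2 1)
  rw [PhiD_apply] at h0 h1
  simp only [e2, PiLp.single_apply] at h0 h1
  simp at h0 h1
  rw [PhiD_det]
  set a := deriv w (z 0) + z 1 • deriv N (z 0)
  have ha : fderiv ℝ (sg w N δ) (Phi w N z) a = 0 := by simpa [a] using h0
  rw [clm_E2] at ha h1
  unfold cr
  set L0 := fderiv ℝ (sg w N δ) (Phi w N z) (e2 0)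
  set L1 := fderiv ℝ (sg w N δ) (Phi w N z) (e2 1)
  constructor
  · linear_combination (N (z 0) 1) * ha - (a 1) * h1
  · linear_combination (a 0) * h1 - (N (z 0) 0) * ha

lemma Collar.gdot_sg (H : Collar w N δ) {z : E2} (hz : |z 1| < δ) (p : E2 → ℝ) :
    (PhiD w N z).det * gdot p (sg w N δ) (Phi w N z) =
      fderiv ℝ p (Phi w N z) (perp2 (deriv w (z 0) + z 1 • deriv N (z 0))) := by
  obtain ⟨k0, k1⟩ := H.sg_grad hz
  rw [clm_E2 (fderiv ℝ p (Phi w N z))]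
  unfold gdot
  simp only [perp2_zero, perp2_one]
  linear_combination (fderiv ℝ p (Phi w N z) (e2 0)) * k0 + (fderiv ℝ p (Phi w N z) (e2 1)) * k1

lemma Collar.period (H : Collar w N δ) (z : E2) : ∃ z' : E2, z' 0 ∈ Ico (0:ℝ) 1 ∧ z' 1 = z 1 ∧ Phi w N z' = Phi w N z := by
  refine ⟨!₂[Int.fract (z 0), z 1], by simp [Int.fract_lt_one], by simp, ?_⟩
  have e1 := H.pw.sub_int_mul_eq ⌊z 0⌋ (x := z 0)
  have e2 := H.pN.sub_int_mul_eq ⌊z 0⌋ (x := z 0)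
  simp only [mul_one, Int.self_sub_floor] at e1 e2
  simp [Phi, e1, e2]

/-- curve image -/
lemma Collar.curve (H : Collar w N δ) : w '' Icc 0 1 = Phi w N '' {z | z 1 = 0} := by
  ext x; constructor
  · rintro ⟨t, -, rfl⟩
    exact ⟨!₂[t, 0], by simp, by simp [Phi]⟩
  · rintro ⟨z, hz, rfl⟩
    obtain ⟨z', h1, h2, h3⟩ := H.period z
    have hz' : z 1 = 0 := hz
    refine ⟨z' 0, ⟨h1.1, h1.2.le⟩, ?_⟩
    rw [← h3]; simp [Phi, h2, hz']

lemma null_line : volume {z : E2 | z 1 = 0} = 0 := by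
  have : {z : E2 | z 1 = 0} = (LinearMap.ker (cL 1 : E2 →ₗ[ℝ] ℝ) : Set E2) := by
    ext z; simp
  rw [this]
  apply Measure.addHaar_submodule
  intro h
  have : e2 1 ∈ LinearMap.ker (cL 1 : E2 →ₗ[ℝ] ℝ) := by rw [h]; trivial
  simp [e2] at this

lemma Collar.null (H : Collar w N δ) : volume (w '' Icc 0 1) = 0 := by
  rw [H.curve]
  exact addHaar_image_eq_zero_of_differentiableOn_of_addHaar_eq_zero volume
    (H.contDiff.differentiable one_ne_zero).differentiableOn null_line

end
end

section
lemma side_of {Q S : Set E2} (hQ : IsPreconnected Q) (hS : IsOpen S) (hd : ∀ x ∈ Q, x ∉ frontier S)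
    (hne : (Q ∩ S).Nonempty) : Q ⊆ S := by
  have hsub : Q ⊆ S ∪ (closure S)ᶜ := by
    intro x hx
    by_cases h : x ∈ closure S
    · left; by_contra h2
      exact hd x hx (by rw [hS.frontier_eq]; exact ⟨h, h2⟩)
    · right; exact h
  refine hQ.subset_left_of_subset_union hS isClosed_closure.isOpen_compl ?_ hsub hne
  rw [Set.disjoint_left]
  intro x hx h2
  exact h2 (subset_closure hx)

lemma convex_slab (a b : ℝ) : Convex ℝ {z : E2 | a < z 1 ∧ z 1 < b} := by
  have h1 := convex_halfSpace_gt (𝕜 := ℝ) (E := E2) (f := fun z => z 1) (cL 1).toLinearMap.isLinear a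
  have h2 := convex_halfSpace_lt (𝕜 := ℝ) (E := E2) (f := fun z => z 1) (cL 1).toLinearMap.isLinear b
  exact h1.inter h2

section
variable {w N : ℝ → E2} {δ : ℝ}

lemma Collar.slab_conn (H : Collar w N δ) (a b : ℝ) : IsPreconnected (Phi w N '' {z | a < z 1 ∧ z 1 < b}) :=
  (convex_slab a b).isPreconnected.image _ H.contDiff.continuous.continuousOn

lemma Collar.off_curve (H : Collar w N δ) {z : E2} (hz : |z 1| < δ) : Phi w N z ∈ w '' Icc 0 1 ↔ z 1 = 0 := by
  rw [H.curve]
  constructor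
  · rintro ⟨z', h1, h2⟩
    have h1' : z' 1 = 0 := h1
    rw [(H.inj z z' hz (by rw [h1']; simpa using H.hδ) h2.symm).2, h1']
  · intro h; exact ⟨z, h, rfl⟩

lemma Collar.N_bdd (H : Collar w N δ) : ∃ C > 0, ∀ t, ‖N t‖ ≤ C := by
  obtain ⟨C, hC⟩ := isCompact_Icc.exists_bound_of_continuousOn (s := Icc (0:ℝ) 1) H.hN.continuous.continuousOn
  refine ⟨max C 1, by positivity, fun t => ?_⟩
  have e2 := H.pN.sub_int_mul_eq ⌊t⌋ (x := t)
  simp only [mul_one, Int.self_sub_floor] at e2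
  rw [← e2]
  exact (hC _ ⟨Int.fract_nonneg _, (Int.fract_lt_one _).le⟩).trans (le_max_left _ _)

lemma Collar.shrink (H : Collar w N δ) {G : Set E2} (hG : IsCompact G) (hd : Disjoint G (w '' Icc 0 1)) :
    ∃ δ', Collar w N δ' ∧ ∀ z : E2, |z 1| < δ' → Phi w N z ∉ G := by
  have hcw : IsCompact (w '' Icc 0 1) := isCompact_Icc.image H.hw.continuous
  obtain ⟨r, hr, h⟩ := hd.exists_thickenings hG hcw.isClosed
  obtain ⟨C, hC, hN⟩ := H.N_bdd
  refine ⟨min δ (r / C), H.mono (by have := H.hδ; positivity) (min_le_left _ _), ?_⟩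
  intro z hz hzG
  have h1 : Phi w N z ∈ thickening r G := self_subset_thickening hr _ hzG
  have h2 : Phi w N z ∈ thickening r (w '' Icc 0 1) := by
    rw [mem_thickening_iff]
    have hc : w (z 0) ∈ w '' Icc 0 1 := by
      rw [H.curve]; exact ⟨!₂[z 0, 0], by simp, by simp [Phi]⟩
    refine ⟨w (z 0), hc, ?_⟩
    rw [dist_eq_norm]
    simp only [Phi, add_sub_cancel_left, norm_smul, Real.norm_eq_abs]
    calc |z 1| * ‖N (z 0)‖ ≤ |z 1| * C := by gcongr; exact hN _
      _ < (r / C) * C := by gcongr; exact hz.trans_le (min_le_right _ _)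
      _ = r := by field_simp
  exact Set.disjoint_left.1 h h1 h2

/-- the data of the inner collar relative to `D` and `U`. -/
structure Sides (w N : ℝ → E2) (δ : ℝ) (D U : Set E2) : Prop extends Collar w N δ where
  plus : ∀ z : E2, 0 < z 1 → z 1 < δ → Phi w N z ∈ D
  minus : ∀ z : E2, -δ < z 1 → z 1 < 0 → Phi w N z ∈ U

lemma Collar.sides (H : Collar w N δ) {D U G : Set E2} {ℓ : ℝ} (hℓ : 0 < ℓ) (hn : ∀ t : ℝ, ‖deriv w t‖ = ℓ)
    (hD : IsOpen D) (hU : IsOpen U)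
    (hfD : frontier D = G ∪ w '' Icc 0 1) (hfU : frontier U = w '' Icc 0 1) (hG : IsCompact G)
    (hdis : Disjoint G (w '' Icc 0 1)) (hUD : closure U ∩ D = ∅)
    (hnor : ∀ t : ℝ, ∀ᶠ s in 𝓝[>] (0:ℝ), w t + s • (ℓ⁻¹ • perp2 (deriv w t)) ∉ closure U) :
    ∃ δ', Sides w N δ' D U := by
  obtain ⟨δ, H, hGd⟩ := H.shrink hG hdis
  refine ⟨δ, ?_⟩
  set Qp := Phi w N '' {z | 0 < z 1 ∧ z 1 < δ} with hQp
  set Qm := Phi w N '' {z | -δ < z 1 ∧ z 1 < 0} with hQm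
  have hδ := H.hδ
  have off : ∀ z : E2, |z 1| < δ → z 1 ≠ 0 → Phi w N z ∉ frontier D ∧ Phi w N z ∉ frontier U := by
    intro z hz hz0
    have h1 : Phi w N z ∉ w '' Icc 0 1 := fun h => hz0 ((H.off_curve hz).1 h)
    rw [hfD, hfU]
    exact ⟨fun h => h.elim (hGd z hz) h1, h1⟩
  have cw : IsPreconnected Qp := H.slab_conn 0 δ
  have cm : IsPreconnected Qm := H.slab_conn (-δ) 0
  have fp : ∀ x ∈ Qp, x ∉ frontier D ∧ x ∉ frontier U := by
    rintro x ⟨z, hz, rfl⟩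
    exact off z (by rw [abs_lt]; constructor <;> linarith [hz.1, hz.2]) hz.1.ne'
  have fm : ∀ x ∈ Qm, x ∉ frontier D ∧ x ∉ frontier U := by
    rintro x ⟨z, hz, rfl⟩
    exact off z (by rw [abs_lt]; constructor <;> linarith [hz.1, hz.2]) hz.2.ne
  have hw0 : w 0 ∈ w '' Icc (0:ℝ) 1 := ⟨0, by simp, rfl⟩
  have hPhi0 : Phi w N 0 = w 0 := by simp [Phi]
  have hV0 : VC w N δ ∈ 𝓝 (w 0) := H.isOpen_V.mem_nhds ⟨0, by simpa using hδ, hPhi0⟩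
  have meet : ∀ S : Set E2, IsOpen S → w 0 ∈ frontier S → (w '' Icc (0:ℝ) 1 ∩ S = ∅) →
      (Qp ∩ S).Nonempty ∨ (Qm ∩ S).Nonempty := by
    intro S hS hf hemp
    obtain ⟨x, hxV, hxS⟩ := mem_closure_iff_nhds.1 (frontier_subset_closure hf) _ hV0
    obtain ⟨z, hz, rfl⟩ := hxV
    have hz : |z 1| < δ := hz
    have hz' := abs_lt.1 hz
    rcases lt_trichotomy (z 1) 0 with h | h | h
    · right; exact ⟨_, ⟨z, ⟨hz'.1, h⟩, rfl⟩, hxS⟩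
    · exfalso
      have : Phi w N z ∈ w '' Icc (0:ℝ) 1 ∩ S := ⟨(H.off_curve hz).2 h, hxS⟩
      rw [hemp] at this; exact this
    · left; exact ⟨_, ⟨z, ⟨h, hz'.2⟩, rfl⟩, hxS⟩
  have disjF : ∀ S : Set E2, IsOpen S → w '' Icc (0:ℝ) 1 ⊆ frontier S → w '' Icc (0:ℝ) 1 ∩ S = ∅ := by
    intro S hS hsub
    ext x; simp only [mem_inter_iff, mem_empty_iff_false, iff_false, not_and]
    intro hx hxS
    have := hsub hx
    rw [hS.frontier_eq] at this
    exact this.2 hxS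
  have sD : w '' Icc (0:ℝ) 1 ⊆ frontier D := by rw [hfD]; exact subset_union_right
  have sU : w '' Icc (0:ℝ) 1 ⊆ frontier U := hfU.symm.subset
  -- points along the normal are in Qp
  have hnorQ : ∃ x ∈ Qp, x ∉ closure U := by
    set n := ℓ⁻¹ • perp2 (deriv w 0) with hn'
    have hd0 : |(0:E2) 1| < δ := by simpa using hδ
    have hsd := ((H.sg_contDiffAt ⟨0, hd0, rfl⟩).differentiableAt one_ne_zero).hasFDerivAt
    have hline : HasDerivAt (fun s : ℝ => w 0 + s • n) n 0 := by
      simpa using ((hasDerivAt_id (0:ℝ)).smul_const n).const_add (w 0)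
    rw [hPhi0] at hsd
    have hcomp := HasFDerivAt.comp_hasDerivAt (x := (0:ℝ)) (f := fun s : ℝ => w 0 + s • n) (l := sg w N δ) (f' := n)
      (l' := fderiv ℝ (sg w N δ) (w 0)) (by simpa using hsd) hline
    obtain ⟨k0, k1⟩ := H.sg_grad hd0
    have hdet := H.det_pos hd0
    have hval : 0 < fderiv ℝ (sg w N δ) (w 0) n := by
      rw [hPhi0] at k0 k1
      have e0 : fderiv ℝ (sg w N δ) (w 0) n * (PhiD w N 0).det = ℓ := by
        rw [clm_E2]
        simp only [PiLp.zero_apply, zero_smul, add_zero] at k0 k1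
        have : ℓ ^ 2 = (deriv w 0) 0 ^ 2 + (deriv w 0) 1 ^ 2 := by rw [← hn 0, norm_sq_E2]
        have e : n 0 = - ℓ⁻¹ * deriv w 0 1 := by simp [hn']
        have e' : n 1 = ℓ⁻¹ * deriv w 0 0 := by simp [hn']
        rw [e, e']
        have hl : ℓ⁻¹ * ℓ ^ 2 = ℓ := by field_simp
        linear_combination (- ℓ⁻¹ * deriv w 0 1) * k0 + (ℓ⁻¹ * deriv w 0 0) * k1 - ℓ⁻¹ * this + hl
      by_contra hcon
      nlinarith
    have h00 : sg w N δ (w 0) = 0 := by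
      have := H.sg_Phi hd0
      rw [hPhi0] at this; simpa using this
    have hpos : ∀ᶠ s in 𝓝[>] (0:ℝ), 0 < sg w N δ (w 0 + s • n) := by
      have hsl := hasDerivAt_iff_tendsto_slope.1 hcomp
      have h1 : ∀ᶠ s in 𝓝[≠] (0:ℝ), 0 < slope (sg w N δ ∘ fun s : ℝ => w 0 + s • n) 0 s :=
        hsl.eventually (lt_mem_nhds hval)
      have h2 : ∀ᶠ s in 𝓝[>] (0:ℝ), 0 < slope (sg w N δ ∘ fun s : ℝ => w 0 + s • n) 0 s :=
        h1.filter_mono (nhdsWithin_mono _ (fun s hs => ne_of_gt hs))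
      filter_upwards [h2, self_mem_nhdsWithin] with s hs hs0
      rw [slope_def_field] at hs
      simp only [Function.comp, zero_smul, add_zero, h00, sub_zero] at hs
      have hs0' : (0:ℝ) < s := hs0
      have := mul_pos hs hs0'
      rwa [div_mul_cancel₀ _ hs0'.ne'] at this
    have hVs : ∀ᶠ s in 𝓝[>] (0:ℝ), w 0 + s • n ∈ VC w N δ := by
      apply nhdsWithin_le_nhds
      apply hline.continuousAt.preimage_mem_nhds
      simpa using hV0
    obtain ⟨s, ⟨h1, h2⟩, h3⟩ := ((hpos.and hVs).and (hnor 0)).exists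
    obtain ⟨z, hz, hze⟩ := h2
    have hz : |z 1| < δ := hz
    refine ⟨_, ⟨z, ⟨?_, (abs_lt.1 hz).2⟩, hze⟩, h3⟩
    rw [← hze, H.sg_Phi hz] at h1
    exact h1
  have hQmU : Qm ⊆ U := by
    rcases meet U hU (sU hw0) (disjF U hU sU) with h | h
    · exfalso
      obtain ⟨x, hx, hxU⟩ := hnorQ
      exact hxU (subset_closure (side_of cw hU (fun x hx => (fp x hx).2) h hx))
    · exact side_of cm hU (fun x hx => (fm x hx).2) h
  have hQpD : Qp ⊆ D := by
    rcases meet D hD (sD hw0) (disjF D hD sD) with h | h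
    · exact side_of cw hD (fun x hx => (fp x hx).1) h
    · exfalso
      obtain ⟨x, hx, hxD⟩ := h
      have : x ∈ closure U ∩ D := ⟨subset_closure (hQmU hx), hxD⟩
      rw [hUD] at this; exact this
  exact ⟨H, fun z h1 h2 => hQpD ⟨z, ⟨h1, h2⟩, rfl⟩, fun z h1 h2 => hQmU ⟨z, ⟨h1, h2⟩, rfl⟩⟩
end
end

section
/-- cutoff profile -/
def chi (r : ℝ) : ℝ := 1 - Real.smoothTransition (3 * r - 1)

lemma chi_contDiff : ContDiff ℝ 1 chi := by
  have : ContDiff ℝ 1 (fun r : ℝ => 3 * r - 1) := by fun_prop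
  exact contDiff_const.sub (Real.smoothTransition.contDiff.comp this)
lemma chi_one {r : ℝ} (h : r ≤ 1/3) : chi r = 1 := by
  unfold chi; rw [Real.smoothTransition.zero_of_nonpos (by linarith)]; simp
lemma chi_zero {r : ℝ} (h : 2/3 ≤ r) : chi r = 0 := by
  unfold chi; rw [Real.smoothTransition.one_of_one_le (by linarith)]; simp
lemma chi_mem (r : ℝ) : 0 ≤ chi r ∧ chi r ≤ 1 := by
  unfold chi
  have h1 := Real.smoothTransition.nonneg (3 * r - 1)
  have h2 := Real.smoothTransition.le_one (3 * r - 1)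
  constructor <;> linarith

open Classical in
def etaF (w N : ℝ → E2) (δ : ℝ) (U : Set E2) (ε : ℝ) (x : E2) : ℝ :=
  if x ∈ VC w N δ then chi (sg w N δ x / ε) else if x ∈ U then 1 else 0

def Ceps (w N : ℝ → E2) (ε : ℝ) : Set E2 := Phi w N '' {z | z 0 ∈ Icc (0:ℝ) 1 ∧ z 1 ∈ Icc 0 (2 * ε / 3)}

lemma isCompact_box (a b c d : ℝ) : IsCompact {z : E2 | z 0 ∈ Icc a b ∧ z 1 ∈ Icc c d} := by
  have : {z : E2 | z 0 ∈ Icc a b ∧ z 1 ∈ Icc c d} =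
      (fun y : ℝ × ℝ => (!₂[y.1, y.2] : E2)) '' (Icc a b ×ˢ Icc c d) := by
    ext z; constructor
    · intro h; exact ⟨(z 0, z 1), ⟨h.1, h.2⟩, by apply E2_ext <;> simp⟩
    · rintro ⟨y, hy, rfl⟩; exact ⟨by simpa using hy.1, by simpa using hy.2⟩
  rw [this]
  apply (isCompact_Icc.prod isCompact_Icc).image
  refine (PiLp.continuous_toLp 2 _).comp (continuous_pi fun i => ?_)
  fin_cases i
  · exact continuous_fst
  · exact continuous_snd

section
variable {w N : ℝ → E2} {δ : ℝ} {D U : Set E2}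

lemma Sides.eta_U (H : Sides w N δ D U) (hU : IsOpen U) (hfU : frontier U = w '' Icc 0 1)
    (hUD : closure U ∩ D = ∅) {ε : ℝ} (hε : 0 < ε) {x : E2} (hx : x ∈ U) : etaF w N δ U ε x = 1 := by
  unfold etaF
  split_ifs with h
  · obtain ⟨z, hz, rfl⟩ := h
    have hz : |z 1| < δ := hz
    rw [H.sg_Phi hz]
    apply chi_one
    have : z 1 ≤ 0 := by
      by_contra h
      push Not at h
      have h1 := H.plus z h (abs_lt.1 hz).2
      have : Phi w N z ∈ closure U ∩ D := ⟨subset_closure hx, h1⟩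
      rw [hUD] at this; exact this
    have : z 1 / ε ≤ 0 := div_nonpos_of_nonpos_of_nonneg this hε.le
    linarith
  · rfl

lemma Sides.eta_zero (H : Sides w N δ D U) {ε : ℝ} (hε : 0 < ε) {x : E2} (hx : x ∉ closure U)
    (hC : x ∉ Ceps w N ε) : etaF w N δ U ε x = 0 := by
  unfold etaF
  have hxU : x ∉ U := fun h => hx (subset_closure h)
  rw [if_neg hxU]
  split_ifs with h
  · obtain ⟨z, hz, rfl⟩ := h
    have hz : |z 1| < δ := hz
    rw [H.sg_Phi hz]
    apply chi_zero
    by_contra hcon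
    push Not at hcon
    rw [div_lt_iff₀ hε] at hcon
    rcases lt_or_ge (z 1) 0 with h | h
    · exact hxU (H.minus z (abs_lt.1 hz).1 h)
    · obtain ⟨z', h1, h2, h3⟩ := H.period z
      apply hC
      refine ⟨z', ⟨⟨h1.1, h1.2.le⟩, ?_⟩, h3⟩
      rw [h2]; exact ⟨h, by linarith⟩
  · rfl

lemma Collar.Ceps_compact (H : Collar w N δ) (ε : ℝ) : IsCompact (Ceps w N ε) :=
  (isCompact_box 0 1 0 (2*ε/3)).image H.contDiff.continuous

lemma Collar.Ceps_V (H : Collar w N δ) {ε : ℝ} (hε : 0 < ε) (hεδ : ε < δ) : Ceps w N ε ⊆ VC w N δ := by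
  rintro x ⟨z, hz, rfl⟩
  refine ⟨z, ?_, rfl⟩
  simp only [mem_ofPred_eq]
  rw [abs_lt]; constructor <;> linarith [hz.2.1, hz.2.2]

lemma Collar.curve_V (H : Collar w N δ) : w '' Icc 0 1 ⊆ VC w N δ := by
  rw [H.curve]
  rintro x ⟨z, hz, rfl⟩
  have hz : z 1 = 0 := hz
  exact ⟨z, by simp [hz, H.hδ], rfl⟩

lemma eta_V_eq (H : Collar w N δ) {ε : ℝ} {x : E2} (hx : x ∈ VC w N δ) :
    etaF w N δ U ε =ᶠ[𝓝 x] fun y => chi (sg w N δ y / ε) := by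
  filter_upwards [H.isOpen_V.mem_nhds hx] with y hy
  simp [etaF, hy]

lemma clos_eq (hU : IsOpen U) (hfU : frontier U = w '' Icc 0 1) {x : E2} (hx : x ∈ closure U) :
    x ∈ U ∨ x ∈ w '' Icc 0 1 := by
  by_cases h : x ∈ U
  · left; exact h
  · right; rw [← hfU, hU.frontier_eq]; exact ⟨hx, h⟩

lemma Sides.eta_tsupport (H : Sides w N δ D U) {ε : ℝ} (hε : 0 < ε) :
    tsupport (etaF w N δ U ε) ⊆ closure U ∪ Ceps w N ε := by
  apply closure_minimal _ (isClosed_closure.union (H.Ceps_compact ε).isClosed)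
  intro x hx
  by_contra h
  rw [mem_union, not_or] at h
  exact hx (H.eta_zero hε h.1 h.2)

lemma Sides.eta_contDiff (H : Sides w N δ D U) (hU : IsOpen U) (hfU : frontier U = w '' Icc 0 1)
    (hUD : closure U ∩ D = ∅) {ε : ℝ} (hε : 0 < ε) (hεδ : ε < δ) : ContDiff ℝ 1 (etaF w N δ U ε) := by
  have hV : ∀ x ∈ VC w N δ, ContDiffAt ℝ 1 (etaF w N δ U ε) x := by
    intro x hx
    refine ContDiffAt.congr_of_eventuallyEq ?_ (eta_V_eq H.toCollar hx)
    exact chi_contDiff.contDiffAt.comp x ((H.sg_contDiffAt hx).div_const ε)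
  apply contDiff_of_ts
  intro x hx
  rcases H.eta_tsupport hε hx with h | h
  · rcases clos_eq hU hfU h with h | h
    · have : etaF w N δ U ε =ᶠ[𝓝 x] fun _ => 1 := by
        filter_upwards [hU.mem_nhds h] with y hy using H.eta_U hU hfU hUD hε hy
      exact contDiffAt_const.congr_of_eventuallyEq this
    · exact hV x (H.curve_V h)
  · exact hV x (H.Ceps_V hε hεδ h)

lemma Sides.eta_hcs (H : Sides w N δ D U) (hUb : Bornology.IsBounded U) {ε : ℝ} (hε : 0 < ε) :
    HasCompactSupport (etaF w N δ U ε) :=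
  (hUb.isCompact_closure.union (H.Ceps_compact ε)).of_isClosed_subset (isClosed_tsupport _) (H.eta_tsupport hε)

lemma Sides.eta_near (H : Sides w N δ D U) (hU : IsOpen U) (hfU : frontier U = w '' Icc 0 1)
    (hUD : closure U ∩ D = ∅) {ε : ℝ} (hε : 0 < ε) {x : E2} (hx : x ∈ closure U) :
    ∀ᶠ y in 𝓝 x, etaF w N δ U ε y = 1 := by
  rcases clos_eq hU hfU hx with h | h
  · filter_upwards [hU.mem_nhds h] with y hy using H.eta_U hU hfU hUD hε hy
  · have hV := H.curve_V h
    have h1 := eta_V_eq (U := U) (ε := ε) H.toCollar hV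
    have h2 : ∀ᶠ y in 𝓝 x, sg w N δ y < ε / 3 := by
      apply (H.sg_contDiffAt hV).continuousAt.eventually_lt continuousAt_const
      obtain ⟨z, hz, rfl⟩ := hV
      rw [H.sg_Phi hz, (H.off_curve hz).1 h]; positivity
    filter_upwards [h1, h2] with y hy hy2
    rw [hy]; apply chi_one
    rw [div_le_iff₀ hε]; linarith

lemma Sides.Ceps_sub (H : Sides w N δ D U) {ε : ℝ} (hε : 0 < ε) (hεδ : ε < δ) :
    Ceps w N ε ⊆ w '' Icc 0 1 ∪ Phi w N '' {z | z 0 ∈ Ico (0:ℝ) 1 ∧ z 1 ∈ Ioo 0 ε} := by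
  rintro x ⟨z, hz, rfl⟩
  have hzd : |z 1| < δ := by rw [abs_lt]; constructor <;> linarith [hz.2.1, hz.2.2]
  rcases eq_or_lt_of_le hz.2.1 with h | h
  · left; exact (H.off_curve hzd).2 h.symm
  · right
    obtain ⟨z', h1, h2, h3⟩ := H.period z
    exact ⟨z', ⟨h1, by rw [h2]; exact ⟨h, by linarith [hz.2.2]⟩⟩, h3⟩

lemma Sides.eta_tsupport' (H : Sides w N δ D U) (hfU : frontier U = w '' Icc 0 1) {ε : ℝ} (hε : 0 < ε) (hεδ : ε < δ) :
    tsupport (etaF w N δ U ε) ⊆ D ∪ closure U := by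
  intro x hx
  rcases H.eta_tsupport hε hx with h | h
  · right; exact h
  · rcases H.Ceps_sub hε hεδ h with h | ⟨z, hz, rfl⟩
    · right; rw [← hfU] at h; exact frontier_subset_closure h
    · left; exact H.plus z hz.2.1 (hz.2.2.trans hεδ)

lemma eta_mem (ε : ℝ) (x : E2) : 0 ≤ etaF w N δ U ε x ∧ etaF w N δ U ε x ≤ 1 := by
  unfold etaF; split_ifs
  · exact chi_mem _
  · simp
  · simp

lemma Sides.eta_int_lim (H : Sides w N δ D U) (hU : IsOpen U) (hUb : Bornology.IsBounded U)
    (hDb : Bornology.IsBounded D) (hfU : frontier U = w '' Icc 0 1)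
    (hUD : closure U ∩ D = ∅) :
    Tendsto (fun ε => ∫ x, etaF w N δ U ε x) (𝓝[>] 0) (𝓝 (volume.real U)) := by
  have hlim : ∫ x, U.indicator (fun _ => (1:ℝ)) x = volume.real U := by
    rw [integral_indicator hU.measurableSet, setIntegral_const]; simp
  rw [← hlim]
  have hsmall : ∀ᶠ ε in 𝓝[>] (0:ℝ), 0 < ε ∧ ε < δ := by
    filter_upwards [Ioo_mem_nhdsGT H.hδ] with ε hε using hε
  set B := closure (D ∪ U) with hB
  have hBc : IsCompact B := (hDb.union hUb).isCompact_closure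
  apply tendsto_integral_filter_of_dominated_convergence (B.indicator fun _ => (1:ℝ))
  · filter_upwards [hsmall] with ε hε
    exact (H.eta_contDiff hU hfU hUD hε.1 hε.2).continuous.aestronglyMeasurable
  · filter_upwards [hsmall] with ε hε
    refine Eventually.of_forall fun x => ?_
    rw [Real.norm_of_nonneg (eta_mem _ _).1]
    by_cases hx : x ∈ B
    · rw [indicator_of_mem hx]; exact (eta_mem _ _).2
    · rw [indicator_of_notMem hx]
      apply le_of_eq
      apply image_eq_zero_of_notMem_tsupport
      intro h
      apply hx
      rcases H.eta_tsupport' hfU hε.1 hε.2 h with h | h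
      · exact subset_closure (Or.inl h)
      · exact closure_mono subset_union_right h
  · exact (integrable_indicator_iff hBc.measurableSet).2 (integrableOn_const hBc.measure_lt_top.ne)
  · have hnull : ∀ᵐ x : E2, x ∉ w '' Icc 0 1 := measure_eq_zero_iff_ae_notMem.1 H.null
    filter_upwards [hnull] with x hx
    by_cases hxU : x ∈ U
    · rw [indicator_of_mem hxU]
      apply tendsto_const_nhds.congr'
      filter_upwards [hsmall] with ε hε
      exact (H.eta_U hU hfU hUD hε.1 hxU).symm
    · rw [indicator_of_notMem hxU]
      have hxc : x ∉ closure U := fun h => (clos_eq hU hfU h).elim hxU hx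
      apply tendsto_const_nhds.congr'
      by_cases hV : x ∈ VC w N δ
      · obtain ⟨z, hz, rfl⟩ := hV
        have hz : |z 1| < δ := hz
        have hz0 : 0 < z 1 := by
          rcases lt_trichotomy (z 1) 0 with h | h | h
          · exact absurd (H.minus z (abs_lt.1 hz).1 h) hxU
          · exact absurd ((H.off_curve hz).2 h) hx
          · exact h
        filter_upwards [Ioo_mem_nhdsGT hz0] with ε hε
        have hV : Phi w N z ∈ VC w N δ := ⟨z, hz, rfl⟩
        rw [etaF, if_pos hV, H.sg_Phi hz, chi_zero]
        rw [le_div_iff₀ hε.1]; linarith [hε.2, hε.1]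
      · filter_upwards with ε
        rw [etaF, if_neg hV, if_neg hxU]
end
end

section
lemma chi_deriv_cont : Continuous (deriv chi) := chi_contDiff.continuous_deriv le_rfl

lemma chi_deriv_zero {r : ℝ} (h : r ∉ Icc (0:ℝ) 1) : deriv chi r = 0 := by
  rw [mem_Icc, not_and_or] at h
  have : ∃ c, chi =ᶠ[𝓝 r] fun _ => c := by
    rcases h with h | h
    · refine ⟨1, ?_⟩
      filter_upwards [Iio_mem_nhds (show r < 1/3 by linarith)] with y hy using chi_one (le_of_lt hy)
    · refine ⟨0, ?_⟩
      filter_upwards [Ioi_mem_nhds (show 2/3 < r by linarith)] with y hy using chi_zero (le_of_lt hy)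
  obtain ⟨c, hc⟩ := this
  rw [hc.deriv_eq]; simp

lemma chi_deriv_bdd : ∃ C : ℝ, 0 < C ∧ ∀ r, |deriv chi r| ≤ C := by
  obtain ⟨C, hC⟩ := (isCompact_Icc (a := (0:ℝ)) (b := 1)).exists_bound_of_continuousOn chi_deriv_cont.continuousOn
  refine ⟨max C 1, by positivity, fun r => ?_⟩
  by_cases h : r ∈ Icc (0:ℝ) 1
  · exact (hC r h).trans (le_max_left _ _)
  · rw [chi_deriv_zero h]; simp

lemma chi_int {ε : ℝ} (hε : 0 < ε) : ∫ y in Ioo 0 ε, ε⁻¹ * deriv chi (y / ε) = -1 := by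
  rw [← integral_Ioc_eq_integral_Ioo, ← intervalIntegral.integral_of_le hε.le]
  have h : ∀ y ∈ uIcc 0 ε, HasDerivAt (fun y => chi (y / ε)) (ε⁻¹ * deriv chi (y / ε)) y := by
    intro y _
    have h1 := ((chi_contDiff.differentiable one_ne_zero (y/ε)).hasDerivAt).comp y ((hasDerivAt_id y).div_const ε)
    refine h1.congr_deriv ?_
    rw [one_div, mul_comm]
  rw [intervalIntegral.integral_eq_sub_of_hasDerivAt h]
  · rw [div_self hε.ne', chi_zero (by norm_num), zero_div, chi_one (by norm_num)]; norm_num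
  · apply Continuous.intervalIntegrable
    have := chi_deriv_cont
    fun_prop

lemma flux_lim_aux {g : ℝ × ℝ → ℝ} {δ : ℝ} (hδ : 0 < δ) (hg : ContinuousOn g (Icc 0 1 ×ˢ Icc 0 δ)) :
    Tendsto (fun ε => ∫ y in Ico (0:ℝ) 1 ×ˢ Ioo (0:ℝ) ε, (ε⁻¹ * deriv chi (y.2/ε)) * g y) (𝓝[>] 0)
      (𝓝 (-∫ x in (0:ℝ)..1, g (x,0))) := by
  obtain ⟨C, hC, hCb⟩ := chi_deriv_bdd
  have hcomp : IsCompact (Icc (0:ℝ) 1 ×ˢ Icc (0:ℝ) δ) := isCompact_Icc.prod isCompact_Icc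
  have hu := hcomp.uniformContinuousOn_of_continuous hg
  rw [Metric.uniformContinuousOn_iff] at hu
  have hcd := chi_deriv_cont
  rw [Metric.tendsto_nhds]
  intro η hη
  obtain ⟨d, hd, hdd⟩ := hu (η / (2 * C)) (by positivity)
  filter_upwards [Ioo_mem_nhdsGT (lt_min hd hδ)] with ε hε
  have hε0 := hε.1
  have hεd : ε < d := hε.2.trans_le (min_le_left _ _)
  have hεδ : ε < δ := hε.2.trans_le (min_le_right _ _)
  have hsub : Ico (0:ℝ) 1 ×ˢ Ioo (0:ℝ) ε ⊆ Icc (0:ℝ) 1 ×ˢ Icc (0:ℝ) δ := by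
    intro y hy; exact ⟨⟨hy.1.1, hy.1.2.le⟩, hy.2.1.le, (hy.2.2.trans hεδ).le⟩
  have hg0 : ContinuousOn (fun y : ℝ × ℝ => g (y.1, 0)) (Icc (0:ℝ) 1 ×ˢ Icc (0:ℝ) δ) := by
    apply hg.comp (by fun_prop)
    intro y hy; exact ⟨hy.1, le_rfl, hδ.le⟩
  have hk : Continuous (fun y : ℝ × ℝ => ε⁻¹ * deriv chi (y.2/ε)) := by fun_prop
  have i1 : IntegrableOn (fun y => (ε⁻¹ * deriv chi (y.2/ε)) * g y) (Ico (0:ℝ) 1 ×ˢ Ioo (0:ℝ) ε) :=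
    ((hk.continuousOn.mul hg).integrableOn_compact hcomp).mono_set hsub
  have i2 : IntegrableOn (fun y => (ε⁻¹ * deriv chi (y.2/ε)) * g (y.1,0)) (Ico (0:ℝ) 1 ×ˢ Ioo (0:ℝ) ε) :=
    ((hk.continuousOn.mul hg0).integrableOn_compact hcomp).mono_set hsub
  have e1 : ∫ y in Ico (0:ℝ) 1 ×ˢ Ioo (0:ℝ) ε, (ε⁻¹ * deriv chi (y.2/ε)) * g (y.1,0) = -∫ x in (0:ℝ)..1, g (x,0) := by
    have := setIntegral_prod_mul (μ := volume) (ν := volume) (fun x : ℝ => g (x,0)) (fun y : ℝ => ε⁻¹ * deriv chi (y/ε)) (Ico (0:ℝ) 1) (Ioo (0:ℝ) ε)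
    rw [chi_int hε0, integral_Ico_eq_integral_Ioc, ← intervalIntegral.integral_of_le zero_le_one] at this
    rw [mul_neg_one] at this
    rw [← this]
    congr 1; ext y; ring
  rw [← e1, dist_eq_norm, ← integral_sub i1 i2]
  have hvol : (volume : Measure (ℝ × ℝ)) (Ico (0:ℝ) 1 ×ˢ Ioo (0:ℝ) ε) = ENNReal.ofReal ε := by
    rw [Measure.volume_eq_prod, Measure.prod_prod]; simp
  have hb := norm_setIntegral_le_of_norm_le_const (μ := volume) (s := Ico (0:ℝ) 1 ×ˢ Ioo (0:ℝ) ε)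
    (f := fun y => (ε⁻¹ * deriv chi (y.2/ε)) * g y - (ε⁻¹ * deriv chi (y.2/ε)) * g (y.1,0))
    (C := ε⁻¹ * C * (η / (2*C))) (by rw [hvol]; exact ENNReal.ofReal_lt_top) (by
      intro y hy
      rw [← mul_sub, norm_mul, norm_mul, norm_inv, norm_of_nonneg hε0.le]
      have h1 : ‖g y - g (y.1, 0)‖ ≤ η / (2*C) := by
        have := hdd y (hsub hy) (y.1, 0) ⟨(hsub hy).1, le_rfl, hδ.le⟩ (by
          rw [Prod.dist_eq]; simp only [dist_self]
          rw [max_lt_iff]; refine ⟨hd, ?_⟩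
          rw [Real.dist_eq, sub_zero, abs_of_pos hy.2.1]; exact hy.2.2.trans hεd)
        rw [← dist_eq_norm]; exact this.le
      have h2 := hCb (y.2/ε)
      rw [← norm_eq_abs] at h2
      gcongr)
  refine hb.trans_lt ?_
  rw [measureReal_def, hvol, ENNReal.toReal_ofReal hε0.le]
  have : ε⁻¹ * C * (η / (2*C)) * ε = η / 2 := by field_simp
  rw [this]; linarith

lemma e2_prod (f : ℝ × ℝ → ℝ) (A B : Set ℝ) :
    ∫ z : E2 in {z : E2 | z 0 ∈ A ∧ z 1 ∈ B}, f (z 0, z 1) = ∫ y in A ×ˢ B, f y := by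
  have m1 : MeasurePreserving (MeasurableEquiv.toLp 2 (Fin 2 → ℝ)).symm volume volume :=
    (EuclideanSpace.volume_preserving_symm_measurableEquiv_toLp (Fin 2))
  have m2 := (volume_preserving_finTwoArrow ℝ)
  have m3 := m2.comp m1
  have hemb : MeasurableEmbedding (MeasurableEquiv.finTwoArrow ∘ (MeasurableEquiv.toLp 2 (Fin 2 → ℝ)).symm : E2 → ℝ × ℝ) :=
    (MeasurableEquiv.measurableEmbedding _).comp (MeasurableEquiv.measurableEmbedding _)
  have := m3.setIntegral_preimage_emb hemb f (A ×ˢ B)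
  exact this

variable {w N : ℝ → E2} {δ : ℝ} {D U : Set E2}

lemma Sides.mem_closure (H : Sides w N δ D U) {z : E2} (h0 : 0 ≤ z 1) (h1 : z 1 < δ) : Phi w N z ∈ closure D := by
  rcases h0.eq_or_lt with h | h
  · have hc : Tendsto (fun s : ℝ => Phi w N (z + s • e2 1)) (𝓝[>] 0) (𝓝 (Phi w N (z + (0:ℝ) • e2 1))) := by
      have : Continuous (fun s : ℝ => Phi w N (z + s • e2 1)) := H.contDiff.continuous.comp (by fun_prop)
      exact (this.tendsto 0).mono_left nhdsWithin_le_nhds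
    rw [zero_smul, add_zero] at hc
    refine mem_closure_of_tendsto hc ?_
    filter_upwards [Ioo_mem_nhdsGT H.hδ] with s hs
    apply H.plus <;> simp [e2, ← h, hs.1, hs.2]
  · exact subset_closure (H.plus z h h1)

lemma Sides.cont_G (H : Sides w N δ D U) {p : E2 → ℝ} (hp : ContDiffOn ℝ 1 p (closure D)) :
    ContinuousOn (fun z => fderivWithin ℝ p (closure D) (Phi w N z) (perp2 (deriv w (z 0) + z 1 • deriv N (z 0))))
      {z : E2 | 0 ≤ z 1 ∧ z 1 < δ} := by
  set P := {z : E2 | 0 ≤ z 1 ∧ z 1 < δ} with hP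
  have hconv : Convex ℝ P := by
    have h1 : Convex ℝ {z : E2 | 0 ≤ cL 1 z} := convex_halfSpace_ge (cL 1).isLinear 0
    have h2 : Convex ℝ {z : E2 | cL 1 z < δ} := convex_halfSpace_lt (cL 1).isLinear δ
    exact h1.inter h2
  have hInt : (interior P).Nonempty := by
    refine ⟨(δ/2) • e2 1, mem_interior_iff_mem_nhds.2 ?_⟩
    have hc1 : Continuous (fun z : E2 => z 1) := by fun_prop
    have : IsOpen {z : E2 | 0 < z 1 ∧ z 1 < δ} :=
      (isOpen_Ioi.preimage hc1).inter (isOpen_Iio.preimage hc1)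
    have hδ := H.hδ
    refine mem_of_superset (this.mem_nhds ?_) (fun z hz => ⟨hz.1.le, hz.2⟩)
    constructor <;> simp [e2] <;> linarith
  have hPu : UniqueDiffOn ℝ P := uniqueDiffOn_convex hconv hInt
  set S := Phi w N '' P with hS
  have hSu : UniqueDiffOn ℝ S := by
    rintro x ⟨z, hz, rfl⟩
    have hzd : |z 1| < δ := by rw [abs_lt]; constructor <;> linarith [hz.1, hz.2, H.hδ]
    refine ((H.hasFDerivAt z).hasFDerivWithinAt).uniqueDiffWithinAt (hPu z hz) ?_
    have := ((PhiD w N z).toContinuousLinearEquivOfDetNeZero (H.det_pos hzd).ne').surjective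
    exact this.denseRange
  have hSD : S ⊆ closure D := by
    rintro x ⟨z, hz, rfl⟩; exact H.mem_closure hz.1 hz.2
  have hc : ContinuousOn (fderivWithin ℝ p S) S := (hp.mono hSD).continuousOn_fderivWithin hSu le_rfl
  have hc2 : ContinuousOn (fderivWithin ℝ p (closure D)) S := by
    refine hc.congr fun x hx => ?_
    exact (fderivWithin_subset hSD (hSu x hx) (hp.differentiableOn one_ne_zero x (hSD hx))).symm
  have hc3 : ContinuousOn (fun z => fderivWithin ℝ p (closure D) (Phi w N z)) P :=
    hc2.comp H.contDiff.continuous.continuousOn (fun z hz => ⟨z, hz, rfl⟩)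
  have hc4 : Continuous (fun z : E2 => perp2 (deriv w (z 0) + z 1 • deriv N (z 0))) := by
    have k1 := H.hw.continuous_deriv le_rfl
    have k2 := H.hN.continuous_deriv le_rfl
    have : Continuous (fun z : E2 => deriv w (z 0) + z 1 • deriv N (z 0)) := by fun_prop
    exact perpL.continuous.comp this
  exact hc3.clm_apply hc4.continuousOn

lemma Sides.flux_lim (H : Sides w N δ D U) (hD : IsOpen D) (hU : IsOpen U) (hfU : frontier U = w '' Icc 0 1)
    (hUD : closure U ∩ D = ∅) {p : E2 → ℝ} (hp : ContDiffOn ℝ 1 p (closure D)) :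
    Tendsto (fun ε => ∫ x in D, gdot p (etaF w N δ U ε) x) (𝓝[>] 0)
      (𝓝 (-∫ t in (0:ℝ)..1, fderivWithin ℝ p (closure D) (w t) (perp2 (deriv w t)))) := by
  set G : E2 → ℝ := fun z => fderivWithin ℝ p (closure D) (Phi w N z) (perp2 (deriv w (z 0) + z 1 • deriv N (z 0))) with hG
  have hGc := H.cont_G hp
  have hδ := H.hδ
  have h1 := flux_lim_aux (g := fun y => G !₂[y.1, y.2]) (δ := δ/2) (by linarith) (by
    refine ContinuousOn.comp (f := fun y : ℝ × ℝ => (!₂[y.1,y.2] : E2)) hGc ?_ ?_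
    · apply Continuous.continuousOn
      refine (PiLp.continuous_toLp 2 _).comp (continuous_pi fun i => ?_)
      fin_cases i <;> simp <;> fun_prop
    · intro y hy
      exact ⟨by simpa using hy.2.1, by simp; linarith [hy.2.2]⟩)
  have e0 : ∫ x in (0:ℝ)..1, G !₂[x, 0] = ∫ t in (0:ℝ)..1, fderivWithin ℝ p (closure D) (w t) (perp2 (deriv w t)) := by
    congr 1; ext t; simp [hG, Phi]
  simp only [e0] at h1
  refine h1.congr' ?_
  filter_upwards [Ioo_mem_nhdsGT hδ] with ε hε
  obtain ⟨hε, hεδ⟩ := hε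
  set T := {z : E2 | z 0 ∈ Ico (0:ℝ) 1 ∧ z 1 ∈ Ioo 0 ε} with hT
  have hTm : MeasurableSet T := by
    have m0 : Measurable (fun z : E2 => z 0) := (cL 0).continuous.measurable
    have m1 : Measurable (fun z : E2 => z 1) := (cL 1).continuous.measurable
    exact (m0 measurableSet_Ico).inter (m1 measurableSet_Ioo)
  have hTd : ∀ z ∈ T, |z 1| < δ := fun z hz => by rw [abs_lt]; constructor <;> linarith [hz.2.1, hz.2.2]
  have hQD : Phi w N '' T ⊆ D := by
    rintro x ⟨z, hz, rfl⟩; exact H.plus z hz.2.1 (hz.2.2.trans hεδ)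
  have hinj : InjOn (Phi w N) T := by
    intro z hz z' hz' h
    obtain ⟨⟨n, hn⟩, h1⟩ := H.inj z z' (hTd z hz) (hTd z' hz') h
    apply E2_ext _ h1
    have a1 := hz.1.1; have a2 := hz.1.2; have a3 := hz'.1.1; have a4 := hz'.1.2
    have b1 : (n:ℝ) < 1 := by linarith
    have b2 : (-1:ℝ) < n := by linarith
    have : n = 0 := by
      have b1' : n < 1 := by exact_mod_cast b1
      have b2' : -1 < n := by exact_mod_cast b2
      omega
    rw [hn, this]; simp
  symm
  have s1 : ∫ x in D, gdot p (etaF w N δ U ε) x = ∫ x in Phi w N '' T, gdot p (etaF w N δ U ε) x := by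
    apply setIntegral_eq_of_subset_of_forall_sdiff_eq_zero hD.measurableSet hQD
    intro x hx
    have : x ∉ tsupport (etaF w N δ U ε) := by
      intro h
      have hxU : x ∉ closure U := fun h => by
        have : x ∈ closure U ∩ D := ⟨h, hx.1⟩
        rw [hUD] at this; exact this
      rcases H.eta_tsupport hε h with h | h
      · exact hxU h
      · rcases H.Ceps_sub hε hεδ h with h | h
        · rw [← hfU] at h; exact hxU (frontier_subset_closure h)
        · exact hx.2 h
    simp [gdot, fderiv_of_notMem_tsupport ℝ this]
  rw [s1, integral_image_eq_integral_abs_det_fderiv_smul volume hTm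
    (fun z _ => (H.hasFDerivAt z).hasFDerivWithinAt) hinj,
    ← e2_prod (fun y => ε⁻¹ * deriv chi (y.2 / ε) * G !₂[y.1, y.2])]
  apply setIntegral_congr_fun hTm
  intro z hz
  have hzd := hTd z hz
  simp only [smul_eq_mul]
  rw [abs_of_pos (H.det_pos hzd)]
  have ez : (!₂[z 0, z 1] : E2) = z := by apply E2_ext <;> simp
  rw [ez]
  have hV : Phi w N z ∈ VC w N δ := ⟨z, hzd, rfl⟩
  have hfd : fderiv ℝ (etaF w N δ U ε) (Phi w N z) = (ε⁻¹ * deriv chi (z 1/ε)) • fderiv ℝ (sg w N δ) (Phi w N z) := by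
    rw [(eta_V_eq H.toCollar hV).fderiv_eq]
    have k1 : HasFDerivAt (fun y => sg w N δ y / ε) (ε⁻¹ • fderiv ℝ (sg w N δ) (Phi w N z)) (Phi w N z) := by
      have := ((H.sg_contDiffAt hV).differentiableAt one_ne_zero).hasFDerivAt.const_smul ε⁻¹
      refine this.congr_of_eventuallyEq (Eventually.of_forall fun y => ?_)
      simp [div_eq_inv_mul]
    have k2 := (chi_contDiff.differentiable one_ne_zero (sg w N δ (Phi w N z)/ε)).hasDerivAt.comp_hasFDerivAt (Phi w N z) k1
    have k3 := k2.fderiv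
    rw [show (fun y => chi (sg w N δ y / ε)) = chi ∘ fun y => sg w N δ y / ε from rfl, k3, H.sg_Phi hzd, smul_smul, mul_comm]
  have hgd : gdot p (etaF w N δ U ε) (Phi w N z) = (ε⁻¹ * deriv chi (z 1/ε)) * gdot p (sg w N δ) (Phi w N z) := by
    unfold gdot; rw [hfd]; simp; ring
  rw [hgd, mul_left_comm, H.gdot_sg hzd]
  have hfe : fderivWithin ℝ p (closure D) (Phi w N z) = fderiv ℝ p (Phi w N z) :=
    fderivWithin_of_mem_nhds (mem_of_superset (hD.mem_nhds (H.plus z hz.2.1 (hz.2.2.trans hεδ))) subset_closure)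
  simp only [hG, hfe]

end

section
lemma gdot_contOn {D : Set E2} {p η : E2 → ℝ} (hD : IsOpen D) (hp : ContDiffOn ℝ 1 p D) (hη : ContDiff ℝ 1 η) :
    ContinuousOn (gdot p η) D := by
  have h1 : ContinuousOn (fderiv ℝ p) D := hp.continuousOn_fderiv_of_isOpen hD le_rfl
  have h2 : Continuous (fderiv ℝ η) := hη.continuous_fderiv one_ne_zero
  have a := fun e : E2 => h1.clm_apply (continuousOn_const (c := e))
  have b := fun e : E2 => (h2.clm_apply (continuous_const (y := e))).continuousOn (s := D)
  exact ((a _).mul (b _)).add ((a _).mul (b _))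

lemma gdot_int {D C : Set E2} {p η : E2 → ℝ} {κ : ℝ} (hD : IsOpen D) (hp : ContDiffOn ℝ 1 p D) (hη : ContDiff ℝ 1 η)
    (hc : HasCompactSupport η) (hs : tsupport η ⊆ D ∪ C) (hκ : ∀ x ∈ C, ∀ᶠ y in 𝓝 x, η y = κ) :
    IntegrableOn (gdot p η) D := by
  have hK : IsCompact (tsupport (fderiv ℝ η)) := hc.fderiv ℝ
  have hKD : tsupport (fderiv ℝ η) ⊆ D := by
    intro x hx
    rcases hs (tsupport_fderiv_subset ℝ hx) with h | h
    · exact h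
    · exfalso
      have h1 : η =ᶠ[𝓝 x] fun _ => κ := hκ x h
      have h2 := h1.fderiv (𝕜 := ℝ)
      refine notMem_tsupport_iff_eventuallyEq.2 ?_ hx
      filter_upwards [h2] with y hy
      rw [hy]; simp
  refine (((gdot_contOn hD hp hη).mono hKD).integrableOn_compact hK).of_forall_sdiff_eq_zero hD.measurableSet ?_
  intro x hx
  have : fderiv ℝ η x = 0 := image_eq_zero_of_notMem_tsupport hx.2
  simp [gdot, this]

variable {w N : ℝ → E2} {δ : ℝ} {D U : Set E2}

lemma Sides.flux_weak (H : Sides w N δ D U) (hD : IsOpen D) (hDb : Bornology.IsBounded D)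
    (hU : IsOpen U) (hUb : Bornology.IsBounded U) (hfU : frontier U = w '' Icc 0 1)
    (hUD : closure U ∩ D = ∅) {p : E2 → ℝ} (hp2 : ContDiffOn ℝ 2 p D) (hp : ContDiffOn ℝ 1 p (closure D))
    (hl : ∀ x ∈ D, lap p x = -2)
    (hfl : ∫ t in (0:ℝ)..1, fderivWithin ℝ p (closure D) (w t) (perp2 (deriv w t)) = -2 * (volume U).toReal)
    {η : E2 → ℝ} {κ : ℝ} (hη : ContDiff ℝ 1 η) (hc : HasCompactSupport η)
    (hs : tsupport η ⊆ D ∪ closure U) (hκ : ∀ x ∈ closure U, ∀ᶠ y in 𝓝 x, η y = κ) :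
    ∫ x in D, gdot p η x = 2 * ∫ x, η x := by
  have hpD : ContDiffOn ℝ 1 p D := hp.mono subset_closure
  have l1 := H.flux_lim hD hU hfU hUD hp
  have l2 := H.eta_int_lim hU hUb hDb hfU hUD
  rw [hfl] at l1
  have l3 := (l1.const_mul κ).sub ((l2.const_mul (2*κ)))
  have hev : ∀ᶠ ε in 𝓝[>] (0:ℝ), κ * (∫ x in D, gdot p (etaF w N δ U ε) x) - 2*κ * (∫ x, etaF w N δ U ε x) =
      (∫ x in D, gdot p η x) - 2 * ∫ x, η x := by
    filter_upwards [Ioo_mem_nhdsGT H.hδ] with ε hε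
    set f := etaF w N δ U ε with hf
    have hfC : ContDiff ℝ 1 f := H.eta_contDiff hU hfU hUD hε.1 hε.2
    have hfc : HasCompactSupport f := H.eta_hcs hUb hε.1
    have hfs : tsupport f ⊆ D ∪ closure U := H.eta_tsupport' hfU hε.1 hε.2
    have hf1 : ∀ x ∈ closure U, ∀ᶠ y in 𝓝 x, f y = 1 := fun x hx => H.eta_near hU hfU hUD hε.1 hx
    have hgC : ContDiff ℝ 1 (fun x => η x - κ * f x) := hη.sub (contDiff_const.mul hfC)
    have hgc : HasCompactSupport (fun x => η x - κ * f x) := by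
      refine (hc.isCompact.union hfc.isCompact).of_isClosed_subset (isClosed_tsupport _) ?_
      refine closure_minimal ?_ ((isClosed_tsupport _).union (isClosed_tsupport _))
      intro x hx
      by_contra h
      rw [mem_union, not_or] at h
      apply hx
      simp [image_eq_zero_of_notMem_tsupport h.1, image_eq_zero_of_notMem_tsupport h.2]
    have hgs : tsupport (fun x => η x - κ * f x) ⊆ D := by
      have h0 : tsupport (fun x => η x - κ * f x) ⊆ tsupport η ∪ tsupport f := by
        refine closure_minimal ?_ ((isClosed_tsupport _).union (isClosed_tsupport _))
        intro x hx
        by_contra h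
        rw [mem_union, not_or] at h
        apply hx
        simp [image_eq_zero_of_notMem_tsupport h.1, image_eq_zero_of_notMem_tsupport h.2]
      intro x hx
      have h1 : x ∈ D ∪ closure U := by
        rcases h0 hx with h | h
        · exact hs h
        · exact hfs h
      rcases h1 with h | h
      · exact h
      · exfalso
        refine notMem_tsupport_iff_eventuallyEq.2 ?_ hx
        filter_upwards [hκ x h, hf1 x h] with y h1 h2
        simp [h1, h2]
    have hw := weak_loc hD hp2 hl hgC hgc hgs
    have i1 := gdot_int hD hpD hη hc hs hκ
    have i2 := gdot_int hD hpD hfC hfc hfs hf1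
    have e1 : ∀ x, gdot p (fun x => η x - κ * f x) x = gdot p η x - κ * gdot p f x := by
      intro x
      have : fderiv ℝ (fun x => η x - κ * f x) x = fderiv ℝ η x - κ • fderiv ℝ f x := by
        have a1 := (hη.differentiable one_ne_zero x).hasFDerivAt
        have a2 := ((hfC.differentiable one_ne_zero x).hasFDerivAt).const_mul κ
        exact (a1.sub a2).fderiv
      unfold gdot; rw [this]; simp; ring
    simp_rw [e1] at hw
    rw [integral_sub i1 (i2.const_mul κ), integral_const_mul,
      integral_sub (hη.continuous.integrable_of_hasCompactSupport hc)
        ((hfC.continuous.integrable_of_hasCompactSupport hfc).const_mul κ), integral_const_mul] at hw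
    linarith
  have l4 := l3.congr' hev
  have := tendsto_nhds_unique l4 tendsto_const_nhds
  rw [measureReal_def] at this
  linarith

open Classical in
def qB (D U : Set E2) (p : E2 → ℝ) (c : ℝ) (x : E2) : ℝ := if x ∈ D then p x else if x ∈ closure U then c else 0

lemma Sides.coreB (H : Sides w N δ D U) {G : Set E2} {c : ℝ} (hD : IsOpen D) (hDb : Bornology.IsBounded D)
    (hU : IsOpen U) (hUb : Bornology.IsBounded U) (hfU : frontier U = w '' Icc 0 1)
    (hfD : frontier D = G ∪ w '' Icc 0 1)
    (hUD : closure U ∩ D = ∅) {p : E2 → ℝ} (hp2 : ContDiffOn ℝ 2 p D) (hp : ContDiffOn ℝ 1 p (closure D))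
    (hl : ∀ x ∈ D, lap p x = -2) (hpG : ∀ x ∈ G, p x = 0) (hpc : ∀ x ∈ w '' Icc 0 1, p x = c) (hc0 : 0 < c)
    (hfl : ∫ t in (0:ℝ)..1, fderivWithin ℝ p (closure D) (w t) (perp2 (deriv w t)) = -2 * (volume U).toReal) :
    Core (qB D U p c) (Ioo 0 c) := by
  have hpcont : ContinuousOn p (closure D) := hp.continuousOn
  have hUD' : ∀ x ∈ closure U, x ∉ D := fun x hx h => by
    have : x ∈ closure U ∩ D := ⟨hx, h⟩
    rw [hUD] at this; exact this
  have qD : ∀ x ∈ D, qB D U p c x = p x := fun x hx => by simp [qB, hx]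
  have qU : ∀ x ∈ closure U, qB D U p c x = c := fun x hx => by simp [qB, hx, hUD' x hx]
  have qO : ∀ x, x ∉ D → x ∉ closure U → qB D U p c x = 0 := fun x hx hx' => by simp [qB, hx, hx']
  have hmeas : Measurable (qB D U p c) := by
    classical
    have : qB D U p c = D.piecewise p ((closure U).piecewise (fun _ => c) (fun _ => 0)) := by
      ext x; simp only [qB, Set.piecewise]
    rw [this]
    have h2 : Measurable ((closure U).piecewise (fun _ => c) (fun _ => (0:ℝ))) :=
      Measurable.piecewise isClosed_closure.measurableSet measurable_const measurable_const
    have h3 : Measurable (D.piecewise p (fun _ => (0:ℝ))) :=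
      ContinuousOn.measurable_piecewise (hpcont.mono subset_closure) continuousOn_const hD.measurableSet
    have : D.piecewise p ((closure U).piecewise (fun _ => c) (fun _ => 0)) =
      D.piecewise (D.piecewise p (fun _ => (0:ℝ))) ((closure U).piecewise (fun _ => c) (fun _ => 0)) := by
      ext x; by_cases hx : x ∈ D <;> simp [hx]
    rw [this]
    exact Measurable.piecewise hD.measurableSet h3 h2
  have hKcomp : ∀ t ∈ Ioo 0 c, IsCompact ((closure D ∩ p ⁻¹' Ici t) ∪ closure U) := by
    intro t _
    have hcomp : IsCompact (closure D) := hDb.isCompact_closure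
    exact (hcomp.of_isClosed_subset (hpcont.preimage_isClosed_of_isClosed isClosed_closure isClosed_Ici) inter_subset_left).union hUb.isCompact_closure
  have hK : ∀ t ∈ Ioo 0 c, ∀ x, t < qB D U p c x → x ∈ (closure D ∩ p ⁻¹' Ici t) ∪ closure U := by
    intro t ht x hx
    by_cases hxD : x ∈ D
    · rw [qD x hxD] at hx; left; exact ⟨subset_closure hxD, hx.le⟩
    · by_cases hxU : x ∈ closure U
      · right; exact hxU
      · rw [qO x hxD hxU] at hx; exact absurd hx (not_lt.2 ht.1.le)
  have hKU : ∀ t ∈ Ioo 0 c, ∀ x ∈ (closure D ∩ p ⁻¹' Ici t) ∪ closure U, x ∉ D → x ∈ closure U := by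
    intro t ht x hx hxD
    rcases hx with hx | hx
    · have hxf : x ∈ frontier D := by rw [hD.frontier_eq]; exact ⟨hx.1, hxD⟩
      rw [hfD] at hxf
      rcases hxf with h | h
      · have h1 := hpG x h
        have h2 : t ≤ p x := hx.2
        linarith [ht.1]
      · rw [← hfU] at h; exact frontier_subset_closure h
    · exact hx
  have hnear : ∀ x ∈ closure U, ∀ s ∈ Ioo 0 c, ∀ᶠ y in 𝓝 x, s < qB D U p c y := by
    intro x hx s hs
    rcases clos_eq hU hfU hx with h | h
    · filter_upwards [hU.mem_nhds h] with y hy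
      rw [qU y (subset_closure hy)]; exact hs.2
    · have hxD : x ∈ closure D := by
        apply frontier_subset_closure; rw [hfD]; right; exact h
      have h1 : ∀ᶠ y in 𝓝[closure D] x, s < p y := by
        apply (hpcont x hxD).eventually_const_lt
        rw [hpc x h]; exact hs.2
      rw [eventually_nhdsWithin_iff] at h1
      filter_upwards [h1, H.isOpen_V.mem_nhds (H.curve_V h)] with y hy hyV
      obtain ⟨z, hz, rfl⟩ := hyV
      have hz : |z 1| < δ := hz
      rw [abs_lt] at hz
      rcases lt_trichotomy (z 1) 0 with h0 | h0 | h0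
      · rw [qU _ (subset_closure (H.minus z hz.1 h0))]; exact hs.2
      · have : Phi w N z ∈ closure U := by
          apply frontier_subset_closure; rw [hfU]
          exact (H.off_curve (abs_lt.2 hz)).2 h0
        rw [qU _ this]; exact hs.2
      · have := H.plus z h0 hz.2
        rw [qD _ this]; exact hy (subset_closure this)
  refine core_mk hD (hp2.of_le (by norm_num)) isOpen_Ioo qD ?_ hmeas ?_
    (fun t => (closure D ∩ p ⁻¹' Ici t) ∪ closure U) hKcomp hK ?_ ?_
  · intro x hx
    by_contra h
    by_cases hxU : x ∈ closure U
    · rw [qU x hxU] at hx; exact lt_irrefl _ hx.2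
    · rw [qO x h hxU] at hx; exact lt_irrefl _ hx.1
  · intro x hx t ht s hs
    by_cases hxU : x ∈ closure U
    · right; rw [qU x hxU]; exact hs.2.le
    · left; rw [qO x hx hxU]; exact ht.1.le
  · intro t ht x hx hxD s hs
    exact hnear x (hKU t ht x hx hxD) s hs
  · intro t ht s hs hts η hη hηc h0 κ hκ
    refine H.flux_weak hD hDb hU hUb hfU hUD hp2 hp hl hfl hη hηc ?_ (κ := κ) ?_
    · have : tsupport η ⊆ (closure D ∩ p ⁻¹' Ici t) ∪ closure U := by
        refine closure_minimal ?_ (hKcomp t ht).isClosed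
        intro x hx
        apply hK t ht
        by_contra h
        exact hx (h0 x (not_lt.1 h))
      intro x hx
      by_cases hxD : x ∈ D
      · left; exact hxD
      · right; exact hKU t ht x (this hx) hxD
    · intro x hx
      filter_upwards [hnear x hx s hs] with y hy using hκ y hy.le
end

section
def mu (D : Set E2) (p : E2 → ℝ) (t : ℝ) : ℝ := volume.real (D ∩ {x | t < p x})

def DropH (D : Set E2) (p : E2 → ℝ) : Prop :=
  ∀ t s, 0 < t → t < s → 0 < mu D p s → 2*π*(s-t) ≤ mu D p t - mu D p s

section
variable {D : Set E2} {p : E2 → ℝ}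

lemma mu_anti (hDb : Bornology.IsBounded D) {t s : ℝ} (h : t ≤ s) : mu D p s ≤ mu D p t := by
  apply measureReal_mono
  · intro x hx; exact ⟨hx.1, lt_of_le_of_lt h hx.2⟩
  · exact (hDb.subset inter_subset_left).measure_lt_top.ne

lemma mu_le (hDb : Bornology.IsBounded D) (t : ℝ) : mu D p t ≤ volume.real D :=
  measureReal_mono inter_subset_left hDb.measure_lt_top.ne

lemma mu_nonneg (t : ℝ) : 0 ≤ mu D p t := measureReal_nonneg

lemma mu_pos (hD : IsOpen D) (hDb : Bornology.IsBounded D) (hp : ContinuousOn p D) {t : ℝ} {x : E2} (hx : x ∈ D) (h : t < p x) :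
    0 < mu D p t := by
  have ho : IsOpen (D ∩ p ⁻¹' (Ioi t)) := hp.isOpen_inter_preimage hD isOpen_Ioi
  have := ho.measure_pos volume ⟨x, hx, h⟩
  exact ENNReal.toReal_pos this.ne' (hDb.subset inter_subset_left).measure_lt_top.ne

lemma DropH.sup_le (H : DropH D p) (hD : IsOpen D) (hDb : Bornology.IsBounded D) (hp : ContinuousOn p D) {x : E2} (hx : x ∈ D) :
    p x ≤ volume.real D / (2*π) := by
  rw [le_div_iff₀ (by positivity)]
  by_contra! hcon
  have hA : 0 ≤ volume.real D := measureReal_nonneg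
  have hpi := pi_pos
  have hpx : 0 < p x := by
    by_contra! h
    nlinarith
  set e := (p x * (2*π) - volume.real D) / (8 * π) with he
  have he0 : 0 < e := by rw [he]; apply div_pos <;> linarith
  have hee : e * (8*π) = p x * (2*π) - volume.real D := by rw [he]; field_simp
  have h4 : e < p x / 2 := by nlinarith
  have := H e (p x - e) he0 (by linarith) (mu_pos hD hDb hp hx (by linarith))
  have h2 := mu_le (p := p) hDb e
  have h3 := mu_nonneg (D := D) (p := p) (p x - e)
  nlinarith

lemma DropH.mu_up (H : DropH D p) (hDb : Bornology.IsBounded D) {t : ℝ} (ht : 0 < t) (h : 0 < mu D p t) :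
    mu D p t ≤ volume.real D - 2*π*t := by
  apply le_of_forall_pos_le_add
  intro e he
  have hpi := pi_pos
  set s := min (t/2) (e / (2*π)) with hs
  have hs0 : 0 < s := lt_min (by linarith) (by positivity)
  have hst : s < t := (min_le_left _ _).trans_lt (by linarith)
  have hse : s * (2*π) ≤ e := by
    rw [← le_div_iff₀ (by positivity)]; exact min_le_right _ _
  have := H s t hs0 hst h
  have h2 := mu_le (p := p) hDb s
  linarith

lemma DropH.mu_low (H : DropH D p) (hD : IsOpen D) (hDb : Bornology.IsBounded D) (hp : ContinuousOn p D)
    (hne : D.Nonempty) {t : ℝ} (ht : 0 < t) (htM : t < sSup (p '' D)) : 2*π*(sSup (p '' D) - t) ≤ mu D p t := by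
  apply le_of_forall_pos_le_add
  intro e he
  have hpi := pi_pos
  set M := sSup (p '' D)
  have hlt : max t (M - e/(2*π)) < M := max_lt htM (by have : 0 < e/(2*π) := by positivity
                                                       linarith)
  obtain ⟨s, hs1, hs2⟩ := exists_between hlt
  obtain ⟨_, ⟨x, hx, rfl⟩, hxs⟩ := exists_lt_of_lt_csSup (hne.image p) hs2
  have h1 := H t s ht ((le_max_left _ _).trans_lt hs1) (mu_pos hD hDb hp hx hxs)
  have h2 := mu_nonneg (D := D) (p := p) s
  have h3 : M - e/(2*π) < s := (le_max_right _ _).trans_lt hs1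
  have h4 : e / (2*π) * (2*π) = e := by field_simp
  nlinarith

lemma DropH.bdd (H : DropH D p) (hD : IsOpen D) (hDb : Bornology.IsBounded D) (hp : ContinuousOn p D) : BddAbove (p '' D) := by
  refine ⟨volume.real D / (2*π), ?_⟩
  rintro _ ⟨x, hx, rfl⟩; exact H.sup_le hD hDb hp hx

lemma DropH.eq_mu (H : DropH D p) (hD : IsOpen D) (hDb : Bornology.IsBounded D) (hp : ContinuousOn p D)
    (hne : D.Nonempty) (hM : sSup (p '' D) = volume.real D / (2*π)) {t : ℝ} (ht : 0 < t) (htM : t < sSup (p '' D)) :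
    mu D p t = volume.real D - 2*π*t := by
  have h1 := H.mu_low hD hDb hp hne ht htM
  have hpi := pi_pos
  have hpos : 0 < mu D p t := lt_of_lt_of_le (by apply mul_pos <;> linarith) h1
  apply le_antisymm (H.mu_up hDb ht hpos)
  have : sSup (p '' D) * (2*π) = volume.real D := by rw [hM]; field_simp
  linarith

lemma DropH.int_le (H : DropH D p) (hD : IsOpen D) (hDb : Bornology.IsBounded D) (hp : ContinuousOn p (closure D))
    (hne : D.Nonempty) :
    (∫ x in D, p x) ≤ volume.real D ^ 2 / (4*π) ∧
      ((∫ x in D, p x) = volume.real D ^ 2 / (4*π) → sSup (p '' D) = volume.real D / (2*π)) := by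
  have hpi := pi_pos
  have hpD := hp.mono subset_closure
  have hA : 0 < volume.real D := ENNReal.toReal_pos (hD.measure_pos volume hne).ne' hDb.measure_lt_top.ne
  have hbd := H.bdd hD hDb hpD
  set M := sSup (p '' D) with hM
  set A := volume.real D with hAd
  have hle : ∀ x ∈ D, p x ≤ M := fun x hx => le_csSup hbd ⟨x, hx, rfl⟩
  have hInt : IntegrableOn p D := (hp.integrableOn_compact hDb.isCompact_closure).mono_set subset_closure
  by_cases hM0 : M ≤ 0
  · have h1 : ∫ x in D, p x ≤ 0 := setIntegral_nonpos hD.measurableSet (fun x hx => (hle x hx).trans hM0)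
    have h2 : 0 < A^2 / (4*π) := by positivity
    exact ⟨by linarith, fun h => by linarith⟩
  push Not at hM0
  have hpos_int : IntegrableOn (fun x => max (p x) 0) D := hInt.pos_part
  have h1 : ∫ x in D, p x ≤ ∫ x in D, max (p x) 0 := setIntegral_mono hInt hpos_int (fun x => le_max_left _ _)
  have h2 := Integrable.integral_eq_integral_meas_lt (μ := volume.restrict D) (f := fun x => max (p x) 0) hpos_int
    (Eventually.of_forall fun x => le_max_right _ _)
  have h3 : ∀ t ∈ Ioi (0:ℝ), (volume.restrict D).real {a | t < max (p a) 0} = mu D p t := by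
    intro t ht
    have ht : 0 < t := ht
    rw [measureReal_def, Measure.restrict_apply' hD.measurableSet, mu, measureReal_def]
    congr 2
    ext x; simp only [mem_inter_iff, mem_ofPred_eq, lt_max_iff]
    constructor
    · rintro ⟨h | h, hx⟩
      · exact ⟨hx, h⟩
      · linarith
    · rintro ⟨hx, h⟩; exact ⟨Or.inl h, hx⟩
  rw [setIntegral_congr_fun measurableSet_Ioi h3] at h2
  have hzero : ∀ t, M ≤ t → mu D p t = 0 := by
    intro t ht
    have : D ∩ {x | t < p x} = ∅ := by
      ext x; simp only [mem_inter_iff, mem_ofPred_eq, mem_empty_iff_false, iff_false, not_and, not_lt]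
      intro hx; exact (hle x hx).trans ht
    rw [mu, this]; simp
  have h4 : ∫ t in Ioi (0:ℝ), mu D p t = ∫ t in Ioc (0:ℝ) M, mu D p t := by
    apply setIntegral_eq_of_subset_of_forall_sdiff_eq_zero measurableSet_Ioi Ioc_subset_Ioi_self
    intro t ht
    apply hzero
    by_contra h
    exact ht.2 ⟨ht.1, by linarith⟩
  have hanti : Antitone (mu D p) := fun t s h => mu_anti hDb h
  have h5 : ∫ t in Ioc (0:ℝ) M, mu D p t ≤ ∫ t in Ioc (0:ℝ) M, (A - 2*π*t) := by
    have i1 : IntegrableOn (mu D p) (Ioc 0 M) := (hanti.antitoneOn _).integrableOn_isCompact isCompact_Icc |>.mono_set Ioc_subset_Icc_self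
    have i2 : IntegrableOn (fun t => A - 2*π*t) (Ioc 0 M) :=
      (Continuous.integrableOn_Icc (by fun_prop)).mono_set Ioc_subset_Icc_self
    apply setIntegral_mono_on i1 i2 measurableSet_Ioc
    intro t ht
    rcases (mu_nonneg (D := D) (p := p) t).eq_or_lt with h | h
    · rw [← h]
      have hMA : M ≤ A / (2*π) := csSup_le (hne.image p) (by rintro _ ⟨x, hx, rfl⟩; exact H.sup_le hD hDb hpD hx)
      rw [le_div_iff₀ (by positivity)] at hMA
      nlinarith [ht.2]
    · exact H.mu_up hDb ht.1 h
  have h6 : ∫ t in Ioc (0:ℝ) M, (A - 2*π*t) = A*M - π*M^2 := by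
    rw [← intervalIntegral.integral_of_le hM0.le]
    rw [intervalIntegral.integral_sub (by simp) ((by fun_prop : Continuous fun t : ℝ => 2*π*t).intervalIntegrable _ _),
      intervalIntegral.integral_const_mul, integral_id]
    simp; ring
  have h7 : ∫ x in D, p x ≤ A*M - π*M^2 := by linarith
  have h8 : A^2/(4*π) - (A*M - π*M^2) = π * (M - A/(2*π))^2 := by field_simp; ring
  have h9 : 0 ≤ π * (M - A/(2*π))^2 := by positivity
  refine ⟨by linarith, fun h => ?_⟩
  have h10 : π * (M - A/(2*π))^2 = 0 := le_antisymm (by linarith) h9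
  have h11 : (M - A/(2*π))^2 = 0 := by
    rcases mul_eq_zero.1 h10 with h | h
    · exact absurd h hpi.ne'
    · exact h
  have := pow_eq_zero_iff (two_ne_zero) |>.1 h11
  linarith

lemma lev_ind {t : ℝ} (ht : 0 ≤ t) : lev (D.indicator p) t = mu D p t := by
  unfold lev mu
  congr 1
  ext x; simp only [mem_inter_iff, mem_ofPred_eq]
  by_cases hx : x ∈ D
  · simp [hx]
  · simp [hx, ht]

lemma lev_qB {U : Set E2} {c : ℝ} (hD : IsOpen D) (hDb : Bornology.IsBounded D) (hp : ContinuousOn p D) (hU : Bornology.IsBounded U)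
    (hUo : IsOpen U) (hUD : closure U ∩ D = ∅) (hn : volume (frontier U) = 0)
    {t : ℝ} (ht : t ∈ Ioo 0 c) : lev (qB D U p c) t = mu D p t + volume.real U := by
  have hset : {x | t < qB D U p c x} = (D ∩ {x | t < p x}) ∪ closure U := by
    ext x; simp only [mem_union, mem_inter_iff, mem_ofPred_eq]
    unfold qB
    split_ifs with h1 h2
    · have : x ∉ closure U := fun h => by
        have : x ∈ closure U ∩ D := ⟨h, h1⟩
        rw [hUD] at this; exact this
      tauto
    · have := ht.2; tauto
    · have := ht.1; simp [h1, h2, ht.1.le]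
  have hcl : volume.real (closure U) = volume.real U := by
    rw [closure_eq_self_union_frontier, measureReal_def, measureReal_def, measure_congr (union_ae_eq_left_of_ae_eq_empty (ae_eq_empty.2 hn))]
  unfold lev mu
  rw [hset, measureReal_union _ isClosed_closure.measurableSet
    (hDb.subset inter_subset_left).measure_lt_top.ne hU.closure.measure_lt_top.ne, hcl]
  · rw [Set.disjoint_left]
    intro x hx hx2
    have : x ∈ closure U ∩ D := ⟨hx2, hx.1⟩
    rw [hUD] at this; exact this

lemma dropA (hD : IsOpen D) (hDb : Bornology.IsBounded D)
    (hp : ContDiffOn ℝ 2 p D) (hpc : ContinuousOn p (closure D))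
    (hl : ∀ x ∈ D, lap p x = -2) (hf : ∀ x ∈ frontier D, p x ≤ 0) : DropH D p := by
  have H := coreA hD hDb hp hpc hl le_rfl hf
  intro t s ht hts hpos
  rw [← lev_ind (ht.trans hts).le] at hpos
  have := H.drop ordConnected_Ioi (show t ∈ Ioi (0:ℝ) from ht) (show s ∈ Ioi (0:ℝ) from ht.trans hts) hts hpos
  rwa [lev_ind ht.le, lev_ind (ht.trans hts).le] at this

lemma dropB (hD : IsOpen D) (hDb : Bornology.IsBounded D)
    (hp : ContDiffOn ℝ 2 p D) (hpc : ContinuousOn p (closure D))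
    (hl : ∀ x ∈ D, lap p x = -2) {U : Set E2} {c : ℝ} (hc : 0 < c) (hf : ∀ x ∈ frontier D, p x ≤ c)
    (hU : Bornology.IsBounded U)
    (hUo : IsOpen U) (hUD : closure U ∩ D = ∅) (hn : volume (frontier U) = 0) (hUne : U.Nonempty)
    (H : Core (qB D U p c) (Ioo 0 c)) : DropH D p := by
  have hpD := hpc.mono subset_closure
  have H2 := coreA hD hDb hp hpc hl hc.le hf
  have hUpos : 0 < volume.real U := ENNReal.toReal_pos (hUo.measure_pos volume hUne).ne' hU.measure_lt_top.ne
  have d1 : ∀ t s, 0 < t → t < s → s < c → 2*π*(s-t) ≤ mu D p t - mu D p s := by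
    intro t s ht hts hs
    have e1 := lev_qB hD hDb hpD hU hUo hUD hn (c := c) (t := t) ⟨ht, hts.trans hs⟩
    have e2 := lev_qB hD hDb hpD hU hUo hUD hn (c := c) (t := s) ⟨ht.trans hts, hs⟩
    have := H.drop ordConnected_Ioo ⟨ht, hts.trans hs⟩ ⟨ht.trans hts, hs⟩ hts (by
      rw [e2]; have := mu_nonneg (D := D) (p := p) s; linarith)
    linarith
  have d2 : ∀ t s, c < t → t < s → 0 < mu D p s → 2*π*(s-t) ≤ mu D p t - mu D p s := by
    intro t s ht hts hpos
    rw [← lev_ind (hc.trans (ht.trans hts)).le] at hpos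
    have := H2.drop ordConnected_Ioi (show t ∈ Ioi c from ht) (show s ∈ Ioi c from ht.trans hts) hts hpos
    rwa [lev_ind (hc.trans ht).le, lev_ind (hc.trans (ht.trans hts)).le] at this
  intro t s ht hts hpos
  have hpi := pi_pos
  apply le_of_forall_pos_le_add
  intro e he
  have hsm : ∀ l u : ℝ, l < u → ∃ r, l < r ∧ r < u ∧ 2*π*(u - r) ≤ e/2 := by
    intro l u hlu
    have : 0 < e/(4*π) := by positivity
    obtain ⟨r, h1, h2⟩ := exists_between (max_lt hlu (show u - e/(4*π) < u by linarith))
    refine ⟨r, (le_max_left _ _).trans_lt h1, h2, ?_⟩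
    have h3 := (le_max_right _ _).trans_lt h1
    have h4 : e/(4*π)*(2*π) = e/2 := by field_simp; ring
    nlinarith
  have hsm2 : ∀ l u : ℝ, l < u → ∃ r, l < r ∧ r < u ∧ 2*π*(r - l) ≤ e/2 := by
    intro l u hlu
    obtain ⟨r, h1, h2, h3⟩ := hsm l u hlu
    exact ⟨l + u - r, by linarith, by linarith, by linarith⟩
  rcases le_or_gt s c with hsc | hsc
  · obtain ⟨r, h1, h2, h3⟩ := hsm t s hts
    have := d1 t r ht h1 (h2.trans_le hsc)
    have h4 := mu_anti (p := p) hDb h2.le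
    linarith
  rcases le_or_gt c t with htc | htc
  · obtain ⟨r, h1, h2, h3⟩ := hsm2 t s hts
    have := d2 r s (htc.trans_lt h1) h2 hpos
    have h4 := mu_anti (p := p) hDb h1.le
    linarith
  · obtain ⟨r, h1, h2, h3⟩ := hsm t c htc
    obtain ⟨r', h1', h2', h3'⟩ := hsm2 c s hsc
    have a1 := d1 t r ht h1 h2
    have a2 := d2 r' s h1' h2' hpos
    have h4 := mu_anti (p := p) hDb (h2.trans h1').le
    linarith
end
end

section
lemma Core.mono {q : E2 → ℝ} {I J : Set ℝ} (H : Core q I) (hJ : IsOpen J) (hs : J ⊆ I) : Core q J := by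
  refine ⟨?_, H.diff.mono (fun x hx => hs hx), H.meas, fun t ht => H.fin t (hs ht), fun t ht s hs' => H.weak t (hs ht) s (hs hs')⟩
  have : {x | q x ∈ J} = {x | q x ∈ I} ∩ q ⁻¹' J := by
    ext x; exact ⟨fun h => ⟨hs h, h⟩, fun h => h.2⟩
  rw [this]
  exact H.diff.continuousOn.isOpen_inter_preimage H.opn hJ

lemma hess_rig {W : Set E2} {p : E2 → ℝ} {m : ℝ} (hW : IsOpen W) (hp : ContDiffOn ℝ 2 p W)
    (hl : ∀ x ∈ W, lap p x = -2) (hg : ∀ x ∈ W, ‖fderiv ℝ p x‖^2 = 2*(m - p x)) (i : Fin 2) {x : E2} (hx : x ∈ W) :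
    fderiv ℝ (fun y => fderiv ℝ p y (e2 i)) x = - cL i := by
  have hd1 : ∀ y ∈ W, DifferentiableAt ℝ p y := fun y hy => (hp.differentiableOn two_ne_zero y hy).differentiableAt (hW.mem_nhds hy)
  have hcd : ∀ i, ContDiffOn ℝ 1 (fun y => fderiv ℝ p y (e2 i)) W := fun i => contDiffOn_pd hW hp (e2 i)
  have hd2 : ∀ i, ∀ y ∈ W, DifferentiableAt ℝ (fun y => fderiv ℝ p y (e2 i)) y := fun i y hy =>
    ((hcd i).differentiableOn one_ne_zero y hy).differentiableAt (hW.mem_nhds hy)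
  set h : Fin 2 → Fin 2 → E2 → ℝ := fun i j y => fderiv ℝ (fun y => fderiv ℝ p y (e2 i)) y (e2 j) with hh
  have hcont : ∀ i j, ContinuousOn (h i j) W := by
    intro i j
    exact ((hcd i).continuousOn_fderiv_of_isOpen hW le_rfl).clm_apply continuousOn_const
  have hsymm : ∀ y ∈ W, h 0 1 y = h 1 0 y := by
    intro y hy
    have hca : ContDiffAt ℝ 2 p y := hp.contDiffAt (hW.mem_nhds hy)
    have hs := hca.isSymmSndFDerivAt (by simp)
    have hdf : DifferentiableAt ℝ (fderiv ℝ p) y :=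
      (hca.fderiv_right (m := 1) (by norm_num)).differentiableAt one_ne_zero
    have e : ∀ i j, h i j y = fderiv ℝ (fderiv ℝ p) y (e2 j) (e2 i) := by
      intro i j
      simp only [hh]
      rw [fderiv_clm_apply hdf (differentiableAt_const _)]
      simp
    rw [e, e]; exact hs _ _
  have htr : ∀ y ∈ W, h 0 0 y + h 1 1 y = -2 := fun y hy => hl y hy
  have heq : ∀ j, ∀ y ∈ W, fderiv ℝ p y (e2 0) * h 0 j y + fderiv ℝ p y (e2 1) * h 1 j y = - fderiv ℝ p y (e2 j) := by
    intro j y hy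
    have e1 : (fun y => fderiv ℝ p y (e2 0)^2 + fderiv ℝ p y (e2 1)^2) =ᶠ[𝓝 y] fun y => 2*(m - p y) := by
      filter_upwards [hW.mem_nhds hy] with z hz
      rw [← clm_norm_sq, hg z hz]
    have a0 := (hd2 0 y hy).hasFDerivAt.pow 2
    have a1 := (hd2 1 y hy).hasFDerivAt.pow 2
    have a2 := ((hd1 y hy).hasFDerivAt.const_sub m).const_mul 2
    have := (a0.add a1).unique (a2.congr_of_eventuallyEq e1)
    have := congrArg (fun L => L (e2 j)) this
    simp at this
    simp only [hh]
    linarith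
  have key : ∀ y ∈ W, (h 0 0 y + 1 = 0 ∧ h 0 1 y = 0) := by
    intro y hy
    by_contra hcon
    have hne : (h 0 0 y + 1)^2 + (h 0 1 y)^2 ≠ 0 := by
      intro h0
      apply hcon
      constructor <;> nlinarith [sq_nonneg (h 0 0 y + 1), sq_nonneg (h 0 1 y)]
    have hc : ContinuousAt (fun y => (h 0 0 y + 1)^2 + (h 0 1 y)^2) y :=
      ((((hcont 0 0).add continuousOn_const).pow 2).add ((hcont 0 1).pow 2)).continuousAt (hW.mem_nhds hy)
    have hz : ∀ᶠ z in 𝓝 y, fderiv ℝ p z (e2 0) = 0 ∧ fderiv ℝ p z (e2 1) = 0 := by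
      filter_upwards [hc.eventually_ne hne, hW.mem_nhds hy] with z hz hzW
      have q0 := heq 0 z hzW
      have q1 := heq 1 z hzW
      rw [hsymm z hzW] at hz q1
      have tr := htr z hzW
      have r0 : (h 0 0 z + 1) * fderiv ℝ p z (e2 0) + h 1 0 z * fderiv ℝ p z (e2 1) = 0 := by linarith
      have r1 : h 1 0 z * fderiv ℝ p z (e2 0) - (h 0 0 z + 1) * fderiv ℝ p z (e2 1) = 0 := by
        have : h 1 1 z = -2 - h 0 0 z := by linarith
        rw [this] at q1; linarith
      constructor
      · apply (mul_eq_zero.1 (show ((h 0 0 z + 1)^2 + (h 1 0 z)^2) * fderiv ℝ p z (e2 0) = 0 by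
          linear_combination (h 0 0 z + 1) * r0 + h 1 0 z * r1)).resolve_left hz
      · apply (mul_eq_zero.1 (show ((h 0 0 z + 1)^2 + (h 1 0 z)^2) * fderiv ℝ p z (e2 1) = 0 by
          linear_combination h 1 0 z * r0 - (h 0 0 z + 1) * r1)).resolve_left hz
    have z0 : (fun z => fderiv ℝ p z (e2 0)) =ᶠ[𝓝 y] fun _ => 0 := hz.mono fun z h => h.1
    have z1 : (fun z => fderiv ℝ p z (e2 1)) =ᶠ[𝓝 y] fun _ => 0 := hz.mono fun z h => h.2
    have := htr y hy
    simp only [hh] at this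
    rw [z0.fderiv_eq, z1.fderiv_eq] at this
    norm_num at this
  obtain ⟨k0, k1⟩ := key x hx
  have k2 := hsymm x hx
  have k3 := htr x hx
  ext v
  rw [clm_E2]
  have c0 : (fderiv ℝ (fun y => fderiv ℝ p y (e2 i)) x) (e2 0) = h i 0 x := rfl
  have c1 : (fderiv ℝ (fun y => fderiv ℝ p y (e2 i)) x) (e2 1) = h i 1 x := rfl
  rw [c0, c1]
  have : i = 0 ∨ i = 1 := by fin_cases i <;> simp
  rcases this with rfl | rfl
  · rw [k1, show h 0 0 x = -1 by linarith]; simp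
  · rw [← k2, k1, show h 1 1 x = -1 by linarith]; simp

lemma dist_sq_E2 (x y : E2) : dist x y ^ 2 = (x 0 - y 0)^2 + (x 1 - y 1)^2 := by
  rw [dist_eq_norm, norm_sq_E2]; simp

/-- on connected sets, `p` is a radial paraboloid -/
lemma rigV {V : Set E2} {p : E2 → ℝ} {m : ℝ} (hV : IsOpen V) (hVc : IsPreconnected V) (hp : ContDiffOn ℝ 2 p V)
    (hl : ∀ x ∈ V, lap p x = -2) (hg : ∀ x ∈ V, ‖fderiv ℝ p x‖^2 = 2*(m - p x)) :
    ∃ x0 : E2, ∀ x ∈ V, p x = m - dist x x0 ^ 2 / 2 := by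
  have key : ∀ i : Fin 2, ∃ a : ℝ, ∀ x ∈ V, fderiv ℝ p x (e2 i) + x i = a := by
    intro i
    have hd : ∀ x ∈ V, HasFDerivAt (fun x => fderiv ℝ p x (e2 i) + x i) (0 : E2 →L[ℝ] ℝ) x := by
      intro x hx
      have h1 : DifferentiableAt ℝ (fun y => fderiv ℝ p y (e2 i)) x :=
        ((contDiffOn_pd hV hp (e2 i)).differentiableOn one_ne_zero x hx).differentiableAt (hV.mem_nhds hx)
      have h2 : HasFDerivAt (fun x : E2 => x i) (cL i) x := (cL i).hasFDerivAt
      have := h1.hasFDerivAt.add h2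
      rw [hess_rig hV hp hl hg i hx] at this
      rw [neg_add_cancel] at this
      exact this
    exact hV.exists_is_const_of_fderiv_eq_zero hVc (fun x hx => (hd x hx).differentiableAt.differentiableWithinAt)
      (fun x hx => (hd x hx).fderiv)
  obtain ⟨a, ha⟩ := key 0
  obtain ⟨b, hb⟩ := key 1
  refine ⟨!₂[a, b], fun x hx => ?_⟩
  have h1 := hg x hx
  rw [clm_norm_sq] at h1
  have h2 := ha x hx
  have h3 := hb x hx
  rw [dist_sq_E2]
  simp only [PiLp.toLp_apply, Matrix.cons_val_zero, Matrix.cons_val_one]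
  rw [← h2, ← h3]
  linarith

lemma comp_closed {W : Set E2} {x y : E2} (hx : x ∈ W) (hy : y ∈ W) (h : y ∈ closure (connectedComponentIn W x)) :
    y ∈ connectedComponentIn W x := by
  set V := connectedComponentIn W x with hV
  have hVp : IsPreconnected V := isPreconnected_connectedComponentIn
  have h1 : IsPreconnected (insert y V) := hVp.subset_closure (subset_insert _ _)
    (insert_subset h subset_closure)
  have h2 : insert y V ⊆ V := by
    apply h1.subset_connectedComponentIn (mem_insert_of_mem _ (mem_connectedComponentIn hx))
    exact insert_subset hy (connectedComponentIn_subset _ _)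
  exact h2 (mem_insert _ _)

/-- generic extension: `Q` is connected, meets the component, and any closure point in `Q` lies in `W` -/
lemma ext_comp {W Q : Set E2} {x : E2} (hW : IsOpen W) (hQ : IsPreconnected Q) (hx : x ∈ W) (hxQ : x ∈ Q)
    (h : ∀ y ∈ closure (connectedComponentIn W x), y ∈ Q → y ∈ W) : Q ⊆ connectedComponentIn W x := by
  have hVo : IsOpen (connectedComponentIn W x) := hW.connectedComponentIn
  apply side_of hQ hVo
  · intro y hy hf
    rw [hVo.frontier_eq] at hf
    exact hf.2 (comp_closed hx (h y hf.1 hy) hf.1)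
  · exact ⟨x, hxQ, mem_connectedComponentIn hx⟩

lemma clos_parab {V D : Set E2} {p : E2 → ℝ} {m : ℝ} {x0 : E2} (hVD : V ⊆ D) (hp : ContinuousOn p (closure D))
    (h : ∀ x ∈ V, p x = m - dist x x0 ^ 2 / 2) : ∀ x ∈ closure V, p x = m - dist x x0 ^ 2 / 2 := by
  intro x hx
  have : ContinuousOn p (closure V) := hp.mono (closure_mono hVD)
  have h2 : EqOn p (fun x => m - dist x x0 ^ 2 / 2) V := h
  exact h2.of_subset_closure this (by fun_prop) subset_closure subset_rfl hx

/-- an open set which contains `B` up to measure zero lies in the closure of `B` -/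
lemma sub_clos {D B : Set E2} (hD : IsOpen D) (hDb : Bornology.IsBounded D) (hB : MeasurableSet B) (hBD : B ⊆ D)
    (hv : volume.real D ≤ volume.real B) : D ⊆ closure B := by
  have h1 : volume.real (D \ B) = 0 := by
    have hle := measureReal_mono hBD hDb.measure_lt_top.ne (μ := volume)
    rw [measureReal_sdiff hBD hB hDb.measure_lt_top.ne] <;> linarith
  have h2 : volume (D \ closure B) = 0 := by
    have : volume (D \ B) = 0 := by
      rw [measureReal_def, ENNReal.toReal_eq_zero_iff] at h1
      exact h1.resolve_right (hDb.subset sdiff_subset).measure_lt_top.ne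
    exact measure_mono_null (sdiff_subset_sdiff_right subset_closure) this
  have h3 : IsOpen (D \ closure B) := hD.sdiff isClosed_closure
  have h4 : D \ closure B = ∅ := by
    by_contra hne
    exact (h3.measure_pos volume (nonempty_iff_ne_empty.2 hne)).ne' h2
  exact sdiff_eq_empty.1 h4

lemma eq_ball {D : Set E2} {x0 : E2} {r : ℝ} (hr : 0 < r) (hD : IsOpen D) (hDb : Bornology.IsBounded D)
    (hBD : ball x0 r ⊆ D) (hv : volume.real D ≤ volume.real (ball x0 r)) : D = ball x0 r := by
  apply subset_antisymm _ hBD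
  have h1 := sub_clos hD hDb measurableSet_ball hBD hv
  rw [closure_ball _ hr.ne'] at h1
  rw [← interior_closedBall _ hr.ne']
  exact interior_maximal h1 hD

lemma vol_ball (x0 : E2) {r : ℝ} (hr : 0 ≤ r) : volume.real (ball x0 r) = π * r^2 := by
  rw [measureReal_def, EuclideanSpace.volume_ball_fin_two]
  rw [ENNReal.toReal_mul, ENNReal.toReal_pow, ENNReal.toReal_ofReal hr]
  simp [mul_comm, pi_pos.le]

/-- ball around a maximum point -/
lemma ball_max {D : Set E2} {p : E2 → ℝ} {c M : ℝ} {x : E2} (hD : IsOpen D) (hp : ContDiffOn ℝ 2 p D)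
    (hpc : ContinuousOn p (closure D)) (hl : ∀ x ∈ D, lap p x = -2) (hf : ∀ x ∈ frontier D, p x ≤ c)
    (hg : ∀ x ∈ D, c < p x → ‖fderiv ℝ p x‖^2 = 2*(M - p x)) (hx : x ∈ D) (hxM : p x = M) (hcM : c < M) :
    ball x (√(2*(M-c))) ⊆ D ∩ {x | c < p x} ∧ ∀ y ∈ ball x (√(2*(M-c))), p y = M - dist y x^2/2 := by
  set W := D ∩ p ⁻¹' (Ioi c) with hW
  have hWo : IsOpen W := (hpc.mono subset_closure).isOpen_inter_preimage hD isOpen_Ioi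
  have hxW : x ∈ W := ⟨hx, by rw [mem_preimage, hxM]; exact hcM⟩
  set V := connectedComponentIn W x with hV
  have hVW : V ⊆ W := connectedComponentIn_subset _ _
  have hVo : IsOpen V := hWo.connectedComponentIn
  obtain ⟨x0, hx0⟩ := rigV (m := M) hVo isPreconnected_connectedComponentIn (hp.mono (hVW.trans inter_subset_left))
    (fun y hy => hl y (hVW hy).1) (fun y hy => hg y (hVW hy).1 (hVW hy).2)
  have hxx : x0 = x := by
    have := hx0 x (mem_connectedComponentIn hxW)
    rw [hxM] at this
    have h2 : dist x x0 ^ 2 = 0 := by linarith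
    have h3 := pow_eq_zero_iff (two_ne_zero) |>.1 h2
    exact (dist_eq_zero.1 h3).symm
  subst hxx
  have hcl := clos_parab (hVW.trans inter_subset_left) hpc hx0
  have hR : 0 < 2*(M-c) := by linarith
  have hsub : ball x0 (√(2*(M-c))) ⊆ V := by
    apply ext_comp hWo (convex_ball _ _).isPreconnected hxW (mem_ball_self (Real.sqrt_pos.2 hR))
    intro y hy hyb
    have h1 := hcl y hy
    have h2 : dist y x0 ^ 2 < 2*(M-c) := by
      rw [mem_ball] at hyb
      have := Real.sq_sqrt hR.le
      nlinarith [dist_nonneg (x := y) (y := x0)]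
    have h3 : c < p y := by linarith
    refine ⟨?_, h3⟩
    by_contra hyD
    have : y ∈ frontier D := by
      rw [hD.frontier_eq]; exact ⟨closure_mono (hVW.trans inter_subset_left) hy, hyD⟩
    linarith [hf y this]
  exact ⟨hsub.trans hVW, fun y hy => hx0 y (hsub hy)⟩

lemma gradA {D : Set E2} {p : E2 → ℝ} {c M : ℝ} (hD : IsOpen D)
    (hH : Core (D.indicator p) (Ioi c)) (hc : 0 ≤ c)
    (hmu : ∀ t, 0 < t → t < M → mu D p t = 2*π*M - 2*π*t) (hM : ∀ x ∈ D, p x ≤ M) :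
    ∀ x ∈ D, c < p x → ‖fderiv ℝ p x‖^2 = 2*(M - p x) := by
  intro x hx hcx
  have hpi := pi_pos
  have he : D.indicator p =ᶠ[𝓝 x] p := by
    filter_upwards [hD.mem_nhds hx] with y hy using indicator_of_mem hy p
  rcases (hM x hx).eq_or_lt with h | h
  · have hmax : IsLocalMax p x := by
      filter_upwards [hD.mem_nhds hx] with y hy
      rw [h]; exact hM y hy
    rw [hmax.fderiv_eq_zero, h]; simp
  · have := (hH.mono (J := Ioo c M) isOpen_Ioo (fun t ht => ht.1)).rigid isOpen_Ioo (K := 2*π*M) (x := x) (by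
      intro τ hτ
      have h0 := hc.trans_lt hτ.1
      rw [lev_ind h0.le, hmu τ h0 hτ.2]) (by rw [indicator_of_mem hx]; exact ⟨hcx, h⟩)
    rw [he.fderiv_eq, indicator_of_mem hx] at this
    rw [this]; field_simp

lemma exists_max {D : Set E2} {p : E2 → ℝ} {c : ℝ} (hD : IsOpen D) (hDb : Bornology.IsBounded D)
    (hpc : ContinuousOn p (closure D)) (hne : D.Nonempty) (hf : ∀ x ∈ frontier D, p x ≤ c)
    (hb : BddAbove (p '' D)) (hc : c < sSup (p '' D)) : ∃ x ∈ D, p x = sSup (p '' D) := by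
  obtain ⟨x, hx, hmax⟩ := hDb.isCompact_closure.exists_isMaxOn hne.closure hpc
  have h1 : sSup (p '' D) ≤ p x := csSup_le (hne.image p) (by
    rintro _ ⟨y, hy, rfl⟩; exact isMaxOn_iff.1 hmax y (subset_closure hy))
  have hxD : x ∈ D := by
    by_contra h
    have := hf x (by rw [hD.frontier_eq]; exact ⟨hx, h⟩)
    linarith
  exact ⟨x, hxD, le_antisymm (le_csSup hb ⟨x, hxD, rfl⟩) h1⟩

lemma rigidA {D : Set E2} {p : E2 → ℝ} (hD : IsOpen D) (hDb : Bornology.IsBounded D)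
    (hp : ContDiffOn ℝ 2 p D) (hpc : ContinuousOn p (closure D)) (hne : D.Nonempty)
    (hl : ∀ x ∈ D, lap p x = -2) (hf : ∀ x ∈ frontier D, p x ≤ 0)
    (hM : sSup (p '' D) = volume.real D / (2*π)) : ∃ x₀ : E2, ∃ r : ℝ, 0 < r ∧ D = Metric.ball x₀ r := by
  have hpi := pi_pos
  have hpD := hpc.mono subset_closure
  have H := dropA hD hDb hp hpc hl hf
  have hbd := H.bdd hD hDb hpD
  have hmu := fun t ht htM => H.eq_mu hD hDb hpD hne hM (t := t) ht htM
  set M := sSup (p '' D) with hMd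
  have hA : 0 < volume.real D := ENNReal.toReal_pos (hD.measure_pos volume hne).ne' hDb.measure_lt_top.ne
  have hM0 : 0 < M := by rw [hM]; positivity
  have hAM : volume.real D = 2*π*M := by rw [hM]; field_simp
  rw [hAM] at hmu
  have hg := gradA hD (coreA hD hDb hp hpc hl le_rfl hf) le_rfl hmu (fun x hx => le_csSup hbd ⟨x, hx, rfl⟩)
  obtain ⟨x, hx, hxM⟩ := exists_max hD hDb hpc hne hf hbd hM0
  obtain ⟨h1, -⟩ := ball_max hD hp hpc hl hf hg hx hxM hM0
  rw [sub_zero] at h1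
  refine ⟨x, √(2*M), by positivity, eq_ball (by positivity) hD hDb (h1.trans inter_subset_left) ?_⟩
  rw [vol_ball _ (by positivity), Real.sq_sqrt (by positivity), hAM]
  linarith
end

section
def ann (x0 : E2) (r1 r2 : ℝ) : Set E2 := {x : E2 | r1 < dist x x0 ∧ dist x x0 < r2}

lemma ann_eq (x0 : E2) (r1 r2 : ℝ) : ann x0 r1 r2 = ball x0 r2 \ closedBall x0 r1 := by
  ext x; simp only [ann, mem_ofPred_eq, Set.mem_sdiff, mem_ball, mem_closedBall, not_le]; tauto

lemma ann_conn (x0 : E2) {r1 r2 : ℝ} (h1 : 0 ≤ r1) : IsPreconnected (ann x0 r1 r2) := by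
  have hs : IsPreconnected (sphere (0:E2) 1) := by
    apply isPreconnected_sphere
    rw [← Module.finrank_eq_rank, finrank_E2]; exact_mod_cast one_lt_two
  have h2 : IsPreconnected (Ioo r1 r2 ×ˢ sphere (0:E2) 1) := isPreconnected_Ioo.prod hs
  have h3 := h2.image (fun y : ℝ × E2 => x0 + y.1 • y.2) (by fun_prop)
  convert h3 using 1
  ext x; constructor
  · intro hx
    have hpos : 0 < dist x x0 := h1.trans_lt hx.1
    refine ⟨(dist x x0, (dist x x0)⁻¹ • (x - x0)), ⟨hx, ?_⟩, ?_⟩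
    · rw [mem_sphere_zero_iff_norm, norm_smul, ← dist_eq_norm, norm_inv, norm_of_nonneg dist_nonneg]
      exact inv_mul_cancel₀ hpos.ne'
    · simp only [smul_smul]; rw [mul_inv_cancel₀ hpos.ne', one_smul]; abel
  · rintro ⟨⟨t, u⟩, ⟨ht, hu⟩, rfl⟩
    have hu : ‖u‖ = 1 := mem_sphere_zero_iff_norm.1 hu
    have ht : t ∈ Ioo r1 r2 := ht
    have : dist (x0 + t • u) x0 = t := by
      rw [dist_eq_norm, add_sub_cancel_left, norm_smul, hu, mul_one, norm_of_nonneg (h1.trans ht.1.le)]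
    simp only [ann, mem_ofPred_eq, this]; exact ht

lemma vol_ann (x0 : E2) {r1 r2 : ℝ} (h1 : 0 ≤ r1) (h2 : r1 < r2) : volume.real (ann x0 r1 r2) = π * r2^2 - π * r1^2 := by
  rw [ann_eq, measureReal_sdiff (closedBall_subset_ball h2) measurableSet_closedBall measure_ball_lt_top.ne, vol_ball _ (h1.trans h2.le)]
  congr 1
  rw [← vol_ball x0 h1, measureReal_def, measureReal_def, Measure.addHaar_closedBall_eq_addHaar_ball]

lemma eq_ann {D : Set E2} {x0 : E2} {r1 r2 : ℝ} (hr1 : 0 < r1) (hr2 : r1 < r2) (hD : IsOpen D) (hDb : Bornology.IsBounded D)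
    (hBD : ann x0 r1 r2 ⊆ D) (hv : volume.real D ≤ volume.real (ann x0 r1 r2)) : D = ann x0 r1 r2 := by
  apply subset_antisymm _ hBD
  have hm : MeasurableSet (ann x0 r1 r2) := by rw [ann_eq]; exact measurableSet_ball.diff measurableSet_closedBall
  have h1 := sub_clos hD hDb hm hBD hv
  have hr2' : r2 ≠ 0 := (hr1.trans hr2).ne'
  have a1 : D ⊆ closedBall x0 r2 := h1.trans (closure_minimal (fun x hx => hx.2.le) isClosed_closedBall)
  have a2 : D ⊆ (ball x0 r1)ᶜ := h1.trans (closure_minimal (fun x hx => by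
    rw [mem_compl_iff, mem_ball, not_lt]; exact hx.1.le) isOpen_ball.isClosed_compl)
  have b1 := interior_maximal a1 hD
  have b2 := interior_maximal a2 hD
  rw [interior_closedBall _ hr2'] at b1
  rw [interior_compl, closure_ball _ hr1.ne'] at b2
  rw [ann_eq]
  exact fun x hx => ⟨b1 hx, b2 hx⟩

lemma freq_eq {f : E2 → ℝ} {x : E2} {a : ℝ} (hf : ContinuousAt f x) (h : ∃ᶠ y in 𝓝 x, f y = a) : f x = a := by
  by_contra hne
  exact h (hf.eventually_ne hne)

lemma max_dist {U : Set E2} {x0 : E2} {r : ℝ} (hr : 0 ≤ r) (hU : IsOpen U) (hUb : Bornology.IsBounded U)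
    (hf : frontier U ⊆ closedBall x0 r) : U ⊆ closedBall x0 r := by
  intro u hu
  obtain ⟨y, hy, hmax⟩ := hUb.isCompact_closure.exists_isMaxOn ⟨u, subset_closure hu⟩
    (f := fun y => dist y x0) (by fun_prop)
  have h1 : dist u x0 ≤ dist y x0 := isMaxOn_iff.1 hmax u (subset_closure hu)
  rw [mem_closedBall]
  by_cases hyU : y ∈ U
  · have hc : Tendsto (fun s : ℝ => y + s • (y - x0)) (𝓝[>] 0) (𝓝 (y + (0:ℝ) • (y - x0))) := by
      have : Continuous (fun s : ℝ => y + s • (y - x0)) := by fun_prop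
      exact (this.tendsto 0).mono_left nhdsWithin_le_nhds
    rw [zero_smul, add_zero] at hc
    obtain ⟨s, hs, hs0⟩ := ((hc.eventually (hU.mem_nhds hyU)).and self_mem_nhdsWithin).exists
    have hs0 : 0 < s := hs0
    have h2 : dist (y + s • (y - x0)) x0 ≤ dist y x0 := isMaxOn_iff.1 hmax _ (subset_closure hs)
    have h3 : dist (y + s • (y - x0)) x0 = (1 + s) * dist y x0 := by
      rw [dist_eq_norm, dist_eq_norm, show y + s • (y - x0) - x0 = (1 + s) • (y - x0) by rw [add_smul, one_smul]; abel,
        norm_smul, norm_of_nonneg (by linarith)]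
    have h4 := dist_nonneg (x := y) (y := x0)
    have h5 : dist y x0 ≤ 0 := by
      by_contra! h; nlinarith
    linarith
  · have : y ∈ frontier U := by rw [hU.frontier_eq]; exact ⟨hy, hyU⟩
    exact h1.trans (hf this)

variable {w N : ℝ → E2} {δ : ℝ} {D U : Set E2}

lemma rigidB (H : Sides w N δ D U) {G : Set E2} {c : ℝ} (hD : IsOpen D) (hDb : Bornology.IsBounded D)
    (hne : D.Nonempty) (hUne : U.Nonempty)
    (hU : IsOpen U) (hUb : Bornology.IsBounded U) (hfU : frontier U = w '' Icc 0 1)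
    (hfD : frontier D = G ∪ w '' Icc 0 1)
    (hUD : closure U ∩ D = ∅) {p : E2 → ℝ} (hp2 : ContDiffOn ℝ 2 p D) (hp : ContDiffOn ℝ 1 p (closure D))
    (hl : ∀ x ∈ D, lap p x = -2) (hpG : ∀ x ∈ G, p x = 0) (hpw : ∀ x ∈ w '' Icc 0 1, p x = c) (hc0 : 0 < c)
    (HB : Core (qB D U p c) (Ioo 0 c)) (hM : sSup (p '' D) = volume.real D / (2*π)) : IsDiskOrAnnulus D := by
  have hpi := pi_pos
  have hpc := hp.continuousOn
  have hpD := hpc.mono subset_closure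
  have hn : volume (frontier U) = 0 := by rw [hfU]; exact H.null
  have hf : ∀ x ∈ frontier D, p x ≤ c := by
    intro x hx; rw [hfD] at hx
    rcases hx with h | h
    · rw [hpG x h]; exact hc0.le
    · rw [hpw x h]
  have Hd := dropB hD hDb hp2 hpc hl hc0 hf hUb hU hUD hn hUne HB
  have hbd := Hd.bdd hD hDb hpD
  have hmu := fun t ht htM => Hd.eq_mu hD hDb hpD hne hM (t := t) ht htM
  set M := sSup (p '' D) with hMd
  have hA : 0 < volume.real D := ENNReal.toReal_pos (hD.measure_pos volume hne).ne' hDb.measure_lt_top.ne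
  have hM0 : 0 < M := by rw [hM]; positivity
  have hAM : volume.real D = 2*π*M := by rw [hM]; field_simp
  rw [hAM] at hmu
  have hle : ∀ x ∈ D, p x ≤ M := fun x hx => le_csSup hbd ⟨x, hx, rfl⟩
  have hUpos : 0 < volume.real U := ENNReal.toReal_pos (hU.measure_pos volume hUne).ne' hUb.measure_lt_top.ne
  have hfrD : ∀ x ∈ frontier D, x ∉ D := fun x hx => by rw [hD.frontier_eq] at hx; exact hx.2
  have hcM : c ≤ M := by
    have hw0 : w 0 ∈ w '' Icc 0 1 := ⟨0, by simp, rfl⟩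
    have h1 : w 0 ∈ closure D := frontier_subset_closure (by rw [hfD]; right; exact hw0)
    rw [← hpw _ hw0]
    have h2 := ((hpc _ h1).mono subset_closure).mem_closure_image h1
    have h3 : closure (p '' D) ⊆ Iic M := closure_minimal (by rintro _ ⟨y, hy, rfl⟩; exact hle y hy) isClosed_Iic
    exact h3 h2
  have gA := gradA hD (coreA hD hDb hp2 hpc hl hc0.le hf) hc0.le hmu hle
  set β := volume.real U / (2*π) with hβ
  have hβ0 : 0 < β := by positivity
  have gB : ∀ x ∈ D, 0 < p x → p x < c → ‖fderiv ℝ p x‖^2 = 2*(M + β - p x) := by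
    intro x hx h0 h1
    have hq : ∀ y ∈ D, qB D U p c y = p y := fun y hy => by simp [qB, hy]
    have he : qB D U p c =ᶠ[𝓝 x] p := by
      filter_upwards [hD.mem_nhds hx] with y hy using hq y hy
    have := HB.rigid isOpen_Ioo (K := 2*π*M + volume.real U) (x := x) (by
      intro τ hτ
      rw [lev_qB hD hDb hpD hUb hU hUD hn hτ, hmu τ hτ.1 (hτ.2.trans_le hcM)]; ring) (by rw [hq x hx]; exact ⟨h0, h1⟩)
    rw [he.fderiv_eq, hq x hx] at this
    rw [this, hβ]; field_simp
  have hpcA : ∀ x ∈ D, ContinuousAt p x := fun x hx => hpD.continuousAt (hD.mem_nhds hx)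
  have hnoc : ∀ x ∈ D, p x ≠ c := by
    intro x hx hxc
    have hcf : ContinuousAt (fun y => ‖fderiv ℝ p y‖^2 - 2*(M - p y)) x := by
      have h1 : ContinuousAt (fderiv ℝ p) x :=
        (hp2.continuousOn_fderiv_of_isOpen hD (by norm_num)).continuousAt (hD.mem_nhds hx)
      have h2 := hpcA x hx
      exact (h1.norm.pow 2).sub (continuousAt_const.mul (continuousAt_const.sub h2))
    have hup : (∃ᶠ y in 𝓝 x, c < p y) → ‖fderiv ℝ p x‖^2 - 2*(M - c) = 0 := by
      intro h
      have := freq_eq (a := 0) hcf ((h.and_eventually (hD.mem_nhds hx)).mono fun y hy => by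
        have := gA y hy.2 hy.1
        linarith)
      rwa [hxc] at this
    have hdn : (∃ᶠ y in 𝓝 x, p y < c) → ‖fderiv ℝ p x‖^2 - 2*(M - c) = 2*β := by
      intro h
      have h0 : ∀ᶠ y in 𝓝 x, 0 < p y := (hpcA x hx).eventually_const_lt (by rw [hxc]; exact hc0)
      have hDx : ∀ᶠ y in 𝓝 x, y ∈ D := hD.mem_nhds hx
      have := freq_eq (a := 2*β) hcf ((h.and_eventually (hDx.and h0)).mono fun y hy => by
        have := gB y hy.2.1 hy.2.2 hy.1
        linarith)
      rwa [hxc] at this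
    by_cases h1 : ∃ᶠ y in 𝓝 x, c < p y
    · have u := hup h1
      by_cases h2 : ∃ᶠ y in 𝓝 x, p y < c
      · linarith [hdn h2]
      · rw [not_frequently] at h2
        have hmin : IsLocalMin p x := by
          filter_upwards [h2] with y hy
          rw [hxc]; exact not_lt.1 hy
        rw [hmin.fderiv_eq_zero] at u
        simp at u
        obtain ⟨y, hy1, hy2⟩ := (h1.and_eventually (hD.mem_nhds hx)).exists
        linarith [hle y hy2]
    · rw [not_frequently] at h1
      have hmax : IsLocalMax p x := by
        filter_upwards [h1] with y hy
        rw [hxc]; exact not_lt.1 hy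
      by_cases h2 : ∃ᶠ y in 𝓝 x, p y < c
      · have u := hdn h2
        rw [hmax.fderiv_eq_zero] at u
        simp at u
        linarith
      · rw [not_frequently] at h2
        have hcst : p =ᶠ[𝓝 x] fun _ => c := by
          filter_upwards [h1, h2] with y a b
          exact le_antisymm (not_lt.1 a) (not_lt.1 b)
        have h3 := hcst.fderiv (𝕜 := ℝ)
        have h4 : ∀ i, (fun y => fderiv ℝ p y (e2 i)) =ᶠ[𝓝 x] fun _ => 0 := by
          intro i; filter_upwards [h3] with y hy
          rw [hy]; simp
        have := hl x hx
        unfold lap at this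
        rw [(h4 0).fderiv_eq, (h4 1).fderiv_eq] at this
        norm_num at this
  rcases hcM.eq_or_lt with hcM | hcM
  · right
    subst hcM
    set W := D ∩ p ⁻¹' (Ioi 0) with hW
    have hWo : IsOpen W := hpD.isOpen_inter_preimage hD isOpen_Ioi
    have hlt : ∀ x ∈ D, p x < M := fun x hx => lt_of_le_of_ne (hle x hx) (hnoc x hx)
    obtain ⟨_, ⟨x, hx, rfl⟩, hx0⟩ := exists_lt_of_lt_csSup (hne.image p) hM0
    have hxW : x ∈ W := ⟨hx, hx0⟩
    set V := connectedComponentIn W x with hV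
    have hVW : V ⊆ W := connectedComponentIn_subset _ _
    have hVo : IsOpen V := hWo.connectedComponentIn
    have hVD := hVW.trans inter_subset_left
    obtain ⟨x0, hx0⟩ := rigV (m := M + β) hVo isPreconnected_connectedComponentIn (hp2.mono hVD)
      (fun y hy => hl y (hVD hy)) (fun y hy => gB y (hVD hy) (hVW hy).2 (hlt y (hVD hy)))
    have hcl := clos_parab hVD hpc hx0
    have s1 := Real.sq_sqrt (show 0 ≤ 2*β by linarith)
    have s2 := Real.sq_sqrt (show 0 ≤ 2*(M+β) by linarith)
    have n1 := Real.sqrt_pos.2 (show 0 < 2*β by linarith)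
    have n2 := Real.sqrt_pos.2 (show 0 < 2*(M+β) by linarith)
    have n12 : √(2*β) < √(2*(M+β)) := Real.sqrt_lt_sqrt (by linarith) (by linarith)
    have hsub : ann x0 (√(2*β)) (√(2*(M+β))) ⊆ V := by
      apply ext_comp hWo (ann_conn x0 n1.le) hxW
      · have h1 := hx0 x (mem_connectedComponentIn hxW)
        have h2 := hlt x hx
        have h3 : 0 < p x := hxW.2
        constructor
        · apply lt_of_pow_lt_pow_left₀ 2 dist_nonneg; linarith
        · apply lt_of_pow_lt_pow_left₀ 2 n2.le; linarith
      · intro y hy hyb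
        have h1 := hcl y hy
        have h2 : √(2*β)^2 < dist y x0 ^ 2 := pow_lt_pow_left₀ hyb.1 n1.le two_ne_zero
        have h3 : dist y x0 ^ 2 < √(2*(M+β))^2 := pow_lt_pow_left₀ hyb.2 dist_nonneg two_ne_zero
        have h4 : 0 < p y := by linarith
        have h5 : p y < M := by linarith
        refine ⟨?_, h4⟩
        by_contra hyD
        have : y ∈ frontier D := by
          rw [hD.frontier_eq]; exact ⟨closure_mono hVD hy, hyD⟩
        rw [hfD] at this
        rcases this with h | h
        · linarith [hpG y h]
        · linarith [hpw y h]
    refine ⟨x0, √(2*β), √(2*(M+β)), n1, n12, eq_ann n1 n12 hD hDb (hsub.trans hVD) ?_⟩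
    rw [vol_ann x0 n1.le n12, s1, s2, hAM]; linarith
  · exfalso
    obtain ⟨x, hx, hxM⟩ := exists_max hD hDb hpc hne hf hbd hcM
    obtain ⟨h1, h2⟩ := ball_max hD hp2 hpc hl hf gA hx hxM hcM
    set R := √(2*(M-c)) with hR
    have hR0 : 0 < R := Real.sqrt_pos.2 (by linarith)
    have hRs : R^2 = 2*(M-c) := Real.sq_sqrt (by linarith)
    have hWo : IsOpen (D ∩ {x | c < p x}) := hpD.isOpen_inter_preimage hD isOpen_Ioi
    have hWB : D ∩ {x | c < p x} = ball x R := by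
      apply eq_ball hR0 hWo (hDb.subset inter_subset_left) h1
      have := hmu c hc0 hcM
      unfold mu at this
      rw [this, vol_ball _ hR0.le, hRs]; linarith
    have hBD : ball x R ⊆ D := h1.trans inter_subset_left
    have hcl := clos_parab hBD hpc h2
    have hsph : ∀ y ∈ sphere x R, y ∉ D := by
      intro y hy hyD
      apply hnoc y hyD
      rw [hcl y (by rw [closure_ball _ hR0.ne']; exact sphere_subset_closedBall hy), mem_sphere.1 hy, hRs]; ring
    obtain ⟨y, hy⟩ : (sphere x R).Nonempty := by
      refine ⟨x + R • e2 0, ?_⟩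
      rw [mem_sphere, dist_eq_norm, add_sub_cancel_left, norm_smul, norm_of_nonneg hR0.le]; simp [e2]
    have hyc : y ∈ closure (ball x R) := by rw [closure_ball _ hR0.ne']; exact sphere_subset_closedBall hy
    have hyw : y ∈ w '' Icc 0 1 := by
      have h3 : y ∈ frontier D := by rw [hD.frontier_eq]; exact ⟨closure_mono hBD hyc, hsph y hy⟩
      rw [hfD] at h3
      rcases h3 with h | h
      · exfalso
        have h4 := hcl y hyc
        rw [hpG y h, mem_sphere.1 hy, hRs] at h4
        linarith
      · exact h
    have hUD' : ∀ x ∈ closure U, x ∉ D := fun x hx h => by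
      have : x ∈ closure U ∩ D := ⟨hx, h⟩
      rw [hUD] at this; exact this
    obtain ⟨b, hbV, hbB⟩ := mem_closure_iff.1 hyc _ H.isOpen_V (H.curve_V hyw)
    obtain ⟨z, hz, rfl⟩ := hbV
    have hz : |z 1| < δ := hz
    have hz1 : 0 < z 1 := by
      by_contra! hneg
      apply hUD' _ _ (hBD hbB)
      rcases hneg.eq_or_lt with h0 | h0
      · apply frontier_subset_closure
        rw [hfU]; exact (H.off_curve hz).2 h0
      · exact subset_closure (H.minus z (abs_lt.1 hz).1 h0)
    have hQ : Phi w N '' {z | 0 < z 1 ∧ z 1 < δ} ⊆ ball x R := by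
      apply side_of (H.slab_conn 0 δ) isOpen_ball
      · rintro _ ⟨z, hz, rfl⟩
        rw [frontier_ball _ hR0.ne']
        exact fun h => hsph _ h (H.plus z hz.1 hz.2)
      · exact ⟨_, ⟨z, ⟨hz1, (abs_lt.1 hz).2⟩, rfl⟩, hbB⟩
    have hwB : frontier U ⊆ closedBall x R := by
      rw [hfU, H.curve]
      rintro _ ⟨z, hz, rfl⟩
      have hz : z 1 = 0 := hz
      have hc : Tendsto (fun s : ℝ => Phi w N (z + s • e2 1)) (𝓝[>] 0) (𝓝 (Phi w N (z + (0:ℝ) • e2 1))) := by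
        have : Continuous (fun s : ℝ => Phi w N (z + s • e2 1)) := H.contDiff.continuous.comp (by fun_prop)
        exact (this.tendsto 0).mono_left nhdsWithin_le_nhds
      rw [zero_smul, add_zero] at hc
      refine isClosed_closedBall.mem_of_tendsto hc ?_
      filter_upwards [Ioo_mem_nhdsGT H.hδ] with s hs
      apply ball_subset_closedBall
      apply hQ
      refine ⟨_, ?_, rfl⟩
      constructor <;> simp [e2, hz, hs.1, hs.2]
    have hUB := max_dist hR0.le hU hUb hwB
    have hUB2 := interior_maximal hUB hU
    rw [interior_closedBall _ hR0.ne'] at hUB2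
    obtain ⟨u, hu⟩ := hUne
    exact hUD' u (subset_closure hu) (hBD (hUB2 hu))
end

section
def quadF (x0 : E2) (R : ℝ) (x : E2) : ℝ := (R^2 - dist x x0 ^ 2) / 2

lemma quadF_eq (x0 : E2) (R : ℝ) : quadF x0 R = fun x : E2 => (R^2 - ((x 0 - x0 0)^2 + (x 1 - x0 1)^2)) / 2 := by
  ext x; rw [quadF, dist_sq_E2]

lemma quadF_contDiff (x0 : E2) (R : ℝ) : ContDiff ℝ 2 (quadF x0 R) := by
  rw [quadF_eq]
  have h0 : ContDiff ℝ 2 (fun x : E2 => x 0) := contDiff_coord 0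
  have h1 : ContDiff ℝ 2 (fun x : E2 => x 1) := contDiff_coord 1
  exact (contDiff_const.sub (((h0.sub contDiff_const).pow 2).add ((h1.sub contDiff_const).pow 2))).div_const 2

lemma hasFDerivAt_coord (i : Fin 2) (x : E2) :
    HasFDerivAt (fun y : E2 => y i) (EuclideanSpace.proj i : E2 →L[ℝ] ℝ) x :=
  (EuclideanSpace.proj i : E2 →L[ℝ] ℝ).hasFDerivAt

lemma quadF_fderiv (x0 : E2) (R : ℝ) (x e : E2) :
    fderiv ℝ (quadF x0 R) x e = -((x 0 - x0 0) * e 0 + (x 1 - x0 1) * e 1) := by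
  rw [quadF_eq]
  have h0 := ((hasFDerivAt_coord 0 x).sub_const (x0 0)).pow 2
  have h1 := ((hasFDerivAt_coord 1 x).sub_const (x0 1)).pow 2
  have h := (((h0.add h1).const_sub (R^2)).mul_const (1/2))
  have e1 : (fun x : E2 => (R^2 - ((x 0 - x0 0)^2 + (x 1 - x0 1)^2)) / 2) =
      fun x : E2 => (R^2 - ((x 0 - x0 0)^2 + (x 1 - x0 1)^2)) * (1/2) := by ext x; ring
  rw [e1]
  have h' : fderiv ℝ (fun x : E2 => (R^2 - ((x 0 - x0 0)^2 + (x 1 - x0 1)^2)) * (1/2)) x = _ := h.fderiv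
  rw [h']
  simp
  ring

lemma quadF_lap (x0 : E2) (R : ℝ) (x : E2) : lap (quadF x0 R) x = -2 := by
  unfold lap
  simp_rw [quadF_fderiv]
  have a0 : (fun y : E2 => -((y 0 - x0 0) * (e2 0) 0 + (y 1 - x0 1) * (e2 0) 1)) = fun y : E2 => -(y 0 - x0 0) := by
    ext y; simp [e2]
  have a1 : (fun y : E2 => -((y 0 - x0 0) * (e2 1) 0 + (y 1 - x0 1) * (e2 1) 1)) = fun y : E2 => -(y 1 - x0 1) := by
    ext y; simp [e2]
  rw [a0, a1]
  have h0 : fderiv ℝ (fun y : E2 => -(y 0 - x0 0)) x = _ := ((hasFDerivAt_coord 0 x).sub_const (x0 0)).neg.fderiv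
  have h1 : fderiv ℝ (fun y : E2 => -(y 1 - x0 1)) x = _ := ((hasFDerivAt_coord 1 x).sub_const (x0 1)).neg.fderiv
  rw [h0, h1]
  simp [e2]; norm_num

lemma qB_cont {D U : Set E2} {h : E2 → ℝ} {k : ℝ} (hD : IsOpen D) (hc : ContinuousOn h (closure D))
    (hx : ∀ x, x ∉ D → (x ∈ closure U ∧ (x ∈ closure D → h x = k) ∧ ∀ᶠ y in 𝓝 x, y ∈ D ∪ closure U) ∨
      (x ∉ closure U ∧ (x ∈ closure D → h x = 0))) : Continuous (qB D U h k) := by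
  rw [continuous_iff_continuousAt]
  intro x
  by_cases hxD : x ∈ D
  · have h1 : ContinuousAt h x := hc.continuousAt (mem_of_superset (hD.mem_nhds hxD) subset_closure)
    refine h1.congr ?_
    filter_upwards [hD.mem_nhds hxD] with y hy
    simp [qB, hy]
  have key : ∀ v, (x ∈ closure D → h x = v) → ∀ ε > 0, ∀ᶠ y in 𝓝 x, y ∈ D → dist (h y) v < ε := by
    intro v hv ε hε
    by_cases hcl : x ∈ closure D
    · have := (hc x hcl)
      rw [ContinuousWithinAt, hv hcl, Metric.tendsto_nhds] at this
      have h2 := this ε hε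
      rw [eventually_nhdsWithin_iff] at h2
      filter_upwards [h2] with y hy hyD using hy (subset_closure hyD)
    · filter_upwards [isClosed_closure.isOpen_compl.mem_nhds hcl] with y hy hyD
      exact absurd (subset_closure hyD) hy
  rcases hx x hxD with ⟨h1, h2, h3⟩ | ⟨h1, h2⟩
  · have e : qB D U h k x = k := by simp [qB, hxD, h1]
    rw [ContinuousAt, e, Metric.tendsto_nhds]
    intro ε hε
    filter_upwards [key k h2 ε hε, h3] with y hy hy3
    by_cases hyD : y ∈ D
    · simpa [qB, hyD] using hy hyD
    · have : y ∈ closure U := hy3.resolve_left hyD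
      simpa [qB, hyD, this] using hε
  · have e : qB D U h k x = 0 := by simp [qB, hxD, h1]
    rw [ContinuousAt, e, Metric.tendsto_nhds]
    intro ε hε
    filter_upwards [key 0 h2 ε hε, isClosed_closure.isOpen_compl.mem_nhds h1] with y hy hy3
    by_cases hyD : y ∈ D
    · simpa [qB, hyD] using hy hyD
    · have : y ∉ closure U := hy3
      simpa [qB, hyD, this] using hε

/-- `h = p - quad` has vanishing gradient where it avoids its boundary values -/
lemma energy {D U : Set E2} {p : E2 → ℝ} {k R : ℝ} {x0 : E2} (hD : IsOpen D) (hDb : Bornology.IsBounded D)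
    (hUb : Bornology.IsBounded U) (hUD : closure U ∩ D = ∅) (hp : ContDiffOn ℝ 1 p D)
    (hcont : Continuous (qB D U (fun x => p x - quadF x0 R x) k))
    (hw : ∀ (η : E2 → ℝ) (κ : ℝ), ContDiff ℝ 1 η → HasCompactSupport η → tsupport η ⊆ D ∪ closure U →
      (∀ x ∈ closure U, ∀ᶠ y in 𝓝 x, η y = κ) → ∫ x in D, gdot p η x = 2 * ∫ x, η x)
    {x : E2} (hx : x ∈ D) (h0 : p x - quadF x0 R x ≠ 0) (hk : p x - quadF x0 R x ≠ k) :
    fderiv ℝ (fun x => p x - quadF x0 R x) x = 0 := by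
  set h : E2 → ℝ := fun x => p x - quadF x0 R x with hh
  set H := qB D U h k with hH
  have hhC : ContDiffOn ℝ 1 h D := hp.sub ((quadF_contDiff x0 R).of_le (by norm_num)).contDiffOn
  have HD : ∀ y ∈ D, H y = h y := fun y hy => by simp [hH, qB, hy]
  have HU : ∀ y ∈ closure U, H y = k := fun y hy => by
    have : y ∉ D := fun h => by
      have : y ∈ closure U ∩ D := ⟨hy, h⟩
      rw [hUD] at this; exact this
    simp [hH, qB, hy, this]
  have HO : ∀ y, y ∉ D → y ∉ closure U → H y = 0 := fun y h1 h2 => by simp [hH, qB, h1, h2]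
  set v := h x with hv
  have h0 : v ≠ 0 := h0
  have hk : v ≠ k := hk
  have b0 : 0 < |v| := abs_pos.2 h0
  have bk : 0 < |k - v| := abs_pos.2 (sub_ne_zero.2 hk.symm)
  set ε := min |v| |k - v| / 2 with hε
  have hε0 : 0 < ε := by rw [hε]; exact half_pos (lt_min b0 bk)
  have e0 : ε < |v| := by have := min_le_left |v| |k - v|; linarith
  have ek : ε < |k - v| := by have := min_le_right |v| |k - v|; linarith
  set ψ : ℝ → ℝ := fun r => max 0 (ε - |r - v|) with hψ
  have hψc : Continuous ψ := by fun_prop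
  have hψ0 : ∀ r, 0 ≤ ψ r := fun r => le_max_left _ _
  set φ : ℝ → ℝ := fun r => ∫ y in (0:ℝ)..r, ψ y with hφ
  have hφd : ∀ r, HasDerivAt φ (ψ r) r := fun r =>
    intervalIntegral.integral_hasDerivAt_right (hψc.intervalIntegrable _ _)
      hψc.aestronglyMeasurable.stronglyMeasurableAtFilter hψc.continuousAt
  have hφC : ContDiff ℝ 1 φ := by
    rw [contDiff_one_iff_deriv]
    refine ⟨fun r => (hφd r).differentiableAt, ?_⟩
    have : deriv φ = ψ := funext fun r => (hφd r).deriv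
    rw [this]; exact hψc
  have hφ00 : φ 0 = 0 := by simp [hφ]
  -- local constancy of φ away from v
  have hloc : ∀ s, ε < |s - v| → ∀ᶠ r in 𝓝 s, φ r = φ s := by
    intro s hs
    have ho : IsOpen {r : ℝ | ε < |r - v|} := isOpen_lt (by fun_prop) (by fun_prop)
    obtain ⟨ρ, hρ, hb⟩ := Metric.isOpen_iff.1 ho s hs
    filter_upwards [ball_mem_nhds s hρ] with r hr
    refine (convex_ball s ρ).is_const_of_fderivWithin_eq_zero (𝕜 := ℝ) (f := φ)
      (fun y _ => (hφd y).differentiableAt.differentiableWithinAt) (fun y hy => ?_) hr (mem_ball_self hρ)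
    rw [fderivWithin_of_isOpen isOpen_ball hy]
    have h1 : ψ y = 0 := by
      have : ε < |y - v| := hb hy
      simp only [hψ]; exact max_eq_left (by linarith)
    have h2 := (hφd y).hasFDerivAt.fderiv
    rw [h2, h1]; ext; simp
  set η : E2 → ℝ := fun y => φ (H y) with hη
  have hlocη : ∀ y, y ∉ D → ∀ᶠ z in 𝓝 y, η z = φ (H y) := by
    intro y hy
    have : ε < |H y - v| := by
      by_cases hyU : y ∈ closure U
      · rw [HU y hyU]; exact ek
      · rw [HO y hy hyU]; simpa using e0
    exact hcont.continuousAt.eventually (hloc _ this)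
  have hηD : ∀ y ∈ D, HasFDerivAt η (ψ (h y) • fderiv ℝ h y) y := by
    intro y hy
    have h1 : DifferentiableAt ℝ h y := (hhC.contDiffAt (hD.mem_nhds hy)).differentiableAt one_ne_zero
    have h2 := (hφd (h y)).comp_hasFDerivAt y h1.hasFDerivAt
    refine h2.congr_of_eventuallyEq ?_
    filter_upwards [hD.mem_nhds hy] with z hz
    simp [hη, HD z hz]
  have hηC : ContDiff ℝ 1 η := by
    rw [contDiff_iff_contDiffAt]
    intro y
    by_cases hy : y ∈ D
    · have h1 := hφC.contDiffAt.comp y (hhC.contDiffAt (hD.mem_nhds hy))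
      refine h1.congr_of_eventuallyEq ?_
      filter_upwards [hD.mem_nhds hy] with z hz
      simp [hη, HD z hz]
    · exact contDiffAt_const.congr_of_eventuallyEq (hlocη y hy)
  have hcpt : IsCompact (closure D ∪ closure U) := hDb.isCompact_closure.union hUb.isCompact_closure
  have hts : tsupport η ⊆ closure D ∪ closure U := by
    refine closure_minimal ?_ hcpt.isClosed
    intro y hy
    by_contra hcon
    rw [mem_union, not_or] at hcon
    apply hy
    simp only [hη]
    rw [HO y (fun h => hcon.1 (subset_closure h)) hcon.2, hφ00]
  have hηc : HasCompactSupport η := hcpt.of_isClosed_subset (isClosed_tsupport _) hts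
  have hηs : tsupport η ⊆ D ∪ closure U := by
    intro y hy
    by_contra hcon
    rw [mem_union, not_or] at hcon
    refine notMem_tsupport_iff_eventuallyEq.2 ?_ hy
    have := hlocη y hcon.1
    rw [HO y hcon.1 hcon.2, hφ00] at this
    exact this
  have hηκ : ∀ y ∈ closure U, ∀ᶠ z in 𝓝 y, η z = φ k := by
    intro y hy
    have hyD : y ∉ D := fun h => by
      have : y ∈ closure U ∩ D := ⟨hy, h⟩
      rw [hUD] at this; exact this
    have := hlocη y hyD
    rwa [HU y hy] at this
  have w1 := hw η (φ k) hηC hηc hηs hηκ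
  have hqC := quadF_contDiff x0 R
  have w2 := weak_loc isOpen_univ hqC.contDiffOn (fun y _ => quadF_lap x0 R y) hηC hηc (subset_univ _)
  rw [neg_neg] at w2
  have w3 : ∫ y in univ, gdot (quadF x0 R) η y = ∫ y in D, gdot (quadF x0 R) η y := by
    apply setIntegral_eq_of_subset_of_forall_sdiff_eq_zero MeasurableSet.univ (subset_univ _)
    intro y hy
    have : fderiv ℝ η y = 0 := by
      rw [(show η =ᶠ[𝓝 y] fun _ => φ (H y) from hlocη y hy.2).fderiv_eq]; simp
    simp [gdot, this]
  have i1 := gdot_int hD hp hηC hηc hηs hηκ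
  have i2 := gdot_int hD (hqC.of_le (by norm_num)).contDiffOn hηC hηc hηs hηκ
  have w4 : ∫ y in D, (gdot p η y - gdot (quadF x0 R) η y) = 0 := by
    rw [integral_sub i1 i2, ← w3, w1, w2]; ring
  have e1 : ∀ y ∈ D, gdot p η y - gdot (quadF x0 R) η y = ψ (h y) * ‖fderiv ℝ h y‖^2 := by
    intro y hy
    have hd : fderiv ℝ h y = fderiv ℝ p y - fderiv ℝ (quadF x0 R) y := by
      have a1 := ((hp.contDiffAt (hD.mem_nhds hy)).differentiableAt one_ne_zero).hasFDerivAt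
      have a2 := (hqC.differentiable two_ne_zero y).hasFDerivAt
      exact (a1.sub a2).fderiv
    rw [clm_norm_sq]
    unfold gdot
    rw [(hηD y hy).fderiv, hd]; simp; ring
  rw [setIntegral_congr_fun hD.measurableSet e1] at w4
  have i3 : IntegrableOn (fun y => ψ (h y) * ‖fderiv ℝ h y‖^2) D :=
    (i1.sub i2).congr_fun e1 hD.measurableSet
  have hco : ContinuousOn (fun y => ψ (h y) * ‖fderiv ℝ h y‖^2) D :=
    (hψc.comp_continuousOn hhC.continuousOn).mul ((hhC.continuousOn_fderiv_of_isOpen hD le_rfl).norm.pow 2)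
  rw [setIntegral_eq_zero_iff_of_nonneg_ae (ae_of_all _ fun y => mul_nonneg (hψ0 _) (sq_nonneg _)) i3] at w4
  have w5 := Measure.eqOn_open_of_ae_eq w4 hD hco continuousOn_const hx
  have w6 : ψ (h x) * ‖fderiv ℝ h x‖^2 = 0 := w5
  have hψx : ψ (h x) = ε := by simp [hψ, ← hv, hε0.le]
  rw [hψx] at w6
  have := (mul_eq_zero.1 w6).resolve_left hε0.ne'
  exact norm_eq_zero.1 (pow_eq_zero_iff two_ne_zero |>.1 this)

/-- conclusion: `p` is the quadratic -/
lemma conv_eq {D U : Set E2} {p : E2 → ℝ} {k R : ℝ} {x0 : E2} (hD : IsOpen D) (hDb : Bornology.IsBounded D)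
    (hDc : IsPreconnected D)
    (hUb : Bornology.IsBounded U) (hUD : closure U ∩ D = ∅) (hp : ContDiffOn ℝ 1 p D)
    (hpc : ContinuousOn p (closure D))
    (hcont : Continuous (qB D U (fun x => p x - quadF x0 R x) k))
    (hw : ∀ (η : E2 → ℝ) (κ : ℝ), ContDiff ℝ 1 η → HasCompactSupport η → tsupport η ⊆ D ∪ closure U →
      (∀ x ∈ closure U, ∀ᶠ y in 𝓝 x, η y = κ) → ∫ x in D, gdot p η x = 2 * ∫ x, η x)
    (hz : ∃ z ∈ closure D, p z - quadF x0 R z = 0) (hz' : ∃ z ∈ closure D, p z - quadF x0 R z = k) :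
    ∀ x ∈ D, p x = quadF x0 R x := by
  set h : E2 → ℝ := fun x => p x - quadF x0 R x with hh
  have hhC : ContDiffOn ℝ 1 h D := hp.sub ((quadF_contDiff x0 R).of_le (by norm_num)).contDiffOn
  have hhc : ContinuousOn h (closure D) := hpc.sub (quadF_contDiff x0 R).continuous.continuousOn
  have hder : ∀ x ∈ D, HasFDerivAt (fun y => h y ^2 * (3*k - 2*h y)) (0 : E2 →L[ℝ] ℝ) x := by
    intro x hx
    have h1 : HasFDerivAt h (fderiv ℝ h x) x := ((hhC.contDiffAt (hD.mem_nhds hx)).differentiableAt one_ne_zero).hasFDerivAt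
    have h2 : HasDerivAt (fun r : ℝ => r^2 * (3*k - 2*r)) (6 * (h x * (k - h x))) (h x) := by
      have := ((hasDerivAt_id (h x)).pow 2).mul (((hasDerivAt_id (h x)).const_mul 2).const_sub (3*k))
      refine this.congr_deriv ?_
      simp; ring
    have h3 := h2.comp_hasFDerivAt x h1
    refine h3.congr_fderiv ?_
    by_cases a0 : h x = 0
    · simp [a0]
    by_cases ak : h x = k
    · simp [ak]
    rw [energy hD hDb hUb hUD hp hcont hw hx a0 ak]; simp
  obtain ⟨a, ha⟩ := hD.exists_is_const_of_fderiv_eq_zero (𝕜 := ℝ) hDc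
    (fun x hx => (hder x hx).differentiableAt.differentiableWithinAt) (fun x hx => (hder x hx).fderiv)
  have hcl : ∀ x ∈ closure D, h x ^2 * (3*k - 2*h x) = a := by
    have hE : EqOn (fun y => h y ^2 * (3*k - 2*h y)) (fun _ => a) D := fun x hx => ha x hx
    have := hE.of_subset_closure ((hhc.pow 2).mul (continuousOn_const.sub (continuousOn_const.mul hhc)))
      continuousOn_const subset_closure subset_rfl
    exact fun x hx => this hx
  obtain ⟨z, hz, hz0⟩ := hz
  obtain ⟨z', hz', hzk⟩ := hz'
  have c1 := hcl z hz
  have c2 := hcl z' hz'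
  have hz0 : h z = 0 := hz0
  have hzk : h z' = k := hzk
  rw [hz0] at c1
  rw [hzk] at c2
  have a0 : a = 0 := by rw [← c1]; ring
  have k0 : k = 0 := by
    rw [a0] at c2
    have : k^3 = 0 := by linarith
    exact pow_eq_zero_iff three_ne_zero |>.1 this
  intro x hx
  have c3 := ha x hx
  rw [a0, k0] at c3
  have : h x ^ 3 = 0 := by linarith
  have := pow_eq_zero_iff three_ne_zero |>.1 this
  exact sub_eq_zero.1 this

lemma quad_int (x0 : E2) {r1 R : ℝ} (h1 : 0 ≤ r1) (h2 : r1 < R) (S : Set E2) (T : Set ℝ) (hT : MeasurableSet T)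
    (hS : ∀ x, x ∈ S ↔ dist x x0 ∈ T) (hTI : Ioi 0 ∩ T = Ioo r1 R) :
    ∫ x in S, quadF x0 R x = π * (R^2 - r1^2)^2 / 4 := by
  have hSm : MeasurableSet S := by
    have : S = (fun x => dist x x0) ⁻¹' T := by ext x; exact hS x
    rw [this]; exact (by fun_prop : Continuous fun x : E2 => dist x x0).measurable hT
  rw [← integral_indicator hSm]
  set f : ℝ → ℝ := T.indicator (fun y => (R^2 - y^2)/2) with hf
  have e1 : S.indicator (quadF x0 R) = fun x => f ‖x - x0‖ := by
    ext x
    rw [← dist_eq_norm]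
    by_cases hx : x ∈ S
    · rw [indicator_of_mem hx, hf, indicator_of_mem ((hS x).1 hx)]; rfl
    · rw [indicator_of_notMem hx, hf, indicator_of_notMem (fun h => hx ((hS x).2 h))]
  rw [e1, integral_sub_right_eq_self (fun x : E2 => f ‖x‖) x0, integral_fun_norm_addHaar, finrank_E2]
  have hb : volume.real (ball (0:E2) 1) = π := by rw [vol_ball _ zero_le_one]; ring
  rw [hb]
  have e2 : ∫ y in Ioi (0:ℝ), y^(2-1) • f y = ∫ y in Ioo r1 R, y * ((R^2 - y^2)/2) := by
    have : (fun y : ℝ => y^(2-1) • f y) = T.indicator (fun y => y * ((R^2 - y^2)/2)) := by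
      ext y; by_cases hy : y ∈ T <;> simp [hf, hy]
    rw [this, setIntegral_indicator hT, hTI]
  rw [e2, ← integral_Ioc_eq_integral_Ioo, ← intervalIntegral.integral_of_le h2.le]
  have e3 : ∫ y in r1..R, y * ((R^2 - y^2)/2) = (R^2*R^2/4 - R^4/8) - (R^2*r1^2/4 - r1^4/8) := by
    refine intervalIntegral.integral_eq_sub_of_hasDerivAt (f := fun y => R^2*y^2/4 - y^4/8) (fun y _ => ?_)
      ((by fun_prop : Continuous fun y : ℝ => y * ((R^2 - y^2)/2)).intervalIntegrable _ _)
    have := (((hasDerivAt_id y).pow 2).const_mul (R^2) |>.div_const 4).sub (((hasDerivAt_id y).pow 4).div_const 8)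
    refine this.congr_deriv ?_
    simp; ring
  rw [e3]; simp; ring

lemma quad_ball (x0 : E2) {R : ℝ} (hR : 0 < R) :
    ∫ x in ball x0 R, quadF x0 R x = volume.real (ball x0 R) ^2 / (4*π) := by
  rw [quad_int x0 le_rfl hR (ball x0 R) (Iio R) measurableSet_Iio (fun x => by simp) (by ext y; simp), vol_ball x0 hR.le]
  have := pi_pos
  field_simp; ring

lemma quad_ann (x0 : E2) {r1 R : ℝ} (hr : 0 < r1) (hR : r1 < R) :
    ∫ x in ann x0 r1 R, quadF x0 R x = volume.real (ann x0 r1 R) ^2 / (4*π) := by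
  rw [quad_int x0 hr.le hR (ann x0 r1 R) (Ioo r1 R) measurableSet_Ioo (fun x => by simp [ann])
    (by ext y; simp; intro h _; linarith), vol_ann x0 hr.le hR]
  have := pi_pos
  field_simp
end

section
lemma no_preconn {A B : Set E2} (hA : IsClosed A) (hB : IsClosed B) (hd : Disjoint A B) (hAn : A.Nonempty) (hBn : B.Nonempty)
    (h : IsPreconnected (A ∪ B)) : False := by
  rw [isPreconnected_closed_iff] at h
  obtain ⟨x, hx⟩ := h A B hA hB subset_rfl (hAn.mono fun x hx => ⟨Or.inl hx, hx⟩) (hBn.mono fun x hx => ⟨Or.inr hx, hx⟩)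
  exact Set.disjoint_left.1 hd hx.2.1 hx.2.2

lemma ann_open (x0 : E2) (r1 r2 : ℝ) : IsOpen (ann x0 r1 r2) := by
  rw [ann_eq]; exact isOpen_ball.sdiff isClosed_closedBall

lemma closure_ann (x0 : E2) {r1 r2 : ℝ} (h1 : 0 < r1) (h2 : r1 < r2) :
    closure (ann x0 r1 r2) = {x | r1 ≤ dist x x0 ∧ dist x x0 ≤ r2} := by
  apply subset_antisymm
  · refine closure_minimal (fun x hx => ⟨hx.1.le, hx.2.le⟩) ?_
    have hdc : Continuous fun x : E2 => dist x x0 := by fun_prop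
    exact (isClosed_le continuous_const hdc).inter (isClosed_le hdc continuous_const)
  · intro x hx
    have hx1 : r1 ≤ dist x x0 := hx.1
    have hx2 : dist x x0 ≤ r2 := hx.2
    have hd : 0 < dist x x0 := by linarith
    set f : ℝ → E2 := fun s => x0 + s • (x - x0) with hf
    have hfc : Continuous f := by fun_prop
    have hf1 : f 1 = x := by simp [hf]
    have hfd : ∀ s, 0 ≤ s → dist (f s) x0 = s * dist x x0 := by
      intro s hs
      rw [dist_eq_norm, dist_eq_norm]; simp [hf, norm_smul, abs_of_nonneg hs]
    have hfd' : Continuous fun s : ℝ => s * dist x x0 := by fun_prop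
    rcases lt_or_ge (dist x x0) r2 with h | h
    · refine mem_closure_of_tendsto (f := f) (b := 𝓝[>] (1:ℝ)) ?_ ?_
      · have := hfc.tendsto 1; rw [hf1] at this; exact this.mono_left nhdsWithin_le_nhds
      · have : ∀ᶠ s in 𝓝[>] (1:ℝ), s * dist x x0 < r2 :=
          ((hfd'.tendsto 1).mono_left nhdsWithin_le_nhds).eventually_lt_const (by simpa using h)
        filter_upwards [this, self_mem_nhdsWithin] with s hs hs1
        have hs1 : 1 < s := hs1
        have e := hfd s (by linarith)
        refine ⟨?_, ?_⟩ <;> rw [e]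
        · nlinarith
        · exact hs
    · have hr : dist x x0 = r2 := le_antisymm hx2 h
      refine mem_closure_of_tendsto (f := f) (b := 𝓝[<] (1:ℝ)) ?_ ?_
      · have := hfc.tendsto 1; rw [hf1] at this; exact this.mono_left nhdsWithin_le_nhds
      · have : ∀ᶠ s in 𝓝[<] (1:ℝ), r1 < s * dist x x0 :=
          ((hfd'.tendsto 1).mono_left nhdsWithin_le_nhds).eventually_const_lt (by simp only [one_mul]; linarith)
        have h0 : ∀ᶠ s in 𝓝[<] (1:ℝ), 0 < s :=
          (tendsto_id.mono_left nhdsWithin_le_nhds).eventually_const_lt (by norm_num : (0:ℝ) < 1)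
        filter_upwards [this, h0, self_mem_nhdsWithin] with s hs h0 hs1
        have hs1 : s < 1 := hs1
        have e := hfd s h0.le
        refine ⟨?_, ?_⟩ <;> rw [e]
        · exact hs
        · nlinarith

lemma frontier_ann (x0 : E2) {r1 r2 : ℝ} (h1 : 0 < r1) (h2 : r1 < r2) :
    frontier (ann x0 r1 r2) = sphere x0 r1 ∪ sphere x0 r2 := by
  rw [(ann_open x0 r1 r2).frontier_eq, closure_ann x0 h1 h2]
  ext x
  simp only [Set.mem_sdiff, ann, mem_ofPred_eq, mem_union, mem_sphere, not_and, not_lt]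
  constructor
  · rintro ⟨⟨a, b⟩, c⟩
    rcases a.lt_or_eq with h | h
    · right; exact le_antisymm b (c h)
    · left; exact h.symm
  · rintro (h | h)
    · exact ⟨⟨h.ge, by linarith⟩, fun h' => absurd h h'.ne'⟩
    · exact ⟨⟨by linarith, h.le⟩, fun h' => h.ge⟩

lemma sphere_disj (x0 : E2) {r1 r2 : ℝ} (h2 : r1 < r2) : Disjoint (sphere x0 r1) (sphere x0 r2) := by
  rw [Set.disjoint_left]
  intro x hx hx'
  rw [mem_sphere] at hx hx'; linarith

lemma curve_conn {w : ℝ → E2} (hw : ContDiff ℝ 1 w) : IsPreconnected (w '' Icc 0 1) :=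
  isPreconnected_Icc.image w hw.continuous.continuousOn

lemma curve_comp {w : ℝ → E2} (hw : ContDiff ℝ 1 w) : IsCompact (w '' Icc 0 1) :=
  isCompact_Icc.image hw.continuous

lemma curve_ne (w : ℝ → E2) : (w '' Icc (0:ℝ) 1).Nonempty := ⟨w 0, 0, by simp, rfl⟩

lemma sphere_ne (x0 : E2) {r : ℝ} (hr : 0 ≤ r) : (sphere x0 r).Nonempty := by
  have : Nontrivial E2 := Module.nontrivial_of_finrank_pos (R := ℝ) (by rw [finrank_E2]; norm_num)
  exact NormedSpace.sphere_nonempty.2 hr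

lemma convA {x0 : E2} {R : ℝ} (hR : 0 < R) {p : E2 → ℝ} (hp2 : ContDiffOn ℝ 2 p (ball x0 R))
    (hpc : ContinuousOn p (closure (ball x0 R))) (hl : ∀ x ∈ ball x0 R, lap p x = -2)
    (hf : ∀ x ∈ frontier (ball x0 R), p x = 0) :
    ∫ x in ball x0 R, p x = volume.real (ball x0 R) ^2 / (4*π) := by
  have hfr := frontier_ball x0 hR.ne'
  have hh0 : ∀ x ∈ sphere x0 R, p x - quadF x0 R x = 0 := by
    intro x hx
    rw [hf x (by rw [hfr]; exact hx)]
    rw [mem_sphere] at hx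
    simp [quadF, hx]
  have hz : ∃ z ∈ closure (ball x0 R), p z - quadF x0 R z = 0 := by
    obtain ⟨z, hz⟩ := sphere_ne x0 hR.le
    exact ⟨z, by rw [closure_ball x0 hR.ne']; exact sphere_subset_closedBall hz, hh0 z hz⟩
  have := conv_eq (U := ∅) (k := 0) (x0 := x0) (R := R) isOpen_ball isBounded_ball (convex_ball x0 R).isPreconnected
    Bornology.isBounded_empty (by simp) (hp2.of_le (by norm_num)) hpc
    (qB_cont isOpen_ball (hpc.sub (quadF_contDiff x0 R).continuous.continuousOn) (fun x hx => by
      right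
      refine ⟨by simp, fun hxc => hh0 x ?_⟩
      rw [← hfr, isOpen_ball.frontier_eq]; exact ⟨hxc, hx⟩))
    (fun η κ h1 h2 h3 _ => by
      rw [weak_loc isOpen_ball hp2 hl h1 h2 (by simpa using h3), neg_neg]) hz hz
  rw [setIntegral_congr_fun measurableSet_ball this, quad_ball x0 hR]

lemma ann_curves {wo wi : Set E2} {U : Set E2} {x0 : E2} {r1 R : ℝ} (h1 : 0 < r1) (hR : r1 < R)
    (cwo : IsPreconnected wo) (cwi : IsPreconnected wi) (nwi : wi.Nonempty)
    (hf : frontier (ann x0 r1 R) = wo ∪ wi)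
    (hU : IsOpen U) (hUb : Bornology.IsBounded U) (hfU : frontier U = wi) (hUD : closure U ∩ ann x0 r1 R = ∅) :
    wo = sphere x0 R ∧ wi = sphere x0 r1 ∧ U = ball x0 r1 := by
  have hR0 : 0 < R := h1.trans hR
  rw [frontier_ann x0 h1 hR] at hf
  have hdj := sphere_disj x0 hR
  have sub : ∀ s : Set E2, IsPreconnected s → s ⊆ sphere x0 r1 ∪ sphere x0 R → s ⊆ sphere x0 r1 ∨ s ⊆ sphere x0 R := by
    intro s hs hss
    exact isPreconnected_iff_subset_of_disjoint_closed.1 hs _ _ isClosed_sphere isClosed_sphere hss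
      (by rw [hdj.inter_eq]; simp)
  have hwi : wi ⊆ sphere x0 r1 := by
    refine (sub wi cwi (by rw [hf]; exact subset_union_right)).resolve_right ?_
    intro hc
    have a1 : U ⊆ closedBall x0 R := max_dist hR0.le hU hUb (by rw [hfU]; exact hc.trans sphere_subset_closedBall)
    have a2 : U ⊆ ball x0 R := by
      have := interior_maximal a1 hU
      rwa [interior_closedBall x0 hR0.ne'] at this
    have a3 : U ⊆ closedBall x0 r1 := by
      intro u hu
      rw [mem_closedBall]
      by_contra! hcon
      have : u ∈ closure U ∩ ann x0 r1 R := ⟨subset_closure hu, hcon, a2 hu⟩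
      rw [hUD] at this; exact this
    obtain ⟨z, hz⟩ := nwi
    have b1 : dist z x0 = R := hc hz
    have b2 : z ∈ closure U := by rw [← hfU] at hz; exact frontier_subset_closure hz
    have b3 : dist z x0 ≤ r1 := closure_minimal a3 isClosed_closedBall b2
    linarith
  have hwo : wo ⊆ sphere x0 R := by
    refine (sub wo cwo (by rw [hf]; exact subset_union_left)).resolve_left ?_
    intro hc
    obtain ⟨z, hz⟩ := sphere_ne x0 hR0.le
    have : z ∈ wo ∪ wi := by rw [← hf]; exact Or.inr hz
    have hz1 : z ∈ sphere x0 r1 := this.elim (fun h => hc h) (fun h => hwi h)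
    exact Set.disjoint_left.1 hdj hz1 hz
  have e1 : wo = sphere x0 R := by
    apply subset_antisymm hwo
    intro z hz
    have : z ∈ wo ∪ wi := by rw [← hf]; exact Or.inr hz
    exact this.resolve_right fun h => Set.disjoint_left.1 hdj (hwi h) hz
  have e2 : wi = sphere x0 r1 := by
    apply subset_antisymm hwi
    intro z hz
    have : z ∈ wo ∪ wi := by rw [← hf]; exact Or.inl hz
    exact this.resolve_left fun h => Set.disjoint_left.1 hdj hz (hwo h)
  refine ⟨e1, e2, ?_⟩
  have a1 : U ⊆ closedBall x0 r1 := max_dist h1.le hU hUb (by rw [hfU]; exact hwi.trans sphere_subset_closedBall)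
  have a2 : U ⊆ ball x0 r1 := by
    have := interior_maximal a1 hU
    rwa [interior_closedBall x0 h1.ne'] at this
  refine subset_antisymm a2 ?_
  have hUne : U.Nonempty := by
    obtain ⟨z, hz⟩ := nwi
    rw [← hfU] at hz
    exact closure_nonempty_iff.1 ⟨z, frontier_subset_closure hz⟩
  obtain ⟨u, hu⟩ := hUne
  refine side_of (convex_ball x0 r1).isPreconnected hU ?_ ⟨u, a2 hu, hu⟩
  rw [hfU, e2]
  intro z hz hz'
  rw [mem_ball] at hz; rw [mem_sphere] at hz'; linarith

variable {w N : ℝ → E2} {δ : ℝ} {U : Set E2}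

lemma convB {x0 : E2} {r1 R : ℝ} (h1 : 0 < r1) (hR : r1 < R) (H : Sides w N δ (ann x0 r1 R) U) {G : Set E2} {c : ℝ}
    (cG : IsPreconnected G) (cw : IsPreconnected (w '' Icc 0 1))
    (hU : IsOpen U) (hUb : Bornology.IsBounded U) (hfU : frontier U = w '' Icc 0 1)
    (hfD : frontier (ann x0 r1 R) = G ∪ w '' Icc 0 1)
    (hUD : closure U ∩ (ann x0 r1 R) = ∅) {p : E2 → ℝ} (hp2 : ContDiffOn ℝ 2 p (ann x0 r1 R))
    (hp : ContDiffOn ℝ 1 p (closure (ann x0 r1 R)))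
    (hl : ∀ x ∈ ann x0 r1 R, lap p x = -2) (hpG : ∀ x ∈ G, p x = 0) (hpw : ∀ x ∈ w '' Icc 0 1, p x = c)
    (hfl : ∫ t in (0:ℝ)..1, fderivWithin ℝ p (closure (ann x0 r1 R)) (w t) (perp2 (deriv w t)) = -2 * (volume U).toReal) :
    ∫ x in ann x0 r1 R, p x = volume.real (ann x0 r1 R) ^2 / (4*π) := by
  obtain ⟨e1, e2, e3⟩ := ann_curves h1 hR cG cw (curve_ne w) hfD hU hUb hfU hUD
  have hpc := hp.continuousOn
  have hR0 : 0 < R := h1.trans hR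
  have hDo := ann_open x0 r1 R
  have hDb : Bornology.IsBounded (ann x0 r1 R) := isBounded_ball.subset (fun x hx => hx.2 : ann x0 r1 R ⊆ ball x0 R)
  set k := c - (R^2 - r1^2)/2 with hk
  have hhR : ∀ x ∈ sphere x0 R, p x - quadF x0 R x = 0 := by
    intro x hx
    rw [hpG x (by rw [e1]; exact hx)]
    rw [mem_sphere] at hx
    simp [quadF, hx]
  have hhr : ∀ x ∈ sphere x0 r1, p x - quadF x0 R x = k := by
    intro x hx
    rw [hpw x (by rw [e2]; exact hx)]
    rw [mem_sphere] at hx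
    simp [quadF, hx, hk]
  have hcl := closure_ann x0 h1 hR
  have hclU : closure U = closedBall x0 r1 := by rw [e3, closure_ball x0 h1.ne']
  have hz : ∃ z ∈ closure (ann x0 r1 R), p z - quadF x0 R z = 0 := by
    obtain ⟨z, hz⟩ := sphere_ne x0 hR0.le
    have hz' : dist z x0 = R := hz
    exact ⟨z, by rw [hcl]; exact ⟨by linarith, by linarith⟩, hhR z hz⟩
  have hz' : ∃ z ∈ closure (ann x0 r1 R), p z - quadF x0 R z = k := by
    obtain ⟨z, hz⟩ := sphere_ne x0 h1.le
    have hz' : dist z x0 = r1 := hz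
    exact ⟨z, by rw [hcl]; exact ⟨by linarith, by linarith⟩, hhr z hz⟩
  have := conv_eq (U := U) (k := k) (x0 := x0) (R := R) hDo hDb (ann_conn x0 h1.le)
    hUb hUD (hp2.of_le (by norm_num)) hpc
    (qB_cont hDo (hpc.sub (quadF_contDiff x0 R).continuous.continuousOn) (fun x hx => by
      rw [hclU, hcl]
      rcases le_or_gt (dist x x0) r1 with h | h
      · left
        refine ⟨h, fun hxc => hhr x (le_antisymm h hxc.1), ?_⟩
        have : ball x0 R ∈ 𝓝 x := isOpen_ball.mem_nhds (by rw [mem_ball]; linarith)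
        filter_upwards [this] with y hy
        rcases le_or_gt (dist y x0) r1 with h | h
        · right; exact h
        · left; exact ⟨h, hy⟩
      · right
        refine ⟨fun h' => absurd h' (not_le.2 h), fun hxc => hhR x (le_antisymm hxc.2 ?_)⟩
        by_contra! hcon
        exact hx ⟨h, hcon⟩))
    (fun η κ a1 a2 a3 a4 => H.flux_weak hDo hDb hU hUb hfU hUD hp2 hp hl hfl a1 a2 a3 a4) hz hz'
  rw [setIntegral_congr_fun hDo.measurableSet this, quad_ann x0 h1 hR]
end

lemma finish {D : Set E2} {p : E2 → ℝ} (hD : IsOpen D) (hDb : Bornology.IsBounded D) (hpc : ContinuousOn p (closure D))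
    (hne : D.Nonempty) (H : DropH D p)
    (hr : sSup (p '' D) = volume.real D / (2*π) → IsDiskOrAnnulus D)
    (hc : IsDiskOrAnnulus D → (∫ x in D, p x) = volume.real D ^ 2 / (4*π)) :
    (∀ x ∈ D, p x ≤ (volume D).toReal / (2 * π)) ∧
    (∫ x in D, p x ≤ (volume D).toReal ^ 2 / (4 * π)) ∧
    (sSup (p '' D) = (volume D).toReal / (2 * π) ↔ IsDiskOrAnnulus D) ∧
    ((∫ x in D, p x) = (volume D).toReal ^ 2 / (4 * π) ↔ IsDiskOrAnnulus D) := by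
  rw [← measureReal_def]
  obtain ⟨h1, h2⟩ := H.int_le hD hDb hpc hne
  exact ⟨fun x hx => H.sup_le hD hDb (hpc.mono subset_closure) hx, h1, ⟨hr, fun h => h2 (hc h)⟩, ⟨fun h => hr (h2 h), hc⟩⟩

lemma ne_of_frontier {D : Set E2} (h : (frontier D).Nonempty) : D.Nonempty := by
  obtain ⟨z, hz⟩ := h
  exact closure_nonempty_iff.1 ⟨z, frontier_subset_closure hz⟩

theorem stmt13 (D : Set E2) (p : E2 → ℝ) (a : ℝ) (ha : 0 < a)
    (hD : IsOpen D) (hDb : Bornology.IsBounded D)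
    (hp2 : ContDiffOn ℝ 2 p D) (hp1 : ContDiffOn ℝ 1 p (closure D))
    (hlap : ∀ x ∈ D, lap p x = -2)
    (hcase :
      (∃ w : ℝ → E2, ∃ ℓ Ka : ℝ, 0 < ℓ ∧ Periodic w 1 ∧ ContDiff ℝ 1 w ∧
        (∀ s t : ℝ, ‖deriv w s - deriv w t‖ ≤ Ka * |s - t| ^ a) ∧
        (∀ t : ℝ, ‖deriv w t‖ = ℓ) ∧ InjOn w (Ico (0:ℝ) 1) ∧
        frontier D = w '' Icc 0 1 ∧
        SimplyConnectedSpace D ∧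
        (∀ x ∈ frontier D, p x = 0)) ∨
      (∃ wo wi : ℝ → E2, ∃ ℓo ℓi Ka : ℝ, ∃ U : Set E2, ∃ c : ℝ,
        0 < ℓo ∧ 0 < ℓi ∧
        Periodic wo 1 ∧ ContDiff ℝ 1 wo ∧
        (∀ s t : ℝ, ‖deriv wo s - deriv wo t‖ ≤ Ka * |s - t| ^ a) ∧
        (∀ t : ℝ, ‖deriv wo t‖ = ℓo) ∧ InjOn wo (Ico (0:ℝ) 1) ∧
        Periodic wi 1 ∧ ContDiff ℝ 1 wi ∧
        (∀ s t : ℝ, ‖deriv wi s - deriv wi t‖ ≤ Ka * |s - t| ^ a) ∧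
        (∀ t : ℝ, ‖deriv wi t‖ = ℓi) ∧ InjOn wi (Ico (0:ℝ) 1) ∧
        frontier D = wo '' Icc 0 1 ∪ wi '' Icc 0 1 ∧
        Disjoint (wo '' Icc 0 1) (wi '' Icc 0 1) ∧
        ¬ SimplyConnectedSpace D ∧
        IsOpen U ∧ Bornology.IsBounded U ∧ frontier U = wi '' Icc 0 1 ∧
        closure U ∩ D = ∅ ∧
        (∀ x ∈ wo '' Icc (0:ℝ) 1, p x = 0) ∧
        (∀ x ∈ wi '' Icc (0:ℝ) 1, p x = c) ∧
        (∀ t : ℝ, ∀ᶠ s in 𝓝[>] (0:ℝ),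
          wi t + s • (ℓi⁻¹ • perp2 (deriv wi t)) ∉ closure U) ∧
        (∫ t in (0:ℝ)..1, fderivWithin ℝ p (closure D) (wi t) (perp2 (deriv wi t))
          = -2 * (volume U).toReal))) :
    (∀ x ∈ D, p x ≤ (volume D).toReal / (2 * π)) ∧
    (∫ x in D, p x ≤ (volume D).toReal ^ 2 / (4 * π)) ∧
    (sSup (p '' D) = (volume D).toReal / (2 * π) ↔ IsDiskOrAnnulus D) ∧
    ((∫ x in D, p x) = (volume D).toReal ^ 2 / (4 * π) ↔ IsDiskOrAnnulus D) := by
  have hpc := hp1.continuousOn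
  rcases hcase with ⟨w, ℓ, Ka, hℓ, pw, hw, hH, hn, hinj, hfD, -, hp0⟩ |
    ⟨wo, wi, ℓo, ℓi, Ka, U, c, hℓo, hℓi, pwo, hwo, hHo, hno, hinjo, pwi, hwi, hHi, hni, hinji, hfD, hdis, -, hU, hUb, hfU,
      hUD, hpo, hpi, hnor, hfl⟩
  · have hne : D.Nonempty := ne_of_frontier (by rw [hfD]; exact curve_ne w)
    have hf : ∀ x ∈ frontier D, p x ≤ 0 := fun x hx => (hp0 x hx).le
    refine finish hD hDb hpc hne (dropA hD hDb hp2 hpc hlap hf)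
      (fun h => Or.inl (rigidA hD hDb hp2 hpc hne hlap hf h)) ?_
    rintro (⟨x0, r, hr, rfl⟩ | ⟨x0, r1, r2, h1, h2, hDe⟩)
    · exact convA hr hp2 hpc hlap hp0
    · exfalso
      have hDe : D = ann x0 r1 r2 := hDe
      rw [hDe, frontier_ann x0 h1 h2] at hfD
      refine no_preconn isClosed_sphere isClosed_sphere (sphere_disj x0 h2) (sphere_ne x0 h1.le)
        (sphere_ne x0 (h1.trans h2).le) ?_
      rw [hfD]; exact curve_conn hw
  · have hne : D.Nonempty := ne_of_frontier (by rw [hfD]; exact (curve_ne wo).mono subset_union_left)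
    have hUne : U.Nonempty := ne_of_frontier (by rw [hfU]; exact curve_ne wi)
    obtain ⟨N, δ0, HC, -⟩ := exists_collar ha hℓi pwi hwi hHi hni hinji
    obtain ⟨δ, H⟩ := HC.sides hℓi hni hD hU hfD hfU (curve_comp hwo) hdis hUD hnor
    have hconv : IsDiskOrAnnulus D → (∫ x in D, p x) = volume.real D ^ 2 / (4*π) := by
      rintro (⟨x0, r, hr, rfl⟩ | ⟨x0, r1, r2, h1, h2, hDe⟩)
      · exfalso
        rw [frontier_ball x0 hr.ne'] at hfD
        refine no_preconn (curve_comp hwo).isClosed (curve_comp hwi).isClosed hdis (curve_ne wo) (curve_ne wi) ?_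
        rw [← hfD]
        apply isPreconnected_sphere
        rw [← Module.finrank_eq_rank, finrank_E2]; exact_mod_cast one_lt_two
      · have hDe : D = ann x0 r1 r2 := hDe
        subst hDe
        exact convB h1 h2 H (curve_conn hwo) (curve_conn hwi) hU hUb hfU hfD hUD hp2 hp1 hlap hpo hpi hfl
    rcases le_or_gt c 0 with hc | hc
    · have hf : ∀ x ∈ frontier D, p x ≤ 0 := by
        intro x hx
        rw [hfD] at hx
        rcases hx with hx | hx
        · exact (hpo x hx).le
        · rw [hpi x hx]; exact hc
      exact finish hD hDb hpc hne (dropA hD hDb hp2 hpc hlap hf)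
        (fun h => Or.inl (rigidA hD hDb hp2 hpc hne hlap hf h)) hconv
    · have hf : ∀ x ∈ frontier D, p x ≤ c := by
        intro x hx
        rw [hfD] at hx
        rcases hx with hx | hx
        · rw [hpo x hx]; exact hc.le
        · exact (hpi x hx).le
      have HB := H.coreB hD hDb hU hUb hfU hfD hUD hp2 hp1 hlap hpo hpi hc hfl
      have hnull : volume (frontier U) = 0 := by rw [hfU]; exact H.null
      exact finish hD hDb hpc hne (dropB hD hDb hp2 hpc hlap hc hf hUb hU hUD hnull hUne HB)
        (fun h => rigidB H hD hDb hne hUne hU hUb hfU hfD hUD hp2 hp1 hlap hpo hpi hc HB h) hconv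

end
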